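/- arXiv:1304.2448 — 2 statements merged into one kernel-verified Lean document; each statement's English description precedes it below -/
import Mathlib

section
/- Let M be a simple non-regular binary matroid of rank r ≥ 8 with no AG(3,2)-minor and with |M| ≥ (r choose 2) + 4. Then M is 3-connected. -/
open Matroid Set

variable {α : Type*}

/-- Deletion of a set of elements from a matroid. -/
def Matroid.del (M : Matroid α) (D : Set α) : Matroid α := M ↾ (M.E \ D)

/-- Contraction of a set of elements in a matroid, defined by duality. -/
def Matroid.con (M : Matroid α) (C : Set α) : Matroid α := ((M✶).del C)✶

/-- `N` is a minor of `M` if it is obtained from `M` by a contraction followed by a deletion. -/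
def Matroid.IsMinorOf (N M : Matroid α) : Prop := ∃ C D : Set α, N = (M.con C).del D

/-- `C` is a circuit of `M`: a dependent set all of whose proper subsets are independent. -/
def Matroid.IsCircuitSet (M : Matroid α) (C : Set α) : Prop :=
  M.Dep C ∧ ∀ D ⊂ C, M.Indep D

/-- A matroid is simple if it has no circuits of size one or two, equivalently every
one- or two-element subset of the ground set is independent. -/
def Matroid.IsSimpleM (M : Matroid α) : Prop := ∀ e ∈ M.E, ∀ f ∈ M.E, M.Indep {e, f}

/-- The rank of a set `X` in a matroid `M`: the supremum of the sizes of independent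
subsets of `X`. -/
noncomputable def Matroid.rks (M : Matroid α) (X : Set α) : ℕ :=
  sSup {n : ℕ | ∃ I ⊆ X, M.Indep I ∧ I.ncard = n}

/-- The rank of a matroid. -/
noncomputable def Matroid.rkM (M : Matroid α) : ℕ := M.rks M.E

/-- `M` is represented over the field `F` by the vector assignment `φ`:
a subset of the ground set is independent iff `φ` is linearly independent on it. -/
def Matroid.IsRepBy (M : Matroid α) (F : Type*) [Field F] {W : Type*} [AddCommGroup W]
    [Module F W] (φ : α → W) : Prop :=
  ∀ I ⊆ M.E, (M.Indep I ↔ LinearIndependent F (I.restrict φ))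

/-- `M` is representable over the field `F`. -/
def Matroid.IsRepOver (M : Matroid α) (F : Type) [Field F] : Prop :=
  ∃ (n : ℕ) (φ : α → (Fin n → F)), M.IsRepBy F φ

/-- A binary matroid is one representable over the two-element field `GF(2)`. -/
def Matroid.IsBinaryM (M : Matroid α) : Prop := M.IsRepOver (ZMod 2)

/-- A regular matroid is one representable over every field. -/
def Matroid.IsRegularM (M : Matroid α) : Prop := ∀ (F : Type) [Field F], M.IsRepOver F

/-- `M` is isomorphic to the binary vector matroid on the set of vectors `V`:
there is a representation of `M` over `GF(2)` mapping the ground set bijectively to `V`. -/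
def Matroid.IsBinaryIsoTo (M : Matroid α) {W : Type*} [AddCommGroup W] [Module (ZMod 2) W]
    (V : Set W) : Prop :=
  ∃ φ : α → W, M.IsRepBy (ZMod 2) φ ∧ Set.BijOn φ M.E V

/-- The eight points of the binary affine cube `AG(3,2)`: the vectors `(1, x)` in `GF(2)⁴`. -/
def agVecs : Set (Fin 4 → ZMod 2) := {x | x 0 = 1}

/-- `M` has a minor isomorphic to `AG(3,2)`. -/
def Matroid.HasAGMinor (M : Matroid α) : Prop :=
  ∃ N : Matroid α, N.IsMinorOf M ∧ N.IsBinaryIsoTo agVecs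

/-- The seven points of the Fano plane `F₇`: the nonzero vectors of `GF(2)³`. -/
def fanoVecs : Set (Fin 3 → ZMod 2) := {x | x ≠ 0}

/-- The vectors `eᵢ + eⱼ` (`i ≠ j`) representing the graphic matroid `M(K_n)`. -/
def kVecs (n : ℕ) : Set (Fin n → ZMod 2) :=
  {x | ∃ i j : Fin n, i ≠ j ∧ x = Pi.single i 1 + Pi.single j 1}

/-- `ℓ` is a line (3-element circuit) of `M` through `x`. -/
def Matroid.IsLineThru (M : Matroid α) (x : α) (ℓ : Set α) : Prop :=
  M.IsCircuitSet ℓ ∧ ℓ.ncard = 3 ∧ x ∈ ℓ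

/-- A matroid is connected if it is nonempty and every two distinct elements of the
ground set lie in a common circuit. -/
def Matroid.IsConnectedM (M : Matroid α) : Prop :=
  M.E.Nonempty ∧ ∀ e ∈ M.E, ∀ f ∈ M.E, e ≠ f →
    ∃ C, M.IsCircuitSet C ∧ e ∈ C ∧ f ∈ C

/-- A matroid is 3-connected if it is connected and has no 2-separation, i.e. no partition
`(A, B)` of the ground set with `|A| ≥ 2`, `|B| ≥ 2` and `r(A) + r(B) - r(M) ≤ 1`. -/
def Matroid.IsThreeConnected (M : Matroid α) : Prop :=
  M.IsConnectedM ∧ ¬ ∃ A B : Set α, A ∪ B = M.E ∧ Disjoint A B ∧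
    2 ≤ A.ncard ∧ 2 ≤ B.ncard ∧ M.rks A + M.rks B ≤ M.rkM + 1

namespace AGB
open Submodule

lemma z2 (c : ZMod 2) : c = 0 ∨ c = 1 := by revert c; decide

section core
variable {V : Type} [AddCommGroup V] [Module (ZMod 2) V]

lemma dbl (x : V) : x + x = 0 := ZModModule.add_self x

lemma dbl2 (x y : V) : x + (x + y) = y := by rw [← add_assoc, dbl, zero_add]

lemma dbl3 (x y : V) : x + y + y = x := by rw [add_assoc, dbl, add_zero]

lemma add_eq_zero_iff' (x y : V) : x + y = 0 ↔ x = y := by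
  constructor
  · intro h
    have := dbl3 x y
    rw [h, zero_add] at this
    exact this.symm
  · rintro rfl; exact dbl x

/-- Vector form of having an `AG(3,2)`-minor: modulo the span of a subset `C` of `S`, two cosets
of the plane spanned by `d, e` are contained in `S`. -/
def AGm (S : Set V) : Prop :=
  ∃ (C : Set V) (d e z w : V), C ⊆ S ∧
    (∀ a b c f : ZMod 2, a • d + b • e + c • z + f • w ∈ span (ZMod 2) C →
      a = 0 ∧ b = 0 ∧ c = 0 ∧ f = 0) ∧
    ∀ a b : ZMod 2, (∃ s ∈ S, s + (z + a • d + b • e) ∈ span (ZMod 2) C) ∧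
      (∃ s ∈ S, s + (w + a • d + b • e) ∈ span (ZMod 2) C)

lemma AGm.mk' {S : Set V} (C : Set V) (hC : C ⊆ S) (D : Submodule (ZMod 2) V) {d e z w : V}
    (hCD : C ⊆ D) (hdD : d ∈ D) (heD : e ∈ D)
    (hd : d ∉ span (ZMod 2) C) (he : e ∉ span (ZMod 2) C) (hde : d + e ∉ span (ZMod 2) C)
    (hz : z ∉ D) (hw : w ∉ D) (hzw : z + w ∉ D)
    (hz0 : ∃ s ∈ S, s + z ∈ span (ZMod 2) C)
    (hz1 : ∃ s ∈ S, s + (z + d) ∈ span (ZMod 2) C)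
    (hz2 : ∃ s ∈ S, s + (z + e) ∈ span (ZMod 2) C)
    (hz3 : ∃ s ∈ S, s + (z + d + e) ∈ span (ZMod 2) C)
    (hw0 : ∃ s ∈ S, s + w ∈ span (ZMod 2) C)
    (hw1 : ∃ s ∈ S, s + (w + d) ∈ span (ZMod 2) C)
    (hw2 : ∃ s ∈ S, s + (w + e) ∈ span (ZMod 2) C)
    (hw3 : ∃ s ∈ S, s + (w + d + e) ∈ span (ZMod 2) C) : AGm S := by
  refine ⟨C, d, e, z, w, hC, ?_, ?_⟩
  · intro a b c f h
    have hD : a • d + b • e + c • z + f • w ∈ D := (span_le.2 hCD) h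
    have h1 : c • z + f • w ∈ D := by
      have := D.sub_mem hD (D.add_mem (D.smul_mem a hdD) (D.smul_mem b heD))
      convert this using 1
      abel
    have h2 : c = 0 ∧ f = 0 := by
      rcases z2 c with rfl | rfl <;> rcases z2 f with rfl | rfl <;> simp_all
    obtain ⟨rfl, rfl⟩ := h2
    rcases z2 a with rfl | rfl <;> rcases z2 b with rfl | rfl <;> simp_all
  · intro a b
    rcases z2 a with rfl | rfl <;> rcases z2 b with rfl | rfl <;>
      simp only [zero_smul, one_smul, add_zero] <;> constructor <;> assumption

lemma AGm.mk0 {S : Set V} (D : Submodule (ZMod 2) V) {d e z w : V}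
    (hdD : d ∈ D) (heD : e ∈ D)
    (hd : d ≠ 0) (he : e ≠ 0) (hde : d ≠ e)
    (hz : z ∉ D) (hw : w ∉ D) (hzw : z + w ∉ D)
    (hz0 : z ∈ S) (hz1 : z + d ∈ S) (hz2 : z + e ∈ S) (hz3 : z + d + e ∈ S)
    (hw0 : w ∈ S) (hw1 : w + d ∈ S) (hw2 : w + e ∈ S) (hw3 : w + d + e ∈ S) : AGm S := by
  have key : ∀ v ∈ S, ∃ s ∈ S, s + v ∈ span (ZMod 2) (∅ : Set V) :=
    fun v hv => ⟨v, hv, by simp [dbl]⟩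
  refine AGm.mk' ∅ (by simp) D (by simp) hdD heD (by simpa) (by simpa) ?_ hz hw hzw
    (key _ hz0) (key _ hz1) (key _ hz2) (key _ hz3) (key _ hw0) (key _ hw1) (key _ hw2)
    (key _ hw3)
  simpa [add_eq_zero_iff'] using hde

lemma AGm.mono {S S' : Set V} (h : S ⊆ S') (hS : AGm S) : AGm S' := by
  obtain ⟨C, d, e, z, w, hC, h1, h2⟩ := hS
  refine ⟨C, d, e, z, w, hC.trans h, h1, fun a b => ?_⟩
  obtain ⟨⟨s, hs, hs'⟩, ⟨t, ht, ht'⟩⟩ := h2 a b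
  exact ⟨⟨s, h hs, hs'⟩, ⟨t, h ht, ht'⟩⟩

variable {U : Type} [AddCommGroup U] [Module (ZMod 2) U]

/-- Image under an injective linear map. -/
lemma AGm.image {S : Set V} (f : V →ₗ[ZMod 2] U) (hf : Function.Injective f) (hS : AGm S) :
    AGm (f '' S) := by
  obtain ⟨C, d, e, z, w, hC, h1, h2⟩ := hS
  have key : ∀ v, f v ∈ span (ZMod 2) (f '' C) ↔ v ∈ span (ZMod 2) C := by
    intro v
    rw [span_image, mem_map]
    constructor
    · rintro ⟨y, hy, hyv⟩
      rwa [← hf hyv]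
    · intro h; exact ⟨v, h, rfl⟩
  refine ⟨f '' C, f d, f e, f z, f w, Set.image_mono hC, ?_, ?_⟩
  · intro a b c g h
    simp only [← map_smul, ← map_add, key] at h
    exact h1 a b c g h
  · intro a b
    obtain ⟨⟨s, hs, hs'⟩, ⟨t, ht, ht'⟩⟩ := h2 a b
    refine ⟨⟨f s, ⟨s, hs, rfl⟩, ?_⟩, ⟨f t, ⟨t, ht, rfl⟩, ?_⟩⟩
    · simp only [← map_smul, ← map_add, key]; exact hs'
    · simp only [← map_smul, ← map_add, key]; exact ht'

/-- Contraction. -/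
lemma AGm.of_contract {S : Set V} {x : V} (hx : x ∈ S) {T : Set (V ⧸ span (ZMod 2) {x})}
    (hT : T ⊆ (span (ZMod 2) {x}).mkQ '' S) (h : AGm T) : AGm S := by
  set q := (span (ZMod 2) {x}).mkQ with hq
  obtain ⟨C', d', e', z', w', hC, h1, h2⟩ := h.mono hT
  obtain ⟨d, rfl⟩ := mkQ_surjective _ d'
  obtain ⟨e, rfl⟩ := mkQ_surjective _ e'
  obtain ⟨z, rfl⟩ := mkQ_surjective _ z'
  obtain ⟨w, rfl⟩ := mkQ_surjective _ w'
  rw [← hq] at *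
  let C : Set V := insert x (S ∩ q ⁻¹' C')
  have hqx : q x = 0 := by
    rw [hq, mkQ_apply, Quotient.mk_eq_zero]; exact mem_span_singleton_self x
  have hCq : map q (span (ZMod 2) C) = span (ZMod 2) C' := by
    rw [map_span]
    apply le_antisymm
    · rw [span_le]
      rintro _ ⟨y, hy, rfl⟩
      rcases hy with rfl | hy
      · rw [hqx]; exact zero_mem _
      · exact subset_span hy.2
    · apply span_mono
      intro y hy
      obtain ⟨s, hs, rfl⟩ := hC hy
      exact ⟨s, Or.inr ⟨hs, hy⟩, rfl⟩
  have hker : ∀ v, q v ∈ span (ZMod 2) C' ↔ v ∈ span (ZMod 2) C := by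
    intro v
    rw [← hCq, mem_map]
    constructor
    · rintro ⟨y, hy, hyv⟩
      have : v - y ∈ span (ZMod 2) {x} := by
        rw [← Quotient.mk_eq_zero, ← mkQ_apply]
        change q (v - y) = 0
        rw [map_sub, hyv, sub_self]
      have h3 : v - y ∈ span (ZMod 2) C :=
        span_mono (Set.singleton_subset_iff.2 (Set.mem_insert x _)) this
      have := add_mem h3 hy
      rwa [sub_add_cancel] at this
    · intro hv; exact ⟨v, hv, rfl⟩
  refine ⟨C, d, e, z, w, ?_, ?_, ?_⟩
  · rintro y (rfl | hy)
    · exact hx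
    · exact hy.1
  · intro a b c f h
    apply h1 a b c f
    simp only [← map_smul, ← map_add, hker]; exact h
  · intro a b
    obtain ⟨⟨s', ⟨s, hs, rfl⟩, hs'⟩, ⟨t', ⟨t, ht, rfl⟩, ht'⟩⟩ := h2 a b
    simp only [← map_smul, ← map_add, hker] at hs' ht'
    exact ⟨⟨s, hs, hs'⟩, ⟨t, ht, ht'⟩⟩

end core
end AGB

namespace AGB
open Submodule Module

section two
variable {V : Type} [AddCommGroup V] [Module (ZMod 2) V]

/-- The quotient map by the line spanned by `x`. -/
abbrev qm (x : V) : V →ₗ[ZMod 2] V ⧸ span (ZMod 2) {x} := (span (ZMod 2) {x}).mkQ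

lemma mem_span1 (x y : V) : y ∈ span (ZMod 2) {x} ↔ y = 0 ∨ y = x := by
  rw [mem_span_singleton]
  constructor
  · rintro ⟨a, rfl⟩
    rcases z2 a with rfl | rfl <;> simp
  · rintro (rfl | rfl)
    · exact ⟨0, by simp⟩
    · exact ⟨1, by simp⟩

lemma qm_zero_iff (x y : V) : qm x y = 0 ↔ y = 0 ∨ y = x := by
  rw [mkQ_apply, Quotient.mk_eq_zero, mem_span1]

lemma qm_self (x : V) : qm x x = 0 := by rw [qm_zero_iff]; simp

lemma qm_eq_iff (x y z : V) : qm x y = qm x z ↔ y = z ∨ y = z + x := by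
  rw [← add_eq_zero_iff', ← map_add, qm_zero_iff, add_eq_zero_iff']
  constructor
  · rintro (h | h)
    · exact Or.inl h
    · right; rw [← h, add_comm y z, dbl2]
  · rintro (h | h)
    · exact Or.inl h
    · right; rw [h, add_comm z x, dbl3]

lemma finrank_qm [Finite V] {x : V} (hx : x ≠ 0) :
    finrank (ZMod 2) (V ⧸ span (ZMod 2) {x}) + 1 = finrank (ZMod 2) V := by
  rw [← finrank_span_singleton (K := ZMod 2) hx]
  exact finrank_quotient_add_finrank _

instance qfin [Finite V] (x : V) : Finite (V ⧸ span (ZMod 2) {x}) :=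
  Finite.of_surjective _ (mkQ_surjective _)

/-- `W` is a Fano plane all of whose points lie in `S`. -/
def F7 (W : Submodule (ZMod 2) V) (S : Set V) : Prop :=
  finrank (ZMod 2) W = 3 ∧ ∀ w ∈ W, w ≠ 0 → w ∈ S

lemma fact1 [Finite V] {W : Submodule (ZMod 2) V} {S : Set V} (hF : F7 W S) {z d e : V}
    (hz : z ∉ W) (hd : d ∈ W) (he : e ∈ W) (hd0 : d ≠ 0) (he0 : e ≠ 0) (hde : d ≠ e)
    (h0 : z ∈ S) (h1 : z + d ∈ S) (h2 : z + e ∈ S) (h3 : z + d + e ∈ S) : AGm S := by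
  have hDW : span (ZMod 2) {d, e} ≤ W := by
    rw [span_le]; rintro y (rfl | rfl) <;> assumption
  have hdD : d ∈ span (ZMod 2) {d, e} := subset_span (by simp)
  have heD : e ∈ span (ZMod 2) {d, e} := subset_span (by simp)
  obtain ⟨g, hgW, hgD⟩ : ∃ g ∈ W, g ∉ span (ZMod 2) {d, e} := by
    classical
    by_contra! hcon
    have h := finrank_mono (R := ZMod 2) (show W ≤ span (ZMod 2) {d, e} from hcon)
    have h' : finrank (ZMod 2) (span (ZMod 2) ({d, e} : Set V)) ≤ ({d, e} : Finset V).card :=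
      by
        have h3 := finrank_span_finset_le_card (R := ZMod 2) ({d, e} : Finset V)
        rwa [Finset.coe_pair] at h3
    have h'' : ({d, e} : Finset V).card ≤ 2 := Finset.card_le_two
    rw [hF.1] at h
    omega
  have key : ∀ u ∈ span (ZMod 2) {d, e}, g + u ∈ S := by
    intro u hu
    apply hF.2 _ (add_mem hgW (hDW hu))
    intro h
    rw [add_eq_zero_iff'] at h
    exact hgD (h ▸ hu)
  refine AGm.mk0 (span (ZMod 2) {d, e}) hdD heD hd0 he0 hde (fun h => hz (hDW h)) hgD ?_
    h0 h1 h2 h3 ?_ (key _ hdD) (key _ heD) ?_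
  · intro h
    have := add_mem (hDW h) hgW
    rw [dbl3] at this
    exact hz this
  · simpa using key 0 (zero_mem _)
  · rw [add_assoc]; exact key _ (add_mem hdD heD)

lemma qm_injOn {W : Submodule (ZMod 2) V} {x : V} (hx : x ∉ W) {a b : V} (ha : a ∈ W) (hb : b ∈ W)
    (h : qm x a = qm x b) : a = b := by
  rw [qm_eq_iff] at h
  rcases h with h | h
  · exact h
  · exfalso; apply hx
    have := add_mem hb ha
    rwa [h, dbl2] at this

lemma mem_map_qm {W : Submodule (ZMod 2) V} {x v : V} :
    qm x v ∈ W.map (qm x) ↔ v ∈ W ∨ v + x ∈ W := by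
  constructor
  · rintro ⟨w, hw, h⟩
    rcases (qm_eq_iff _ _ _).1 h with h | h
    · left; rw [← h]; exact hw
    · right; rw [← h]; exact hw
  · rintro (h | h)
    · exact mem_map_of_mem h
    · refine ⟨_, h, ?_⟩
      rw [qm_eq_iff]; right; rfl

lemma F7.contract [Finite V] {W : Submodule (ZMod 2) V} {S : Set V} (hF : F7 W S) {x : V}
    (hxW : x ∉ W) {T : Set (V ⧸ span (ZMod 2) {x})} (hT : ∀ s ∈ S, qm x s ≠ 0 → qm x s ∈ T) :
    F7 (W.map (qm x)) T := by
  constructor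
  · rw [← hF.1]
    have hi : Function.Injective ((qm x).domRestrict W) := by
      intro a b h
      exact Subtype.ext (qm_injOn hxW a.2 b.2 h)
    have := LinearMap.finrank_range_of_inj hi
    rw [LinearMap.range_domRestrict] at this
    exact this
  · rintro _ ⟨w, hw, rfl⟩ h0
    apply hT _ _ h0
    apply hF.2 _ hw
    rintro rfl
    simp at h0

/-- Two `d`-pairs in the same coset pair, with respect to contraction of `z₁`. -/
lemma fact2 [Finite V] {W : Submodule (ZMod 2) V} {S : Set V} (hF : F7 W S) {z₀ e z d : V}
    (hz₀ : z₀ ∉ W) (he : e ∈ W) (he0 : e ≠ 0) (hd : d ∈ W) (hd0 : d ≠ 0) (hde : d ≠ e)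
    (hz₁ : z₀ + e ∈ S) (hz : z ∉ W) (hzz : z + z₀ ∉ W)
    (h0 : z ∈ S) (h1 : z + d ∈ S) (h2 : z + z₀ ∈ S) (h3 : z + z₀ + d ∈ S) : AGm S := by
  have hx : z₀ + e ∉ W := fun h => hz₀ ((W.add_mem_iff_left he).1 h)
  refine AGm.of_contract hz₁ (T := qm (z₀ + e) '' S) subset_rfl ?_
  have hF' := hF.contract hx (T := qm (z₀ + e) '' S) (fun s hs _ => ⟨s, hs, rfl⟩)
  have hne : ∀ w ∈ W, w ≠ 0 → qm (z₀ + e) w ≠ 0 := by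
    intro w hw h0 h
    rcases (qm_zero_iff _ _).1 h with h | h
    · exact h0 h
    · exact hx (h ▸ hw)
  refine fact1 hF' (z := qm (z₀ + e) z) (d := qm _ d) (e := qm _ e) ?_ (mem_map_of_mem hd)
    (mem_map_of_mem he) (hne d hd hd0) (hne e he he0) (fun h => hde (qm_injOn hx hd he h))
    ⟨z, h0, rfl⟩ ⟨_, h1, by rw [map_add]⟩ ⟨_, h2, ?_⟩ ⟨_, h3, ?_⟩
  · rw [mem_map_qm]
    rintro (h | h)
    · exact hz h
    · rw [← add_assoc] at h
      exact hzz ((W.add_mem_iff_left he).1 h)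
  · rw [← map_add, qm_eq_iff]; right
    rw [show z + e + (z₀ + e) = z + z₀ + (e + e) by abel, dbl, add_zero]
  · rw [← map_add, ← map_add, qm_eq_iff]; right
    rw [show z + d + e + (z₀ + e) = z + z₀ + d + (e + e) by abel, dbl, add_zero]

/-- Two classes of collisions in the same direction `d` form an affine cube. -/
lemma fact3 [Finite V] {W : Submodule (ZMod 2) V} {S : Set V} {z₀ z z' d : V}
    (hz₀ : z₀ ∉ W) (hd : d ∈ W) (hd0 : d ≠ 0) (hz : z ∉ W) (hzz : z + z₀ ∉ W)
    (hz' : z' ∉ W) (hzz' : z' + z₀ ∉ W)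
    (h0 : z ∈ S) (h1 : z + d ∈ S) (h2 : z + z₀ ∈ S) (h3 : z + z₀ + d ∈ S)
    (h0' : z' ∈ S) (h1' : z' + d ∈ S) (h2' : z' + z₀ ∈ S) (h3' : z' + z₀ + d ∈ S)
    (hAG : ¬ AGm S) : z' = z ∨ z' = z + d ∨ z' = z + z₀ ∨ z' = z + z₀ + d := by
  by_contra! hne
  apply hAG
  have hmem : ∀ v, v ∈ span (ZMod 2) {d, z₀} → v = 0 ∨ v = d ∨ v = z₀ ∨ v = z₀ + d := by
    intro v hv
    rw [mem_span_pair] at hv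
    obtain ⟨a, b, rfl⟩ := hv
    rcases z2 a with rfl | rfl <;> rcases z2 b with rfl | rfl <;> simp [add_comm]
  have hno : ∀ v, v ∉ W → v + z₀ ∉ W → v ∉ span (ZMod 2) {d, z₀} := by
    intro v hv hv' h
    rcases hmem v h with rfl | rfl | rfl | rfl
    · exact hv (zero_mem _)
    · exact hv hd
    · apply hv'; rw [dbl]; exact zero_mem _
    · apply hv'; rw [add_comm z₀ d, dbl3]; exact hd
  refine AGm.mk0 (span (ZMod 2) {d, z₀}) (d := d) (e := z₀) (z := z) (w := z')
    (subset_span (by simp)) (subset_span (by simp)) hd0 ?_ ?_ (hno _ hz hzz) (hno _ hz' hzz') ?_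
    h0 h1 h2 ?_ h0' h1' h2' ?_
  · rintro rfl; exact hz₀ (zero_mem _)
  · rintro rfl; exact hz₀ hd
  · intro h
    have key : ∀ v, z + z' = v → z' = z + v := by rintro v rfl; rw [dbl2]
    rcases hmem _ h with h | h | h | h
    · have := key _ h; simp at this; exact hne.1 this
    · exact hne.2.1 (key _ h)
    · exact hne.2.2.1 (key _ h)
    · apply hne.2.2.2; rw [add_assoc]; exact key _ h
  · rw [add_right_comm]; exact h3
  · rw [add_right_comm]; exact h3'

end two
end AGB

namespace AGB
open Submodule Module
open scoped Classical

/-- Counting with a map all of whose fibres are contained in orbits of an involution. -/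
lemma two_fold {A B : Type} (X : Finset A) (Y : Finset B) (f : A → B) (σ : A → A)
    (hf : ∀ a ∈ X, f a ∈ Y) (hσ2 : ∀ a, σ (σ a) = a)
    (h : ∀ a ∈ X, ∀ b ∈ X, f a = f b → b = a ∨ b = σ a) :
    2 * X.card ≤ 2 * Y.card + (X.filter (fun a => σ a ∈ X)).card := by
  have h1 := Finset.card_eq_sum_card_fiberwise (f := f) (s := X) (t := Y) hf
  have h2 := Finset.card_eq_sum_card_fiberwise (f := f) (s := X.filter (fun a => σ a ∈ X))
    (t := Y) (fun a ha => hf a (Finset.mem_filter.1 ha).1)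
  rw [h1, h2, Finset.mul_sum, mul_comm 2 Y.card, ← smul_eq_mul Y.card 2, ← Finset.sum_const,
    ← Finset.sum_add_distrib]
  apply Finset.sum_le_sum
  intro y hy
  by_cases hc : (X.filter (fun a => f a = y)).card ≤ 1
  · omega
  · push Not at hc
    obtain ⟨a, ha, b, hb, hab⟩ := Finset.one_lt_card.1 hc
    rw [Finset.mem_filter] at ha hb
    have hbσ : b = σ a := by
      rcases h a ha.1 b hb.1 (ha.2.trans hb.2.symm) with h | h
      · exact absurd h.symm hab
      · exact h
    have hsub : X.filter (fun a => f a = y) ⊆ {a, b} := by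
      intro c hcm
      rw [Finset.mem_filter] at hcm
      rcases h a ha.1 c hcm.1 (ha.2.trans hcm.2.symm) with h | h
      · simp [h]
      · simp [h, hbσ]
    have hsub2 : {a, b} ⊆ (X.filter (fun a => σ a ∈ X)).filter (fun a => f a = y) := by
      intro c hcm
      simp only [Finset.mem_insert, Finset.mem_singleton] at hcm
      simp only [Finset.mem_filter]
      rcases hcm with rfl | rfl
      · exact ⟨⟨ha.1, hbσ ▸ hb.1⟩, ha.2⟩
      · refine ⟨⟨hb.1, ?_⟩, hb.2⟩
        rw [hbσ, hσ2]; exact ha.1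
    have e1 := Finset.card_le_card hsub
    have e2 := Finset.card_le_card hsub2
    rw [Finset.card_pair hab] at e1 e2
    omega

section three
variable {V : Type} [AddCommGroup V] [Module (ZMod 2) V] [Fintype V]

/-- Ordered pairs `{z, z + d}` in `S` outside `W` with direction `d` in `W`. -/
noncomputable def NN (S : Finset V) (W : Submodule (ZMod 2) V) : Finset (V × V) :=
  Finset.univ.filter
    (fun p => p.1 ∈ W ∧ p.1 ≠ 0 ∧ p.2 ∉ W ∧ p.2 ∈ S ∧ p.2 + p.1 ∈ S)

/-- The nonzero elements of `W`. -/
noncomputable def WW (W : Submodule (ZMod 2) V) : Finset V :=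
  Finset.univ.filter (fun d => d ∈ W ∧ d ≠ 0)

lemma card_WW {W : Submodule (ZMod 2) V} (hW : finrank (ZMod 2) W = 3) : (WW W).card = 7 := by
  have h1 : (Finset.univ.filter (fun d => d ∈ W)).card = 8 := by
    have := Module.card_eq_pow_finrank (K := ZMod 2) (V := W)
    rw [hW, ZMod.card] at this
    rw [← Fintype.card_subtype]
    norm_num at this
    convert this using 1
  have h2 : WW W = (Finset.univ.filter (fun d => d ∈ W)).erase 0 := by
    ext d; simp [WW, and_comm]
  rw [h2, Finset.card_erase_of_mem (by simp), h1]

lemma card_by_dir {W : Submodule (ZMod 2) V} (hW : finrank (ZMod 2) W = 3) (X : Finset (V × V))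
    (k : ℕ) (hX : ∀ p ∈ X, p.1 ∈ W ∧ p.1 ≠ 0)
    (h : ∀ d ∈ W, d ≠ 0 → (X.filter (fun p => p.1 = d)).card ≤ k) : X.card ≤ 7 * k := by
  rw [Finset.card_eq_sum_card_fiberwise (f := Prod.fst) (s := X) (t := WW W)
    (fun p hp => by simpa [WW] using hX p hp), ← card_WW hW, ← smul_eq_mul, ← Finset.sum_const]
  apply Finset.sum_le_sum
  intro d hd
  simp only [WW, Finset.mem_filter, Finset.mem_univ, true_and] at hd
  exact h d hd.1 hd.2

/-- points of `S` in the coset of `z₀`. -/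
noncomputable def AA (S : Finset V) (W : Submodule (ZMod 2) V) (z₀ : V) : Finset V :=
  S.filter (fun z => z + z₀ ∈ W)

/-- pairs of `NN` in the coset of `z₀`. -/
noncomputable def N0 (S : Finset V) (W : Submodule (ZMod 2) V) (z₀ : V) : Finset (V × V) :=
  (NN S W).filter (fun p => p.2 + z₀ ∈ W)

lemma card_N0_eq (S : Finset V) (W : Submodule (ZMod 2) V) {z₀ : V} (hz₀ : z₀ ∉ W) :
    (N0 S W z₀).card = (AA S W z₀).card * (AA S W z₀).card - (AA S W z₀).card := by
  rw [← Finset.offDiag_card]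
  refine Finset.card_bij' (fun p _ => (p.2, p.2 + p.1)) (fun p _ => (p.1 + p.2, p.1)) ?_ ?_ ?_ ?_
  · rintro ⟨d, z⟩ h
    simp only [N0, NN, Finset.mem_filter, Finset.mem_univ, true_and] at h
    obtain ⟨⟨h1, h2, h3, h4, h5⟩, h6⟩ := h
    simp only [Finset.mem_offDiag, AA, Finset.mem_filter]
    refine ⟨⟨h4, h6⟩, ⟨h5, ?_⟩, ?_⟩
    · rw [add_right_comm]; exact add_mem h6 h1
    · simpa using h2
  · rintro ⟨a, b⟩ h
    simp only [Finset.mem_offDiag, AA, Finset.mem_filter] at h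
    obtain ⟨⟨h1, h2⟩, ⟨h3, h4⟩, h5⟩ := h
    simp only [N0, NN, Finset.mem_filter, Finset.mem_univ, true_and]
    refine ⟨⟨?_, ?_, ?_, h1, ?_⟩, h2⟩
    · have := add_mem h2 h4
      rwa [show a + z₀ + (b + z₀) = a + b + (z₀ + z₀) by abel, dbl, add_zero] at this
    · rwa [Ne, add_eq_zero_iff']
    · intro h
      exact hz₀ ((W.add_mem_iff_right h).1 h2)
    · rwa [dbl2]
  · rintro ⟨d, z⟩ h
    simp [dbl2]
  · rintro ⟨a, b⟩ h
    simp [dbl2]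

lemma card_AA_le {S : Finset V} {W : Submodule (ZMod 2) V} (hF : F7 W (S : Set V))
    (hAG : ¬ AGm (S : Set V)) {z₀ : V} (hz₀ : z₀ ∉ W) : (AA S W z₀).card ≤ 4 := by
  have h14 : (N0 S W z₀).card ≤ 7 * 2 := by
    apply card_by_dir hF.1
    · rintro ⟨d, z⟩ h
      simp only [N0, NN, Finset.mem_filter, Finset.mem_univ, true_and] at h
      exact ⟨h.1.1, h.1.2.1⟩
    · intro d hd hd0
      rcases Finset.eq_empty_or_nonempty ((N0 S W z₀).filter (fun p => p.1 = d)) with h | ⟨p, hp⟩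
      · rw [h]; simp
      obtain ⟨d', z⟩ := p
      simp only [N0, NN, Finset.mem_filter, Finset.mem_univ, true_and] at hp
      obtain ⟨⟨⟨h1, h2, h3, h4, h5⟩, h6⟩, rfl⟩ := hp
      refine (Finset.card_le_card (t := {(d', z), (d', z + d')}) ?_).trans Finset.card_le_two
      rintro ⟨d, y⟩ hp
      simp only [N0, NN, Finset.mem_filter, Finset.mem_univ, true_and] at hp
      obtain ⟨⟨⟨g1, g2, g3, g4, g5⟩, g6⟩, rfl⟩ := hp
      simp only [Finset.mem_insert, Finset.mem_singleton, Prod.mk.injEq, true_and]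
      by_contra! hne
      apply hAG
      have hzy : z + y ∈ W := by
        have := add_mem h6 g6
        rwa [show z + z₀ + (y + z₀) = z + y + (z₀ + z₀) by abel, dbl, add_zero] at this
      refine fact1 hF (z := z) (d := d) (e := z + y) h3 h1 hzy h2 ?_ ?_ h4 h5 ?_ ?_
      · rw [Ne, add_eq_zero_iff']; exact fun h => hne.1 h.symm
      · rintro h
        apply hne.2
        rw [h, dbl2]
      · rw [dbl2]; exact g4
      · rw [show z + d + (z + y) = z + (z + (y + d)) by abel, dbl2]; exact g5
  rw [card_N0_eq S W hz₀] at h14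
  by_contra! h
  have : (AA S W z₀).card * 5 ≤ (AA S W z₀).card * (AA S W z₀).card :=
    Nat.mul_le_mul_left _ h
  omega

lemma card_N0_le {S : Finset V} {W : Submodule (ZMod 2) V} (hF : F7 W (S : Set V))
    (hAG : ¬ AGm (S : Set V)) {z₀ : V} (hz₀ : z₀ ∉ W) : (N0 S W z₀).card ≤ 12 := by
  rw [card_N0_eq S W hz₀]
  have := card_AA_le hF hAG hz₀
  interval_cases (AA S W z₀).card <;> norm_num

/-- The simplification of the contraction of `x`. -/
noncomputable def SC (S : Finset V) (x : V) : Finset (V ⧸ span (ZMod 2) {x}) :=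
  (S.image (qm x)).erase 0

lemma mem_SC {S : Finset V} {x : V} {y} : y ∈ SC S x ↔ y ≠ 0 ∧ ∃ s ∈ S, qm x s = y := by
  simp [SC]

lemma SC_AG {S : Finset V} {x : V} (hx : x ∈ S) (hAG : ¬ AGm (S : Set V)) :
    ¬ AGm (SC S x : Set (V ⧸ span (ZMod 2) {x})) := by
  intro h
  apply hAG
  refine AGm.of_contract (S := (S : Set V)) (x := x) hx ?_ h
  intro y hy
  obtain ⟨_, s, hs, rfl⟩ := mem_SC.1 hy
  exact ⟨s, hs, rfl⟩

lemma SC_F7 {S : Finset V} {W : Submodule (ZMod 2) V} (hF : F7 W (S : Set V)) {x : V}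
    (hx : x ∉ W) : F7 (W.map (qm x)) (SC S x : Set (V ⧸ span (ZMod 2) {x})) := by
  apply hF.contract hx
  intro s hs h
  exact mem_SC.2 ⟨h, s, hs, rfl⟩

end three

lemma klemma (n : ℕ) : ∀ (V : Type) [AddCommGroup V] [Module (ZMod 2) V] [Fintype V]
    (S : Finset V) (W : Submodule (ZMod 2) V), finrank (ZMod 2) V = n + 3 → F7 W (S : Set V) →
    ¬ AGm (S : Set V) → (NN S W).card = 0 ∨ (NN S W).card + 2 ≤ 14 * n := by
  induction n with
  | zero =>
    intro V _ _ _ S W hV hF hAG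
    left
    have hW : W = ⊤ := by
      apply eq_top_of_finrank_eq
      rw [hF.1, hV]
    rw [Finset.card_eq_zero]
    simp [NN, hW]
  | succ n ih =>
    intro V _ _ _ S W hV hF hAG
    by_cases hz : ∃ z₀ ∈ S, z₀ ∉ W
    swap
    · push Not at hz
      left
      rw [Finset.card_eq_zero, NN, Finset.filter_eq_empty_iff]
      rintro ⟨d, z⟩ - ⟨h1, h2, h3, h4, h5⟩
      exact h3 (hz _ h4)
    obtain ⟨z₀, hz₀S, hz₀⟩ := hz
    have hz₀0 : z₀ ≠ 0 := by rintro rfl; exact hz₀ (zero_mem _)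
    have : Fintype (V ⧸ span (ZMod 2) {z₀}) := Fintype.ofFinite _
    have ih' := ih (V ⧸ span (ZMod 2) {z₀}) (SC S z₀) (W.map (qm z₀))
      (by have := finrank_qm hz₀0; omega) (SC_F7 hF hz₀) (SC_AG hz₀S hAG)
    set N1 := (NN S W).filter (fun p => ¬ (p.2 + z₀ ∈ W)) with hN1
    have hsplit : (N0 S W z₀).card + N1.card = (NN S W).card :=
      Finset.card_filter_add_card_filter_not _
    have hN0 := card_N0_le hF hAG hz₀
    have hm1 : ∀ d z, (d, z) ∈ N1 ↔ (d ∈ W ∧ d ≠ 0 ∧ z ∉ W ∧ z ∈ S ∧ z + d ∈ S) ∧ z + z₀ ∉ W := by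
      intro d z; simp [hN1, NN]
    have hfold := two_fold N1 (NN (SC S z₀) (W.map (qm z₀)))
      (fun p => (qm z₀ p.1, qm z₀ p.2)) (fun p => (p.1, p.2 + z₀))
      (by
        rintro ⟨d, z⟩ h
        obtain ⟨⟨h1, h2, h3, h4, h5⟩, h6⟩ := (hm1 d z).1 h
        have hzn : qm z₀ z ∉ W.map (qm z₀) := by rw [mem_map_qm]; tauto
        have hzdn : qm z₀ (z + d) ∉ W.map (qm z₀) := by
          rw [mem_map_qm]
          rintro (h | h)
          · exact h3 ((W.add_mem_iff_left h1).1 h)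
          · rw [add_right_comm] at h
            exact h6 ((W.add_mem_iff_left h1).1 h)
        simp only [NN, Finset.mem_filter, Finset.mem_univ, true_and]
        refine ⟨mem_map_of_mem h1, ?_, hzn, ?_, ?_⟩
        · intro h
          rcases (qm_zero_iff _ _).1 h with h | h
          · exact h2 h
          · exact hz₀ (h ▸ h1)
        · refine mem_SC.2 ⟨?_, z, h4, rfl⟩
          intro h; rw [h] at hzn; exact hzn (zero_mem _)
        · rw [← map_add]
          refine mem_SC.2 ⟨?_, z + d, h5, rfl⟩
          intro h; rw [h] at hzdn; exact hzdn (zero_mem _))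
      (by rintro ⟨d, z⟩; simp [dbl3])
      (by
        rintro ⟨d, z⟩ h ⟨d', z'⟩ h' heq
        simp only [Prod.mk.injEq] at heq ⊢
        obtain ⟨⟨h1, -⟩, -⟩ := (hm1 d z).1 h
        obtain ⟨⟨h1', -⟩, -⟩ := (hm1 d' z').1 h'
        have : d' = d := (qm_injOn hz₀ h1 h1' heq.1).symm
        rcases (qm_eq_iff _ _ _).1 heq.2.symm with h | h
        · left; exact ⟨this, h⟩
        · right; exact ⟨this, h⟩)
    set Cs := N1.filter (fun p => (p.1, p.2 + z₀) ∈ N1) with hCs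
    have hfold' : 2 * N1.card ≤ 2 * (NN (SC S z₀) (W.map (qm z₀))).card + Cs.card := by
      convert hfold
    clear hfold
    have hmC : ∀ d z, (d, z) ∈ Cs → d ∈ W ∧ d ≠ 0 ∧ z ∉ W ∧ z + z₀ ∉ W ∧ z ∈ S ∧ z + d ∈ S ∧
        z + z₀ ∈ S ∧ z + z₀ + d ∈ S := by
      intro d z h
      rw [hCs, Finset.mem_filter] at h
      have h1 := (hm1 _ _).1 h.1
      have h2 := (hm1 _ _).1 h.2
      tauto
    have hC4 : ∀ d ∈ W, d ≠ 0 → (Cs.filter (fun p => p.1 = d)).card ≤ 4 := by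
      intro d hd hd0
      rcases Finset.eq_empty_or_nonempty (Cs.filter (fun p => p.1 = d)) with h | ⟨p, hp⟩
      · rw [h]; simp
      obtain ⟨d', z⟩ := p
      rw [Finset.mem_filter] at hp
      obtain ⟨hp, rfl⟩ := hp
      obtain ⟨h1, h2, h3, h4, h5, h6, h7, h8⟩ := hmC _ _ hp
      refine (Finset.card_le_card
        (t := {(d', z), (d', z + d'), (d', z + z₀), (d', z + z₀ + d')}) ?_).trans Finset.card_le_four
      rintro ⟨d, y⟩ hq
      rw [Finset.mem_filter] at hq
      obtain ⟨hq, rfl⟩ := hq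
      obtain ⟨g1, g2, g3, g4, g5, g6, g7, g8⟩ := hmC _ _ hq
      have := fact3 hz₀ h1 h2 h3 h4 g3 g4 h5 h6 h7 h8 g5 g6 g7 g8 hAG
      simpa using this
    right
    by_cases hz1 : ∃ z₁ ∈ AA S W z₀, z₁ ≠ z₀
    · obtain ⟨z₁, hz1, hne⟩ := hz1
      simp only [AA, Finset.mem_filter] at hz1
      have hCc : Cs.card ≤ 4 := by
        refine le_trans (Finset.card_le_card (t := Cs.filter (fun p => p.1 = z₁ + z₀)) ?_)
          (hC4 (z₁ + z₀) hz1.2 (by rwa [Ne, add_eq_zero_iff']))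
        rintro ⟨d, z⟩ hp
        rw [Finset.mem_filter]
        refine ⟨hp, ?_⟩
        obtain ⟨h1, h2, h3, h4, h5, h6, h7, h8⟩ := hmC _ _ hp
        by_contra hd
        apply hAG
        refine fact2 hF hz₀ hz1.2 (by rwa [Ne, add_eq_zero_iff']) h1 h2 hd ?_ h3 h4 h5 h6 h7 h8
        rw [add_comm z₁, dbl2]; exact hz1.1
      rcases ih' with ih' | ih'
      · rw [ih'] at hfold'
        have : N1.card = 0 := by
          by_contra hN
          obtain ⟨⟨d, z⟩, hp⟩ := Finset.card_pos.1 (Nat.pos_of_ne_zero hN)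
          rw [Finset.card_eq_zero] at ih'
          have hle : Cs.card ≤ N1.card := Finset.card_filter_le _ _
          omega
        omega
      · omega
    · push Not at hz1
      have hA1 : (AA S W z₀).card ≤ 1 := Finset.card_le_one.2
        (fun a ha b hb => (hz1 a ha).trans (hz1 b hb).symm)
      have hN00 : (N0 S W z₀).card = 0 := by
        rw [card_N0_eq S W hz₀]
        interval_cases (AA S W z₀).card <;> norm_num
      have hC28 := card_by_dir hF.1 Cs 4 (by
        rintro ⟨d, z⟩ h
        have := hmC _ _ h
        exact ⟨this.1, this.2.1⟩) hC4
      have hle : Cs.card ≤ N1.card := Finset.card_filter_le _ _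
      rcases ih' with ih' | ih'
      · omega
      · omega

end AGB

namespace AGB
open Submodule Module
open scoped Classical

section four
variable {V : Type} [AddCommGroup V] [Module (ZMod 2) V] [Fintype V]

/-- The points of `S` other than `x` on full lines through `x`. -/
noncomputable def LL (S : Finset V) (x : V) : Finset V :=
  S.filter (fun s => s ≠ x ∧ s + x ∈ S)

lemma contr_count {S : Finset V} (h0 : (0 : V) ∉ S) {x : V} (hx : x ∈ S) :
    2 * S.card ≤ 2 + 2 * (SC S x).card + (LL S x).card := by
  have h := two_fold (S.erase x) (SC S x) (qm x) (fun s => s + x)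
    (by
      intro a ha
      rw [Finset.mem_erase] at ha
      refine mem_SC.2 ⟨?_, a, ha.2, rfl⟩
      intro h
      rcases (qm_zero_iff _ _).1 h with rfl | h
      · exact h0 ha.2
      · exact ha.1 h)
    (fun a => dbl3 a x)
    (by
      intro a _ b _ hab
      exact (qm_eq_iff _ _ _).1 hab.symm)
  have h2 : (Finset.filter (fun a => a + x ∈ S.erase x) (S.erase x)).card ≤ (LL S x).card := by
    apply Finset.card_le_card
    intro a ha
    simp only [Finset.mem_filter, Finset.mem_erase] at ha
    simp only [LL, Finset.mem_filter]
    tauto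
  have h3 := Finset.card_erase_add_one hx
  have h4 : 2 * (S.erase x).card ≤ 2 * (SC S x).card + (LL S x).card := by
    refine h.trans ?_
    apply Nat.add_le_add_left
    convert h2
  omega

lemma mem_span_image_sum {Q : Type} (y : Q → V) (R : Finset Q) (v : V)
    (hv : v ∈ span (ZMod 2) (y '' (R : Set Q))) : ∃ R' ⊆ R, v = ∑ t ∈ R', y t := by
  obtain ⟨c, rfl⟩ := (Submodule.mem_span_image_finset_iff_exists_fun' (ZMod 2)).1 hv
  refine ⟨R.filter (fun t => c t = 1), Finset.filter_subset _ _, ?_⟩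
  rw [Finset.sum_filter]
  apply Finset.sum_congr rfl
  intro t _
  rcases z2 (c t) with h | h <;> simp [h]

/-- A minimal zero-sum set. -/
lemma exists_min_zero_sum {Q : Type} [AddCommGroup Q] [Module (ZMod 2) Q] [Finite Q] (T : Finset Q)
    (h : finrank (ZMod 2) Q < T.card) :
    ∃ U ⊆ T, U.Nonempty ∧ ∑ t ∈ U, t = 0 ∧ ∀ A ⊆ U, ∑ t ∈ A, t = 0 → A = ∅ ∨ A = U := by
  have hne : (T.powerset.filter (fun U => U.Nonempty ∧ ∑ t ∈ U, t = 0)).Nonempty := by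
    obtain ⟨f, hf, x, hx, hfx⟩ := Module.exists_nontrivial_relation_of_finrank_lt_card h
    refine ⟨T.filter (fun t => f t = 1), ?_⟩
    rw [Finset.mem_filter, Finset.mem_powerset]
    refine ⟨Finset.filter_subset _ _, ⟨x, ?_⟩, ?_⟩
    · rw [Finset.mem_filter]
      rcases z2 (f x) with h | h
      · exact absurd h hfx
      · exact ⟨hx, h⟩
    · rw [← hf, Finset.sum_filter]
      apply Finset.sum_congr rfl
      intro t _
      rcases z2 (f t) with h | h <;> simp [h]
  obtain ⟨U, hU, hmin⟩ := Finset.exists_min_image _ Finset.card hne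
  rw [Finset.mem_filter, Finset.mem_powerset] at hU
  refine ⟨U, hU.1, hU.2.1, hU.2.2, ?_⟩
  intro A hA hA0
  rcases Finset.eq_empty_or_nonempty A with h | h
  · exact Or.inl h
  · right
    apply Finset.eq_of_subset_of_card_le hA
    apply hmin
    rw [Finset.mem_filter, Finset.mem_powerset]
    exact ⟨hA.trans hU.1, h, hA0⟩

lemma spike {S : Finset V} (h0 : (0 : V) ∉ S) (hAG : ¬ AGm (S : Set V)) {x : V} (hx : x ∈ S)
    (hL : 2 * finrank (ZMod 2) V ≤ (LL S x).card) : ∃ W, F7 W (S : Set V) := by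
  have hx0 : x ≠ 0 := fun h => h0 (h ▸ hx)
  have hfr := finrank_qm hx0
  have hcard : (LL S x).card ≤ 2 * ((LL S x).image (qm x)).card := by
    apply Finset.card_le_mul_card_image
    intro t ht
    obtain ⟨s, hs, rfl⟩ := Finset.mem_image.1 ht
    refine (Finset.card_le_card (t := {s, s + x}) ?_).trans Finset.card_le_two
    intro a ha
    rw [Finset.mem_filter] at ha
    simpa using (qm_eq_iff _ _ _).1 ha.2
  obtain ⟨U, hUT, hUne, hU0, hUmin⟩ := exists_min_zero_sum ((LL S x).image (qm x)) (by omega)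
  have hlift : ∀ t, ∃ y : V, qm x y = t ∧ (t ∈ U → y ∈ S ∧ y + x ∈ S ∧ y ≠ x) := by
    intro t
    by_cases ht : t ∈ U
    · obtain ⟨s, hs, rfl⟩ := Finset.mem_image.1 (hUT ht)
      simp only [LL, Finset.mem_filter] at hs
      exact ⟨s, rfl, fun _ => ⟨hs.1, hs.2.2, hs.2.1⟩⟩
    · obtain ⟨y, rfl⟩ := mkQ_surjective _ t
      exact ⟨y, rfl, fun h => absurd h ht⟩
  choose y hyq hyS using hlift
  have hne0 : ∀ t ∈ U, t ≠ 0 := by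
    intro t ht h
    have h1 := hyq t
    rw [h, qm_zero_iff] at h1
    rcases h1 with h1 | h1
    · have := (hyS t ht).1
      rw [h, h1] at this; exact h0 this
    · apply (hyS t ht).2.2
      rw [h, h1]
  have hU3 : 3 ≤ U.card := by
    by_contra! hlt
    have : U.card = 1 ∨ U.card = 2 := by
      have := Finset.card_pos.2 hUne
      omega
    rcases this with h | h
    · obtain ⟨t, rfl⟩ := Finset.card_eq_one.1 h
      rw [Finset.sum_singleton] at hU0
      exact hne0 t (by simp) hU0
    · obtain ⟨t, u, htu, rfl⟩ := Finset.card_eq_two.1 h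
      rw [Finset.sum_pair htu, add_eq_zero_iff'] at hU0
      exact htu hU0
  by_cases hU3' : U.card = 3
  · obtain ⟨t₁, t₂, t₃, h12, h13, h23, rfl⟩ := Finset.card_eq_three.1 hU3'
    have hs : t₃ = t₁ + t₂ := by
      rw [Finset.sum_insert (by simp [h12, h13]), Finset.sum_pair h23, ← add_assoc,
        add_eq_zero_iff'] at hU0
      exact hU0.symm
    have m1 := hyS t₁ (by simp)
    have m2 := hyS t₂ (by simp)
    have m3 := hyS t₃ (by simp)
    have n1 := hne0 t₁ (by simp)
    have n2 := hne0 t₂ (by simp)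
    have n3 := hne0 t₃ (by simp)
    have h3 : y t₃ = y t₁ + y t₂ ∨ y t₃ = y t₁ + y t₂ + x := by
      rw [← qm_eq_iff, map_add, hyq, hyq, hyq, hs]
    have m12 : y t₁ + y t₂ ∈ S ∧ y t₁ + y t₂ + x ∈ S := by
      rcases h3 with h | h
      · rw [← h]; exact ⟨m3.1, m3.2.1⟩
      · have e : y t₁ + y t₂ = y t₃ + x := by rw [h, dbl3]
        refine ⟨e ▸ m3.2.1, h ▸ m3.1⟩
    refine ⟨span (ZMod 2) {x, y t₁, y t₂}, ?_, ?_⟩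
    · have hli : LinearIndependent (ZMod 2) ![x, y t₁, y t₂] := by
        rw [Fintype.linearIndependent_iff]
        intro g hg
        simp only [Fin.sum_univ_three, Matrix.cons_val_zero, Matrix.cons_val_one,
          Matrix.cons_val] at hg
        have hq := congrArg (qm x) hg
        simp only [map_add, map_smul, hyq, qm_self, map_zero, smul_zero, zero_add] at hq
        have h12z : g 1 = 0 ∧ g 2 = 0 := by
          rcases z2 (g 1) with h | h <;> rcases z2 (g 2) with h' | h' <;>
            simp only [h, h', zero_smul, one_smul, zero_add, add_zero] at hq ⊢
          · simp
          · exact absurd hq n2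
          · exact absurd hq n1
          · exact absurd ((add_eq_zero_iff' _ _).1 hq) h12
        have h00 : g 0 = 0 := by
          rcases z2 (g 0) with h | h
          · exact h
          · simp [h, h12z.1, h12z.2, hx0] at hg
        intro i
        fin_cases i
        · exact h00
        · exact h12z.1
        · exact h12z.2
      have := finrank_span_eq_card hli
      rwa [Matrix.range_cons, Matrix.range_cons, Matrix.range_cons, Matrix.range_empty,
        Set.union_empty, Set.singleton_union, Set.singleton_union] at this
    · intro w hw hw0
      rw [mem_span_triple] at hw
      obtain ⟨a, b, c, rfl⟩ := hw
      rcases z2 a with rfl | rfl <;> rcases z2 b with rfl | rfl <;> rcases z2 c with rfl | rfl <;>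
        simp only [zero_smul, one_smul, zero_add, add_zero, ne_eq, not_true_eq_false] at hw0 ⊢
      · exact m2.1
      · exact m1.1
      · exact m12.1
      · exact hx
      · rw [add_comm]; exact m2.2.1
      · rw [add_comm]; exact m1.2.1
      · rw [add_assoc, add_comm]; exact m12.2
  · exfalso
    apply hAG
    obtain ⟨U4, hU4, hc4⟩ := Finset.exists_subset_card_eq (show 4 ≤ U.card by omega)
    obtain ⟨t₁, t₂, t₃, t₄, h12, h13, h14, h23, h24, h34, rfl⟩ := Finset.card_eq_four.1 hc4
    set R := U \ {t₁, t₂, t₃, t₄} with hR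
    have k1 : t₁ ∈ U := hU4 (by simp)
    have k2 : t₂ ∈ U := hU4 (by simp)
    have k3 : t₃ ∈ U := hU4 (by simp)
    have k4 : t₄ ∈ U := hU4 (by simp)
    have m1 := hyS t₁ k1
    have m2 := hyS t₂ k2
    have m3 := hyS t₃ k3
    have m4 := hyS t₄ k4
    have key : ∀ B ⊆ ({t₁, t₂, t₃} : Finset _), ∀ R' ⊆ R, ∑ t ∈ B, t = ∑ t ∈ R', t → 
        B = ∅ ∧ R' = ∅ := by
      intro B hB R' hR' hs
      have hdis : Disjoint B R' := by
        rw [Finset.disjoint_left]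
        intro t htB htR
        have h1 := hB htB
        have h2 := (Finset.mem_sdiff.1 (hR' htR)).2
        simp only [Finset.mem_insert, Finset.mem_singleton] at h1 h2
        tauto
      have h4 : t₄ ∉ B ∪ R' := by
        rw [Finset.mem_union]
        rintro (h | h)
        · have := hB h
          simp only [Finset.mem_insert, Finset.mem_singleton] at this
          rcases this with h | h | h
          · exact h14 h.symm
          · exact h24 h.symm
          · exact h34 h.symm
        · have := (Finset.mem_sdiff.1 (hR' h)).2
          simp at this
      have hsub : B ∪ R' ⊆ U := by
        apply Finset.union_subset
        · refine hB.trans (subset_trans ?_ hU4)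
          intro t; simp only [Finset.mem_insert, Finset.mem_singleton]; tauto
        · exact hR'.trans Finset.sdiff_subset
      rcases hUmin _ hsub (by rw [Finset.sum_union hdis, hs, dbl]) with h | h
      · exact Finset.union_eq_empty.1 h
      · rw [h] at h4; exact absurd k4 h4
    have hspanq : ∀ v ∈ span (ZMod 2) (y '' (R : Set _)), ∃ R' ⊆ R, v = ∑ t ∈ R', y t ∧
        qm x v = ∑ t ∈ R', t := by
      intro v hv
      obtain ⟨R', h1, rfl⟩ := mem_span_image_sum y R v hv
      refine ⟨R', h1, rfl, ?_⟩
      rw [map_sum]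
      exact Finset.sum_congr rfl (fun t _ => hyq t)
    have hD : ∀ v ∈ span (ZMod 2) (insert x (insert (y t₁ + y t₂) (y '' (R : Set _)))),
        ∃ R' ⊆ R, qm x v = ∑ t ∈ R', t ∨ qm x v = t₁ + t₂ + ∑ t ∈ R', t := by
      intro v hv
      obtain ⟨a, v1, hv1, rfl⟩ := mem_span_insert.1 hv
      obtain ⟨b, v2, hv2, rfl⟩ := mem_span_insert.1 hv1
      obtain ⟨R', h1, h2, h3⟩ := hspanq v2 hv2
      refine ⟨R', h1, ?_⟩
      simp only [map_add, map_smul, qm_self, smul_zero, zero_add, hyq, h3]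
      rcases z2 b with rfl | rfl <;> simp
    have s123 : ∀ t, t ∈ ({t₁, t₂, t₃} : Finset _) ↔ t = t₁ ∨ t = t₂ ∨ t = t₃ := by simp
    have key' : ∀ B ⊆ ({t₁, t₂, t₃} : Finset _), B ≠ ∅ → ∀ R' ⊆ R, ∑ t ∈ B, t ≠ ∑ t ∈ R', t :=
      fun B hB hB0 R' hR' h => hB0 (key B hB R' hR' h).1
    have hUsum : t₄ = t₁ + t₂ + t₃ + ∑ t ∈ R, t := by
      have h := Finset.sum_sdiff (f := fun t => t) hU4
      rw [← hR, hU0, Finset.sum_insert (by simp [h12, h13, h14]),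
        Finset.sum_insert (by simp [h23, h24]), Finset.sum_pair h34] at h
      have h' : t₁ + t₂ + t₃ + ∑ t ∈ R, t + t₄ = 0 := by rw [← h]; abel
      rw [add_eq_zero_iff'] at h'
      exact h'.symm
    have h4c : y t₄ = y t₁ + y t₂ + y t₃ + ∑ t ∈ R, y t ∨
        y t₄ = y t₁ + y t₂ + y t₃ + ∑ t ∈ R, y t + x := by
      rw [← qm_eq_iff]
      simp only [map_add, hyq, map_sum]
      exact hUsum
    have hRs : ∑ t ∈ R, y t ∈ span (ZMod 2) (y '' (R : Set _)) :=
      sum_mem (fun t ht => subset_span ⟨t, ht, rfl⟩)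
    refine AGm.mk' (y '' (R : Set _)) ?_
      (span (ZMod 2) (insert x (insert (y t₁ + y t₂) (y '' (R : Set _)))))
      (d := x) (e := y t₁ + y t₂) (z := y t₁) (w := y t₃) ?_ (subset_span (by simp))
      (subset_span (by simp)) ?_ ?_ ?_ ?_ ?_ ?_
      ⟨y t₁, m1.1, by simp [dbl]⟩ ⟨y t₁ + x, m1.2.1, by simp [dbl]⟩
      ⟨y t₂, m2.1, by simp [dbl, dbl2]⟩ ⟨y t₂ + x, m2.2.1, ?_⟩
      ⟨y t₃, m3.1, by simp [dbl]⟩ ⟨y t₃ + x, m3.2.1, by simp [dbl]⟩ ?_ ?_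
    · rintro _ ⟨t, ht, rfl⟩
      exact (hyS t (Finset.mem_sdiff.1 ht).1).1
    · intro v hv; apply subset_span; simp only [Set.mem_insert_iff]; tauto
    · intro h
      obtain ⟨R', h1, h2, h3⟩ := hspanq _ h
      rw [qm_self] at h3
      have := (key ∅ (by simp) R' h1 (by rw [← h3]; simp)).2
      rw [this] at h2; simp at h2; exact hx0 h2
    · intro h
      obtain ⟨R', h1, h2, h3⟩ := hspanq _ h
      refine key' {t₁, t₂} (by intro t; simp; tauto) (by simp) R' h1 ?_
      rw [← h3, Finset.sum_pair h12, map_add, hyq, hyq]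
    · intro h
      obtain ⟨R', h1, h2, h3⟩ := hspanq _ h
      refine key' {t₁, t₂} (by intro t; simp; tauto) (by simp) R' h1 ?_
      rw [← h3, Finset.sum_pair h12, map_add, map_add, hyq, hyq, qm_self, zero_add]
    · intro h
      obtain ⟨R', h1, h3 | h3⟩ := hD _ h <;> rw [hyq] at h3
      · exact key' {t₁} (by simp) (by simp) R' h1 (by simpa using h3)
      · refine key' {t₂} (by simp) (by simp) R' h1 ?_
        rw [Finset.sum_singleton]
        linear_combination (norm := abel) h3 + dbl t₂ 
    · intro h
      obtain ⟨R', h1, h3 | h3⟩ := hD _ h <;> rw [hyq] at h3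
      · exact key' {t₃} (by simp) (by simp) R' h1 (by simpa using h3)
      · refine key' {t₁, t₂, t₃} (by simp) (by simp) R' h1 ?_
        rw [Finset.sum_insert (by simp [h12, h13]), Finset.sum_pair h23, h3]
        linear_combination (norm := abel) dbl t₁ + dbl t₂
    · intro h
      obtain ⟨R', h1, h3 | h3⟩ := hD _ h <;> rw [map_add, hyq, hyq] at h3
      · refine key' {t₁, t₃} (by intro t; simp; tauto) (by simp) R' h1 ?_
        rw [Finset.sum_pair h13]; exact h3
      · refine key' {t₂, t₃} (by intro t; simp; tauto) (by simp) R' h1 ?_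
        rw [Finset.sum_pair h23]
        linear_combination (norm := abel) h3 + dbl t₂
    · rw [show y t₂ + x + (y t₁ + x + (y t₁ + y t₂)) = 0 by
        linear_combination (norm := abel) dbl x + dbl (y t₁) + dbl (y t₂)]
      exact zero_mem _
    · rcases h4c with h | h
      · refine ⟨y t₄, m4.1, ?_⟩
        rw [h]
        convert hRs using 1
        linear_combination (norm := abel) dbl (y t₁) + dbl (y t₂) + dbl (y t₃)
      · refine ⟨y t₄ + x, m4.2.1, ?_⟩
        rw [h]
        convert hRs using 1
        linear_combination (norm := abel) dbl (y t₁) + dbl (y t₂) + dbl (y t₃) + dbl x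
    · rcases h4c with h | h
      · refine ⟨y t₄ + x, m4.2.1, ?_⟩
        rw [h]
        convert hRs using 1
        linear_combination (norm := abel) dbl (y t₁) + dbl (y t₂) + dbl (y t₃) + dbl x
      · refine ⟨y t₄, m4.1, ?_⟩
        rw [h]
        convert hRs using 1
        linear_combination (norm := abel) dbl (y t₁) + dbl (y t₂) + dbl (y t₃) + dbl x

end four
end AGB

namespace AGB
open Submodule Module
open scoped Classical

section five
variable {V : Type} [AddCommGroup V] [Module (ZMod 2) V] [Fintype V]

lemma avg {n : ℕ} (hn : 1 ≤ n) {S : Finset V} (h0 : (0 : V) ∉ S) {W : Submodule (ZMod 2) V}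
    (hV : finrank (ZMod 2) V = n + 3) (hF : F7 W (S : Set V)) (hAG : ¬ AGm (S : Set V)) :
    ∃ x ∈ S, (LL S x).card < 2 * (n + 3) := by
  have hk := klemma n V S W hV hF hAG
  have hex : ∃ d ∈ WW W, ((NN S W).filter (fun p => p.1 = d)).card < 2 * n := by
    by_contra! hcon
    have h1 := Finset.card_eq_sum_card_fiberwise (f := Prod.fst) (s := NN S W) (t := WW W)
      (by
        rintro ⟨d, z⟩ h
        simp only [NN, Finset.coe_filter, Finset.mem_univ, true_and, Set.mem_ofPred_eq] at h
        simp [WW, h.1, h.2.1])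
    have h2 := Finset.sum_le_sum hcon
    rw [← h1, Finset.sum_const, card_WW hF.1, smul_eq_mul] at h2
    omega
  obtain ⟨d, hd, hlt⟩ := hex
  have hd' := hd
  simp only [WW, Finset.mem_filter, Finset.mem_univ, true_and] at hd'
  refine ⟨d, hF.2 d hd'.1 hd'.2, ?_⟩
  have hsub : LL S d ⊆ (WW W).erase d ∪ ((NN S W).filter (fun p => p.1 = d)).image Prod.snd := by
    intro s hs
    simp only [LL, Finset.mem_filter] at hs
    rw [Finset.mem_union]
    by_cases hsW : s ∈ W
    · by_cases hs0 : s = 0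
      · right
        exact absurd (hs0 ▸ hs.1) h0
      · left
        simp [WW, hs.2.1, hsW, hs0]
    · right
      rw [Finset.mem_image]
      refine ⟨(d, s), ?_, rfl⟩
      simp [NN, hd', hsW, hs.1, hs.2.2]
  have h1 := Finset.card_le_card hsub
  have h2 := Finset.card_union_le ((WW W).erase d)
    (((NN S W).filter (fun p => p.1 = d)).image Prod.snd)
  have h3 : (((NN S W).filter (fun p => p.1 = d)).image Prod.snd).card ≤ _ :=
    Finset.card_image_le
  have h4 := Finset.card_erase_of_mem hd
  rw [card_WW hF.1] at h4
  omega

lemma step {r : ℕ} (hr : 4 ≤ r) {S : Finset V} (h0 : (0 : V) ∉ S)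
    (hV : finrank (ZMod 2) V = r) (hAG : ¬ AGm (S : Set V)) (hne : S.Nonempty) :
    ∃ x ∈ S, S.card ≤ (SC S x).card + r := by
  have hex : ∃ x ∈ S, (LL S x).card < 2 * r := by
    by_contra! hcon
    obtain ⟨x, hx⟩ := hne
    obtain ⟨W, hW⟩ := spike h0 hAG hx (by rw [hV]; exact hcon x hx)
    obtain ⟨y, hy, hy2⟩ := avg (n := r - 3) (by omega) h0 (by omega) hW hAG
    have := hcon y hy
    omega
  obtain ⟨x, hx, hlt⟩ := hex
  have := contr_count h0 hx
  exact ⟨x, hx, by omega⟩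

/-- The merged fibre. -/
noncomputable def GG (S : Finset V) (W : Submodule (ZMod 2) V) (z₁ z₂ z₃ : V) : Finset V :=
  AA S W z₁ ∪ (AA S W z₂).image (· + z₃)

lemma mem_shift {S : Finset V} {W : Submodule (ZMod 2) V} {z₁ z₂ z₃ y : V}
    (h123 : z₁ + z₂ + z₃ ∈ W) :
    y ∈ (AA S W z₂).image (· + z₃) ↔ y + z₃ ∈ S ∧ y + z₁ ∈ W := by
  have e : y + z₁ ∈ W ↔ y + z₃ + z₂ ∈ W := by
    rw [show y + z₃ + z₂ = (y + z₁) + (z₁ + z₂ + z₃) by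
      linear_combination (norm := abel) - dbl z₁]
    exact (W.add_mem_iff_left h123).symm
  simp only [AA, Finset.mem_image, Finset.mem_filter]
  constructor
  · rintro ⟨u, ⟨hu, hu2⟩, rfl⟩
    rw [e, dbl3]
    exact ⟨hu, hu2⟩
  · rintro ⟨h1, h2⟩
    exact ⟨y + z₃, ⟨h1, e.1 h2⟩, dbl3 _ _⟩

lemma card_GG_le {S : Finset V} {W : Submodule (ZMod 2) V} (hF : F7 W (S : Set V))
    (hAG : ¬ AGm (S : Set V)) {z₁ z₂ z₃ : V} (h1 : z₁ ∉ W) (h2 : z₂ ∉ W) (h3 : z₃ ∉ W)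
    (h3S : z₃ ∈ S) (h123 : z₁ + z₂ + z₃ ∈ W) : (GG S W z₁ z₂ z₃).card ≤ 4 := by
  have : Fintype (V ⧸ span (ZMod 2) {z₃}) := Fintype.ofFinite _
  have h13 : z₁ + z₃ ∉ W := by
    intro h
    rw [show z₁ + z₂ + z₃ = z₂ + (z₁ + z₃) by abel] at h123
    exact h2 ((W.add_mem_iff_left h).1 h123)
  have hq1 : qm z₃ z₁ ∉ W.map (qm z₃) := by rw [mem_map_qm]; tauto
  refine le_trans ?_ (card_AA_le (SC_F7 hF h3) (SC_AG h3S hAG) (z₀ := qm z₃ z₁) hq1)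
  have hco : ∀ y ∈ GG S W z₁ z₂ z₃, y + z₁ ∈ W ∧ (y ∈ S ∨ y + z₃ ∈ S) := by
    intro y hy
    rw [GG, Finset.mem_union, mem_shift h123] at hy
    simp only [AA, Finset.mem_filter] at hy
    tauto
  apply Finset.card_le_card_of_injOn (qm z₃)
  · intro y hy
    obtain ⟨g1, g2⟩ := hco y hy
    have hq : qm z₃ y + qm z₃ z₁ ∈ W.map (qm z₃) := by
      rw [← map_add]; exact mem_map_of_mem g1
    simp only [AA, Finset.coe_filter, Set.mem_ofPred_eq]
    refine ⟨mem_SC.2 ⟨?_, ?_⟩, hq⟩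
    · intro h
      rw [h, zero_add] at hq
      exact hq1 hq
    · rcases g2 with g2 | g2
      · exact ⟨y, g2, rfl⟩
      · refine ⟨_, g2, ?_⟩
        rw [map_add, qm_self, add_zero]
  · intro y hy y' hy' h
    have g := (hco y hy).1
    have g' := (hco y' hy').1
    have := qm_injOn h3 g g' (by rw [map_add, h, map_add])
    exact add_right_cancel this

lemma inter_diff {S : Finset V} {W : Submodule (ZMod 2) V} (hF : F7 W (S : Set V))
    (hAG : ¬ AGm (S : Set V)) {z₁ z₂ z₃ : V} (h1 : z₁ ∉ W) (h2 : z₂ ∉ W) (h3 : z₃ ∉ W)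
    (h123 : z₁ + z₂ + z₃ ∈ W) {z : V} (hz : z ∈ AA S W z₃) (hzne : z ≠ z₃) {y y' : V}
    (hy : y ∈ AA S W z₁ ∩ (AA S W z₂).image (· + z₃))
    (hy' : y' ∈ AA S W z₁ ∩ (AA S W z₂).image (· + z₃)) (hne : y' ≠ y) : y' = y + (z₃ + z) := by
  rw [Finset.mem_inter, mem_shift h123] at hy hy'
  simp only [AA, Finset.mem_filter] at hy hy' hz
  obtain ⟨⟨a1, a2⟩, a3, -⟩ := hy
  obtain ⟨⟨b1, b2⟩, b3, -⟩ := hy'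
  by_contra hcon
  apply hAG
  have hyW : y ∉ W := fun h => h1 ((W.add_mem_iff_right h).1 a2)
  have hyW3 : y + z₃ ∉ W := by
    intro h
    have e : z₂ = (y + z₃) + ((y + z₁) + (z₁ + z₂ + z₃)) := by
      linear_combination (norm := abel) - dbl y - dbl z₃ - dbl z₁
    apply h2
    rw [e]
    exact add_mem h (add_mem a2 h123)
  refine fact2 hF (z₀ := z₃) (e := z₃ + z) (z := y) (d := y + y') h3 ?_ ?_ ?_ ?_ ?_ ?_ hyW hyW3
    a1 ?_ a3 ?_
  · rw [add_comm]; exact hz.2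
  · rw [Ne, add_eq_zero_iff']; exact hzne.symm
  · have := add_mem a2 b2
    rwa [show y + z₁ + (y' + z₁) = y + y' + (z₁ + z₁) by abel, dbl, add_zero] at this
  · rw [Ne, add_eq_zero_iff']; exact hne.symm
  · intro h
    apply hcon
    rw [← h, dbl2]
  · rw [dbl2]; exact hz.1
  · rw [dbl2]; exact b1
  · rw [show y + z₃ + (y + y') = y + (y + (y' + z₃)) by abel, dbl2]; exact b3

lemma pair_sum {S : Finset V} {W : Submodule (ZMod 2) V} (hF : F7 W (S : Set V))
    (hAG : ¬ AGm (S : Set V)) {z₁ z₂ z₃ : V} (h1 : z₁ ∉ W) (h2 : z₂ ∉ W) (h3 : z₃ ∉ W)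
    (h3S : z₃ ∈ S) (h123 : z₁ + z₂ + z₃ ∈ W) :
    (2 ≤ (AA S W z₃).card → (AA S W z₁).card + (AA S W z₂).card ≤ 6) ∧
    (3 ≤ (AA S W z₃).card → (AA S W z₁).card + (AA S W z₂).card ≤ 5) := by
  have hG := card_GG_le hF hAG h1 h2 h3 h3S h123
  have hui := Finset.card_union_add_card_inter (AA S W z₁) ((AA S W z₂).image (· + z₃))
  rw [Finset.card_image_of_injective _ (add_left_injective z₃)] at hui
  rw [GG] at hG
  have h33 : z₃ ∈ AA S W z₃ := by simp [AA, h3S, dbl]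
  have hd := fun z hz hzne y hy y' hy' hne =>
    inter_diff hF hAG h1 h2 h3 h123 (z := z) hz hzne (y := y) (y' := y') hy hy' hne
  set I := AA S W z₁ ∩ (AA S W z₂).image (· + z₃) with hI
  have her := Finset.card_erase_of_mem h33
  constructor
  · intro hm
    have : I.card ≤ 2 := by
      obtain ⟨z, hz⟩ := Finset.card_pos.1 (show 0 < ((AA S W z₃).erase z₃).card by omega)
      rw [Finset.mem_erase] at hz
      rcases Finset.eq_empty_or_nonempty I with h | ⟨y, hy⟩
      · rw [h]; simp
      refine (Finset.card_le_card (t := {y, y + (z₃ + z)}) ?_).trans Finset.card_le_two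
      intro y' hy'
      rw [Finset.mem_insert, Finset.mem_singleton]
      by_cases h : y' = y
      · exact Or.inl h
      · exact Or.inr (hd z hz.2 hz.1 y hy y' hy' h)
    omega
  · intro hm
    have : I.card ≤ 1 := by
      obtain ⟨z, hz, z', hz', hne⟩ :=
        Finset.one_lt_card.1 (show 1 < ((AA S W z₃).erase z₃).card by omega)
      rw [Finset.mem_erase] at hz hz'
      rw [Finset.card_le_one]
      intro y hy y' hy'
      by_contra h
      have e1 := hd z hz.2 hz.1 y hy y' hy' (Ne.symm h)
      have e2 := hd z' hz'.2 hz'.1 y hy y' hy' (Ne.symm h)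
      rw [e1] at e2
      exact hne (add_left_cancel (add_left_cancel e2))
    omega

lemma single_fibre {S : Finset V} (h0 : (0 : V) ∉ S) {W : Submodule (ZMod 2) V}
    (hF : F7 W (S : Set V))
    (hAG : ¬ AGm (S : Set V)) {z₁ z₂ z₃ : V} (h1 : z₁ ∉ W) (h2 : z₂ ∉ W) (h3 : z₃ ∉ W)
    (h3S : z₃ ∈ S) (h123 : z₁ + z₂ + z₃ ∈ W)
    (hcov : ∀ s ∈ S, s ∉ W → s + z₁ ∈ W ∨ s + z₂ ∈ W ∨ s + z₃ ∈ W)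
    (hone : (AA S W z₃).card ≤ 1) : ∃ d ∈ S, (LL S d).card ≤ 6 := by
  have hG := card_GG_le hF hAG h1 h2 h3 h3S h123
  set G := GG S W z₁ z₂ z₃ with hGdef
  set Dir := G.offDiag.image (fun p => p.1 + p.2) with hDir
  have hD6 : Dir.card ≤ 6 := by
    have hm := Finset.mul_card_image_le_card (s := G.offDiag) (f := fun p => p.1 + p.2) 2 (by
      intro d hd
      obtain ⟨⟨a, b⟩, hab, rfl⟩ := Finset.mem_image.1 hd
      rw [Finset.mem_offDiag] at hab
      obtain ⟨ha, hb, hne⟩ := hab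
      simp only at ha hb hne ⊢
      rw [← Finset.card_pair (show (a, b) ≠ (b, a) by simp [hne])]
      apply Finset.card_le_card
      intro p hp
      rw [Finset.mem_insert, Finset.mem_singleton] at hp
      rcases hp with rfl | rfl
      · simp [ha, hb, hne]
      · simp [ha, hb, hne.symm, add_comm])
    rw [Finset.offDiag_card] at hm
    have : G.card * G.card - G.card ≤ 12 := by
      interval_cases G.card <;> norm_num
    have h2 : 2 * Dir.card ≤ 12 := hm.trans this
    omega
  obtain ⟨d, hdW, hdD⟩ : ∃ d ∈ WW W, d ∉ Dir := by
    by_contra! hcon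
    have := Finset.card_le_card (show WW W ⊆ Dir from hcon)
    rw [card_WW hF.1] at this
    omega
  have hd' := hdW
  simp only [WW, Finset.mem_filter, Finset.mem_univ, true_and] at hd'
  refine ⟨d, hF.2 d hd'.1 hd'.2, ?_⟩
  have h6 := Finset.card_erase_of_mem hdW
  rw [card_WW hF.1] at h6
  refine (Finset.card_le_card ?_).trans h6.le
  intro s hs
  simp only [LL, Finset.mem_filter] at hs
  obtain ⟨hs1, hs2, hs3⟩ := hs
  have hGd : ∀ a ∈ G, a + d ∈ G → False := by
    intro a ha hb
    apply hdD
    refine Finset.mem_image.2 ⟨(a, a + d), ?_, dbl2 _ _⟩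
    rw [Finset.mem_offDiag]
    refine ⟨ha, hb, ?_⟩
    simpa using hd'.2
  by_cases hsW : s ∈ W
  · have : s ≠ 0 := fun h => h0 (h ▸ hs1)
    simp [WW, hsW, this, hs2]
  · exfalso
    rcases hcov s hs1 hsW with h | h | h
    · apply hGd s
      · rw [hGdef, GG, Finset.mem_union]; left
        simp [AA, hs1, h]
      · rw [hGdef, GG, Finset.mem_union]; left
        rw [AA, Finset.mem_filter, add_right_comm]
        exact ⟨hs3, add_mem h hd'.1⟩
    · apply hGd (s + z₃)
      · rw [hGdef, GG, Finset.mem_union]; right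
        refine Finset.mem_image.2 ⟨s, ?_, rfl⟩
        simp [AA, hs1, h]
      · rw [hGdef, GG, Finset.mem_union]; right
        refine Finset.mem_image.2 ⟨s + d, ?_, add_right_comm _ _ _⟩
        rw [AA, Finset.mem_filter, add_right_comm]
        exact ⟨hs3, add_mem h hd'.1⟩
    · have e := Finset.card_le_one.1 hone s (by simp [AA, hs1, h]) (s + d) (by
        rw [AA, Finset.mem_filter, add_right_comm]
        exact ⟨hs3, add_mem h hd'.1⟩)
      exact hd'.2 (by simpa using e)

end five
end AGB

namespace AGB
open Submodule Module
open scoped Classical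

section six
variable {V : Type} [AddCommGroup V] [Module (ZMod 2) V] [Fintype V]

lemma even_LL {S : Finset V} {x : V} (hx : x ≠ 0) (h0 : (0 : V) ∉ S) : Even (LL S x).card := by
  have h : ∑ s ∈ LL S x, (1 : ZMod 2) = 0 := by
    refine Finset.sum_involution (fun s _ => s + x) (fun _ _ => by decide) ?_ ?_ ?_
    · intro a _ _ h; exact hx (by simpa using h)
    · intro a ha
      simp only [LL, Finset.mem_filter] at ha ⊢
      refine ⟨ha.2.2, ?_, ?_⟩
      · intro h
        have : a = 0 := by simpa using h
        exact h0 (this ▸ ha.1)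
      · rw [dbl3]; exact ha.1
    · intro a _; exact dbl3 _ _
  rw [Finset.sum_const, nsmul_eq_mul, mul_one] at h
  exact even_iff_two_dvd.2 ((ZMod.natCast_eq_zero_iff _ _).1 h)

/-- ordered pairs on full lines. -/
noncomputable def PP (S : Finset V) : Finset (V × V) :=
  Finset.univ.filter (fun p => p.1 ∈ S ∧ p.2 ∈ LL S p.1)

lemma card_PP (S : Finset V) : (PP S).card = ∑ x ∈ S, (LL S x).card := by
  rw [Finset.card_eq_sum_card_fiberwise (f := Prod.fst) (s := PP S) (t := S)
    (by rintro ⟨a, b⟩ h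
        simp only [PP, Finset.coe_filter, Finset.mem_univ, true_and, Set.mem_ofPred_eq] at h
        exact h.1)]
  apply Finset.sum_congr rfl
  intro x hx
  refine Finset.card_bij' (fun p _ => p.2) (fun y _ => (x, y)) ?_ ?_ ?_ ?_
  · rintro ⟨a, b⟩ h
    simp only [PP, Finset.mem_filter, Finset.mem_univ, true_and] at h
    obtain ⟨⟨_, h⟩, rfl⟩ := h
    exact h
  · intro y hy
    simp [PP, hx, hy]
  · rintro ⟨a, b⟩ h
    simp only [PP, Finset.mem_filter, Finset.mem_univ, true_and] at h
    simp [h.2]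
  · intro y hy; rfl

lemma three_dvd_PP {S : Finset V} (h0 : (0 : V) ∉ S) : 3 ∣ (PP S).card := by
  have hmem : ∀ a b, (a, b) ∈ PP S ↔ a ∈ S ∧ b ∈ S ∧ b ≠ a ∧ b + a ∈ S := by
    intro a b; simp [PP, LL]
  have hne : ∀ a ∈ S, a ≠ 0 := fun a ha h => h0 (h ▸ ha)
  let f : Function.End (PP S) := fun p => ⟨(p.1.2, p.1.1 + p.1.2), by
    obtain ⟨⟨a, b⟩, h⟩ := p
    obtain ⟨h1, h2, h3, h4⟩ := (hmem a b).1 h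
    refine (hmem _ _).2 ⟨h2, by rw [add_comm]; exact h4, ?_, ?_⟩
    · intro h
      exact hne a h1 (by simpa using h)
    · rw [dbl3]; exact h1⟩
  have hf : f ^ (3 ^ 1) = 1 := by
    funext p
    obtain ⟨⟨a, b⟩, h⟩ := p
    rw [pow_one]
    apply Subtype.ext
    change (b + (a + b), (a + b) + (b + (a + b))) = (a, b)
    have e1 : b + (a + b) = a := by rw [add_comm a b, dbl2]
    rw [e1, add_comm (a + b), dbl2]
  have : Fact (Nat.Prime 3) := ⟨Nat.prime_three⟩
  have h := Equiv.Perm.card_fixedPoints_modEq hf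
  have hempty : Fintype.card f.fixedPoints = 0 := by
    rw [Fintype.card_eq_zero_iff]
    constructor
    rintro ⟨⟨⟨a, b⟩, hab⟩, hfix⟩
    obtain ⟨h1, h2, h3, h4⟩ := (hmem a b).1 hab
    have := congrArg (fun p => p.1.1) hfix
    exact h3 this
  rw [hempty, Fintype.card_coe] at h
  exact (Nat.modEq_zero_iff_dvd).1 h

lemma cover {W : Submodule (ZMod 2) V} (hV : finrank (ZMod 2) V = 5)
    (hW : finrank (ZMod 2) W = 3) {z₁ z₂ : V} (h1 : z₁ ∉ W) (h2 : z₂ ∉ W) (h12 : z₁ + z₂ ∉ W)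
    (v : V) : v ∈ W ∨ v + z₁ ∈ W ∨ v + z₂ ∈ W ∨ v + (z₁ + z₂) ∈ W := by
  have : Fintype (V ⧸ W) := Fintype.ofFinite _
  have hc : Fintype.card (V ⧸ W) = 4 := by
    have h := finrank_quotient_add_finrank W
    have h2 := Module.card_eq_pow_finrank (K := ZMod 2) (V := V ⧸ W)
    rw [h2, ZMod.card, show finrank (ZMod 2) (V ⧸ W) = 2 by omega]
    norm_num
  have hz : ∀ u, W.mkQ u = 0 ↔ u ∈ W := fun u => by rw [mkQ_apply, Quotient.mk_eq_zero]
  have he : ∀ u u', W.mkQ u = W.mkQ u' ↔ u + u' ∈ W := by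
    intro u u'
    rw [← hz, map_add, add_eq_zero_iff']
  have h4 : ({0, W.mkQ z₁, W.mkQ z₂, W.mkQ (z₁ + z₂)} : Finset (V ⧸ W)).card = 4 := by
    rw [Finset.card_eq_four]
    refine ⟨_, _, _, _, ?_, ?_, ?_, ?_, ?_, ?_, rfl⟩
    · exact fun h => h1 ((hz _).1 h.symm)
    · exact fun h => h2 ((hz _).1 h.symm)
    · exact fun h => h12 ((hz _).1 h.symm)
    · rwa [Ne, he]
    · rwa [Ne, he, dbl2]
    · rwa [Ne, he, add_comm z₁, dbl2]
  have huniv := Finset.eq_univ_of_card _ (h4.trans hc.symm)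
  have hm : W.mkQ v ∈ ({0, W.mkQ z₁, W.mkQ z₂, W.mkQ (z₁ + z₂)} : Finset (V ⧸ W)) := by
    rw [huniv]; simp
  simpa only [Finset.mem_insert, Finset.mem_singleton, hz, he] using hm

lemma rank_five (hrec : ∀ (V' : Type) [AddCommGroup V'] [Module (ZMod 2) V'] [Fintype V']
      (S : Finset V'), (0 : V') ∉ S → finrank (ZMod 2) V' = 4 → ¬ AGm (S : Set V') → S.card ≤ 11)
    {S : Finset V} (h0 : (0 : V) ∉ S)
    (hV : finrank (ZMod 2) V = 5) (hAG : ¬ AGm (S : Set V)) : S.card ≤ 15 := by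
  by_contra! hS
  have hne : ∀ a ∈ S, a ≠ 0 := fun a ha h => h0 (h ▸ ha)
  have hL8 : ∀ x ∈ S, 2 * S.card ≤ 24 + (LL S x).card := by
    intro x hx
    have h1 := contr_count h0 hx
    have : Fintype (V ⧸ span (ZMod 2) {x}) := Fintype.ofFinite _
    have h2 := hrec (V ⧸ span (ZMod 2) {x}) (SC S x) (by simp [SC])
      (by have := finrank_qm (hne x hx); omega) (SC_AG hx hAG)
    omega
  by_cases hex : ∃ W, F7 W (S : Set V)
  · obtain ⟨W, hF⟩ := hex
    have hsplit : (S.filter (fun s => s ∈ W)).card + (S.filter (fun s => ¬ s ∈ W)).card = S.card :=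
      Finset.card_filter_add_card_filter_not _
    have hW7 : (S.filter (fun s => s ∈ W)).card ≤ 7 := by
      rw [← card_WW hF.1]
      apply Finset.card_le_card
      intro s hs
      rw [Finset.mem_filter] at hs
      simp [WW, hs.2, hne s hs.1]
    set O := S.filter (fun s => ¬ s ∈ W) with hO
    obtain ⟨z₁, hz₁⟩ := Finset.card_pos.1 (show 0 < O.card by omega)
    obtain ⟨s1, h1⟩ := Finset.mem_filter.1 hz₁
    have hA1 := card_AA_le hF hAG h1
    obtain ⟨z₂, hz₂, hz₂'⟩ := Finset.exists_mem_notMem_of_card_lt_card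
      (show (AA S W z₁).card < O.card by omega)
    obtain ⟨s2, h2⟩ := Finset.mem_filter.1 hz₂
    have hA2 := card_AA_le hF hAG h2
    have h12 : z₁ + z₂ ∉ W := by
      intro h; apply hz₂'
      rw [AA, Finset.mem_filter, add_comm]; exact ⟨s2, h⟩
    obtain ⟨z₃, hz₃, hz₃'⟩ := Finset.exists_mem_notMem_of_card_lt_card
      (show (AA S W z₁ ∪ AA S W z₂).card < O.card by
        have := Finset.card_union_le (AA S W z₁) (AA S W z₂)
        omega)
    obtain ⟨s3, h3⟩ := Finset.mem_filter.1 hz₃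
    have hA3 := card_AA_le hF hAG h3
    have h123 : z₁ + z₂ + z₃ ∈ W := by
      rcases cover hV hF.1 h1 h2 h12 z₃ with h | h | h | h
      · exact absurd h h3
      · exfalso; apply hz₃'; rw [Finset.mem_union]; left; simp [AA, s3, h]
      · exfalso; apply hz₃'; rw [Finset.mem_union]; right; simp [AA, s3, h]
      · rwa [add_comm]
    have hcov : ∀ s ∈ S, s ∉ W → s + z₁ ∈ W ∨ s + z₂ ∈ W ∨ s + z₃ ∈ W := by
      intro s _ hsW
      rcases cover hV hF.1 h1 h2 h12 s with h | h | h | h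
      · exact absurd h hsW
      · exact Or.inl h
      · exact Or.inr (Or.inl h)
      · right; right
        have := add_mem h h123
        rwa [show s + (z₁ + z₂) + (z₁ + z₂ + z₃) = s + z₃ by
          linear_combination (norm := abel) dbl z₁ + dbl z₂] at this
    have hOle : O.card ≤ (AA S W z₁).card + (AA S W z₂).card + (AA S W z₃).card := by
      have hsub : O ⊆ AA S W z₁ ∪ AA S W z₂ ∪ AA S W z₃ := by
        intro s hs
        rw [hO, Finset.mem_filter] at hs
        have := hcov s hs.1 hs.2
        simp only [AA, Finset.mem_union, Finset.mem_filter]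
        tauto
      have g1 := Finset.card_le_card hsub
      have g2 := Finset.card_union_le (AA S W z₁ ∪ AA S W z₂) (AA S W z₃)
      have g3 := Finset.card_union_le (AA S W z₁) (AA S W z₂)
      omega
    have hno : ∀ z₁ z₂ z₃ : V, z₁ ∉ W → z₂ ∉ W → z₃ ∉ W → z₃ ∈ S → z₁ + z₂ + z₃ ∈ W →
        (∀ s ∈ S, s ∉ W → s + z₁ ∈ W ∨ s + z₂ ∈ W ∨ s + z₃ ∈ W) → 2 ≤ (AA S W z₃).card := by
      intro z₁ z₂ z₃ h1 h2 h3 h3S h123 hcov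
      by_contra hcon
      obtain ⟨d, hd, hd6⟩ := single_fibre h0 hF hAG h1 h2 h3 h3S h123 hcov (by omega)
      have := hL8 d hd
      omega
    have h132 : z₁ + z₃ + z₂ ∈ W := by rwa [add_right_comm]
    have h231 : z₂ + z₃ + z₁ ∈ W := by rwa [show z₂ + z₃ + z₁ = z₁ + z₂ + z₃ by abel]
    have n3 := hno z₁ z₂ z₃ h1 h2 h3 s3 h123 hcov
    have n2 := hno z₁ z₃ z₂ h1 h3 h2 s2 h132 (fun s a b => by have := hcov s a b; tauto)
    have n1 := hno z₂ z₃ z₁ h2 h3 h1 s1 h231 (fun s a b => by have := hcov s a b; tauto)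
    have p3 := pair_sum hF hAG h1 h2 h3 s3 h123
    have p2 := pair_sum hF hAG h1 h3 h2 s2 h132
    have p1 := pair_sum hF hAG h2 h3 h1 s1 h231
    omega
  · have hlt : ∀ x ∈ S, (LL S x).card < 10 := by
      intro x hx
      by_contra! hcon
      exact hex (spike h0 hAG hx (by rw [hV]; exact hcon))
    have heq : ∀ x ∈ S, (LL S x).card = 8 := by
      intro x hx
      have g1 := hL8 x hx
      have g2 := hlt x hx
      obtain ⟨k, hk⟩ := even_LL (S := S) (hne x hx) h0
      omega
    obtain ⟨x, hx⟩ := Finset.card_pos.1 (show 0 < S.card by omega)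
    have hS16 : S.card = 16 := by
      have g1 := hL8 x hx
      have g2 := heq x hx
      omega
    have h3 := three_dvd_PP h0
    rw [card_PP, Finset.sum_congr rfl heq, Finset.sum_const, hS16] at h3
    norm_num at h3

end six

/-- The extremal function. -/
def FF : ℕ → ℕ
  | 0 => 0
  | 1 => 1
  | 2 => 3
  | 3 => 7
  | 4 => 11
  | (n + 5) => (n + 6).choose 2

lemma bound_small {V : Type} [AddCommGroup V] [Module (ZMod 2) V] [Fintype V] {r : ℕ}
    {S : Finset V} (h0 : (0 : V) ∉ S) (hV : finrank (ZMod 2) V = r) : S.card + 1 ≤ 2 ^ r := by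
  have h := Module.card_eq_pow_finrank (K := ZMod 2) (V := V)
  rw [hV, ZMod.card] at h
  rw [← h, ← Finset.card_insert_of_notMem h0]
  exact Finset.card_le_univ _

lemma bound_step {V : Type} [AddCommGroup V] [Module (ZMod 2) V] [Fintype V] {r k : ℕ}
    (hr : 4 ≤ r + 1) (hrec : ∀ (V' : Type) [AddCommGroup V'] [Module (ZMod 2) V'] [Fintype V']
      (S : Finset V'), (0 : V') ∉ S → finrank (ZMod 2) V' = r → ¬ AGm (S : Set V') → S.card ≤ k)
    {S : Finset V} (h0 : (0 : V) ∉ S)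
    (hV : finrank (ZMod 2) V = r + 1) (hAG : ¬ AGm (S : Set V)) : S.card ≤ k + (r + 1) := by
  rcases Finset.eq_empty_or_nonempty S with h | h
  · rw [h]; simp
  obtain ⟨x, hx, hle⟩ := step hr h0 hV hAG h
  have : Fintype (V ⧸ span (ZMod 2) {x}) := Fintype.ofFinite _
  have hx0 : x ≠ 0 := fun h => h0 (h ▸ hx)
  have h2 := hrec (V ⧸ span (ZMod 2) {x}) (SC S x) (by simp [SC])
      (by have := finrank_qm hx0; omega) (SC_AG hx hAG)
  omega

theorem bound (r : ℕ) : ∀ (V : Type) [AddCommGroup V] [Module (ZMod 2) V] [Fintype V]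
    (S : Finset V), (0 : V) ∉ S → finrank (ZMod 2) V = r → ¬ AGm (S : Set V) → S.card ≤ FF r := by
  induction r with
  | zero =>
    intro V _ _ _ S h0 hV _
    have := bound_small h0 hV
    simp [FF] at *; omega
  | succ r ih =>
    intro V _ _ _ S h0 hV hAG
    have hs := bound_small h0 hV
    match r, ih with
    | 0, _ => simp [FF] at *; omega
    | 1, _ => simp [FF] at *; omega
    | 2, _ => simp [FF] at *; omega
    | 3, ih => exact bound_step (by omega) ih h0 hV hAG
    | 4, ih => exact rank_five ih h0 hV hAG
    | (n + 5), ih =>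
      have := bound_step (by omega) ih h0 hV hAG
      refine this.trans (le_of_eq ?_)
      change (n + 6).choose 2 + (n + 6) = (n + 7).choose 2
      rw [Nat.choose_succ_succ' (n + 6) 1, Nat.choose_one_right, add_comm]

end AGB

namespace AGB
open Submodule Module
open scoped Classical

section seven

lemma isRep_iff {α : Type*} {M : Matroid α} {V : Type} [AddCommGroup V] [Module (ZMod 2) V]
    {φ : α → V} (hφ : M.IsRepBy (ZMod 2) φ) {I : Set α} (hI : I ⊆ M.E) :
    M.Indep I ↔ LinearIndepOn (ZMod 2) φ I := hφ I hI

lemma span_basis {α : Type*} {M : Matroid α} {V : Type} [AddCommGroup V] [Module (ZMod 2) V]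
    {φ : α → V} (hφ : M.IsRepBy (ZMod 2) φ) {A J : Set α} (hJ : M.IsBasis J A) :
    span (ZMod 2) (φ '' J) = span (ZMod 2) (φ '' A) := by
  apply le_antisymm (span_mono (Set.image_mono hJ.subset))
  rw [span_le]
  rintro _ ⟨x, hx, rfl⟩
  by_cases hxJ : x ∈ J
  · exact subset_span ⟨x, hxJ, rfl⟩
  · by_contra hcon
    have hd := hJ.insert_dep ⟨hx, hxJ⟩
    apply hd.not_indep
    rw [isRep_iff hφ hd.subset_ground, linearIndepOn_insert hxJ]
    exact ⟨(isRep_iff hφ hJ.indep.subset_ground).1 hJ.indep, hcon⟩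

lemma hasAG_of_AGm {α : Type*} {M : Matroid α} {V : Type} [AddCommGroup V] [Module (ZMod 2) V]
    {φ : α → V} (hφ : M.IsRepBy (ZMod 2) φ) (h : AGm (φ '' M.E)) : M.HasAGMinor := by
  obtain ⟨C, d, e, z, w, hC, hind, hpt⟩ := h
  obtain ⟨J, hJ⟩ := M.exists_isBasis {x ∈ M.E | φ x ∈ C} (fun x hx => hx.1)
  have himg : φ '' {x ∈ M.E | φ x ∈ C} = C := by
    ext c
    constructor
    · rintro ⟨x, hx, rfl⟩; exact hx.2
    · intro hc
      obtain ⟨x, hx, rfl⟩ := hC hc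
      exact ⟨x, ⟨hx, hc⟩, rfl⟩
  have hspan : span (ZMod 2) (φ '' J) = span (ZMod 2) C := by
    rw [span_basis hφ hJ, himg]
  rw [← hspan] at hind hpt
  set K := span (ZMod 2) (φ '' J) with hK
  let τ : (Fin 4 → ZMod 2) →ₗ[ZMod 2] V := Fintype.linearCombination (ZMod 2) ![z, d, e, z + w]
  have hτ : ∀ c, τ c = c 0 • z + c 1 • d + c 2 • e + c 3 • (z + w) := by
    intro c
    simp [τ, Fintype.linearCombination_apply, Fin.sum_univ_four]
  have hτK : ∀ c, τ c ∈ K → c = 0 := by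
    intro c hc
    rw [hτ] at hc
    have := hind (c 1) (c 2) (c 0 + c 3) (c 3) (by
      convert hc using 1
      rw [smul_add, add_smul]; abel)
    obtain ⟨a1, a2, a3, a4⟩ := this
    rw [a4, add_zero] at a3
    funext i
    fin_cases i
    · exact a3
    · exact a1
    · exact a2
    · exact a4
  let ψ := K.mkQ ∘ₗ τ
  have hψ : LinearMap.ker ψ = ⊥ := by
    rw [LinearMap.ker_eq_bot']
    intro c hc
    apply hτK
    rwa [← Quotient.mk_eq_zero, ← mkQ_apply]
  obtain ⟨ρ, hρ⟩ := LinearMap.exists_leftInverse_of_injective ψ hψ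
  have hρ' : ∀ c, ρ (ψ c) = c := fun c => LinearMap.congr_fun hρ c
  have hg : ∀ c : Fin 4 → ZMod 2, ∃ s, c ∈ agVecs → s ∈ M.E ∧ K.mkQ (φ s) = ψ c := by
    intro c
    by_cases hc : c ∈ agVecs
    · have hc0 : c 0 = 1 := hc
      have hs : ∃ s ∈ φ '' M.E, s + τ c ∈ K := by
        rw [hτ, hc0]
        rcases z2 (c 3) with h | h
        · rw [h]
          simpa using (hpt (c 1) (c 2)).1
        · rw [h]
          have := (hpt (c 1) (c 2)).2
          convert this using 5
          simp only [one_smul]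
          linear_combination (norm := abel) dbl z
      obtain ⟨_, ⟨s, hs, rfl⟩, hsK⟩ := hs
      refine ⟨s, fun _ => ⟨hs, ?_⟩⟩
      change K.mkQ (φ s) = K.mkQ (τ c)
      rw [← add_eq_zero_iff', ← map_add, mkQ_apply, Quotient.mk_eq_zero]
      exact hsK
    · obtain ⟨_, ⟨s, _, rfl⟩, _⟩ := (hpt 0 0).1
      exact ⟨s, fun h => absurd h hc⟩
  choose g hg using hg
  set X := g '' agVecs with hX
  have hXE : X ⊆ M.E := by rintro _ ⟨c, hc, rfl⟩; exact (hg c hc).1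
  have hXJ : Disjoint J X := by
    rw [Set.disjoint_left]
    rintro x hxJ ⟨c, hc, rfl⟩
    have h1 := (hg c hc).2
    have h2 : K.mkQ (φ (g c)) = 0 := by
      rw [mkQ_apply, Quotient.mk_eq_zero]
      exact subset_span ⟨_, hxJ, rfl⟩
    rw [h2] at h1
    have : c = 0 := by rw [← hρ' c, ← h1, map_zero]
    have hc0 : c 0 = 1 := hc
    rw [this] at hc0
    simp at hc0
  let φN : α → (Fin 4 → ZMod 2) := fun x => ρ (K.mkQ (φ x))
  have hφN : ∀ c ∈ agVecs, φN (g c) = c := by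
    intro c hc
    change ρ (K.mkQ (φ (g c))) = c
    rw [(hg c hc).2, hρ']
  have hcon : M.con J = M ／ J := rfl
  have hground : ((M.con J).del Xᶜ).E = X := by
    change (M ／ J).E \ Xᶜ = X
    rw [Matroid.contract_ground]
    ext x
    simp only [Set.mem_diff, Set.mem_compl_iff, not_not]
    constructor
    · exact fun h => h.2
    · exact fun h => ⟨⟨hXE h, fun hJ' => Set.disjoint_left.1 hXJ hJ' h⟩, h⟩
  refine ⟨(M.con J).del Xᶜ, ⟨J, Xᶜ, rfl⟩, φN, ?_, ?_⟩
  · intro I hI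
    have hI' : I ⊆ ((M ／ J).E \ Xᶜ) := hI
    rw [hground] at hI
    have h1 : ((M.con J).del Xᶜ).Indep I ↔ (M ／ J).Indep I := by
      change ((M ／ J) ↾ ((M ／ J).E \ Xᶜ)).Indep I ↔ _
      rw [Matroid.restrict_indep_iff]
      exact ⟨fun h => h.1, fun h => ⟨h, hI'⟩⟩
    have hdis : Disjoint J I := hXJ.mono_right hI
    have hJE := hJ.indep.subset_ground
    have hJLI := (isRep_iff hφ hJE).1 hJ.indep
    rw [h1, hJ.indep.contract_indep_iff]
    change _ ↔ LinearIndepOn (ZMod 2) φN I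
    rw [and_iff_right hdis.symm, Set.union_comm,
      isRep_iff hφ (Set.union_subset hJE (hI.trans hXE)),
      ← LinearIndepOn.quotient_iff_union hJLI hdis, ← hK]
    have hcg : Set.EqOn (K.mkQ ∘ φ) (ψ ∘ φN) I := by
      intro x hx
      obtain ⟨c, hc, rfl⟩ := hI hx
      simp only [Function.comp]
      rw [hφN c hc, (hg c hc).2]
    rw [linearIndepOn_congr hcg]
    exact LinearMap.linearIndepOn_iff_of_injOn ψ (LinearMap.ker_eq_bot.1 hψ).injOn
  · rw [hground]
    refine ⟨?_, ?_, ?_⟩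
    · rintro _ ⟨c, hc, rfl⟩
      rw [hφN c hc]; exact hc
    · rintro _ ⟨c, hc, rfl⟩ _ ⟨c', hc', rfl⟩ h
      rw [hφN c hc, hφN c' hc'] at h
      rw [h]
    · intro c hc
      exact ⟨g c, ⟨c, hc, rfl⟩, hφN c hc⟩

lemma FF_mono : Monotone FF := by
  apply monotone_nat_of_le_succ
  intro n
  match n with
  | 0 => decide
  | 1 => decide
  | 2 => decide
  | 3 => decide
  | 4 => decide
  | (k + 5) => exact Nat.choose_le_choose 2 (by omega)

lemma rks_bdd {α : Type*} (M : Matroid α) {A : Set α} (hA : A.Finite) :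
    BddAbove {n : ℕ | ∃ I ⊆ A, M.Indep I ∧ I.ncard = n} := by
  refine ⟨A.ncard, ?_⟩
  rintro _ ⟨I, hI, -, rfl⟩
  exact Set.ncard_le_ncard hI hA

lemma le_rks {α : Type*} {M : Matroid α} {A I : Set α} (hA : A.Finite) (hI : I ⊆ A)
    (hInd : M.Indep I) : I.ncard ≤ M.rks A :=
  le_csSup (rks_bdd M hA) ⟨I, hI, hInd, rfl⟩

lemma exists_rks {α : Type*} (M : Matroid α) {A : Set α} (hA : A.Finite) :
    ∃ I ⊆ A, M.Indep I ∧ I.ncard = M.rks A := by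
  have hne : {n : ℕ | ∃ I ⊆ A, M.Indep I ∧ I.ncard = n}.Nonempty :=
    ⟨0, ∅, by simp, M.empty_indep, by simp⟩
  exact Nat.sSup_mem hne (rks_bdd M hA)

lemma matroid_bound {α : Type*} {M : Matroid α} (hfin : M.E.Finite) (hbin : M.IsBinaryM)
    (hsimple : M.IsSimpleM) (hAG : ¬ M.HasAGMinor) {A : Set α} (hA : A ⊆ M.E) :
    A.ncard ≤ FF (M.rks A) := by
  obtain ⟨n, φ, hφ⟩ := hbin
  have hAfin := hfin.subset hA
  have hne : ∀ x ∈ M.E, φ x ≠ 0 := by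
    intro x hx
    have h := hsimple x hx x hx
    rw [Set.pair_eq_singleton, isRep_iff hφ (by simpa using hx)] at h
    exact h.ne_zero (Set.mem_singleton x)
  have hinj : Set.InjOn φ M.E := by
    intro x hx y hy hxy
    have h := hsimple x hx y hy
    rw [isRep_iff hφ (by rintro u (rfl | rfl) <;> assumption)] at h
    exact h.injOn (by simp) (by simp) hxy
  set Y := span (ZMod 2) (φ '' A) with hY
  set S : Finset Y := Finset.univ.filter (fun v => v.1 ∈ φ '' A) with hS
  have hSim : ((↑) : Y → (Fin n → ZMod 2)) '' (S : Set Y) = φ '' A := by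
    ext v
    constructor
    · rintro ⟨u, hu, rfl⟩
      simpa [hS] using hu
    · intro hv
      refine ⟨⟨v, subset_span hv⟩, ?_, rfl⟩
      simpa [hS] using hv
  have hcard : S.card = A.ncard := by
    rw [← Set.ncard_coe_finset, ← Set.ncard_image_of_injective _ Subtype.val_injective, hSim,
      Set.ncard_image_of_injOn (hinj.mono hA)]
  have h0 : (0 : Y) ∉ S := by
    intro h
    simp only [hS, Finset.mem_filter, Finset.mem_univ, true_and] at h
    obtain ⟨x, hx, h⟩ := h
    exact hne x (hA hx) h
  have hS_AG : ¬ AGm (S : Set Y) := by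
    intro h
    apply hAG
    apply hasAG_of_AGm hφ
    have := AGm.image Y.subtype Y.subtype_injective h
    refine this.mono ?_
    change ((↑) : Y → (Fin n → ZMod 2)) '' (S : Set Y) ⊆ _
    rw [hSim]
    exact Set.image_mono hA
  have hb := bound (finrank (ZMod 2) Y) Y S h0 rfl hS_AG
  rw [hcard] at hb
  refine hb.trans (FF_mono ?_)
  obtain ⟨J, hJ⟩ := M.exists_isBasis A hA
  have hJfin := hAfin.subset hJ.subset
  refine le_trans ?_ (le_rks hAfin hJ.subset hJ.indep)
  rw [hY, ← span_basis hφ hJ]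
  have := (hJfin.image φ).fintype
  refine (finrank_span_le_card (φ '' J)).trans ?_
  rw [← Set.ncard_eq_toFinset_card']
  exact Set.ncard_image_le hJfin

lemma circ_iff {α : Type*} {M : Matroid α} {C : Set α} : M.IsCircuitSet C ↔ M.IsCircuit C := by
  rw [Matroid.isCircuit_iff_forall_ssubset]; rfl

lemma circ_trans {α : Type*} {M : Matroid α} (hfin : M.E.Finite) {e f : α} :
    ∀ (k : ℕ) (C₁ C₂ : Set α), (C₁ ∪ C₂).ncard = k → M.IsCircuit C₁ → M.IsCircuit C₂ → e ∈ C₁ →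
      f ∈ C₂ → (C₁ ∩ C₂).Nonempty → ∃ C, M.IsCircuit C ∧ e ∈ C ∧ f ∈ C := by
  intro k
  induction k using Nat.strong_induction_on with
  | _ k ih =>
    intro C₁ C₂ hk h1 h2 he hf ⟨g, hg1, hg2⟩
    by_contra hno
    push Not at hno
    have he2 : e ∉ C₂ := fun h => hno C₂ h2 h hf
    have hf1 : f ∉ C₁ := fun h => hno C₁ h1 he h
    have hUfin : (C₁ ∪ C₂).Finite :=
      hfin.subset (Set.union_subset h1.subset_ground h2.subset_ground)
    have hsmall : ∀ D₁ D₂ : Set α, M.IsCircuit D₁ → M.IsCircuit D₂ → e ∈ D₁ → f ∈ D₂ →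
        (D₁ ∩ D₂).Nonempty → D₁ ∪ D₂ ⊆ C₁ ∪ C₂ → C₁ ∪ C₂ ⊆ D₁ ∪ D₂ := by
      intro D₁ D₂ d1 d2 de df dn hsub
      by_contra hcon
      have hlt := Set.ncard_lt_ncard (HasSubset.Subset.ssubset_of_not_subset hsub hcon) hUfin
      rw [hk] at hlt
      obtain ⟨C, hC, hCe, hCf⟩ := ih _ hlt D₁ D₂ rfl d1 d2 de df dn
      exact hno C hC hCe hCf
    obtain ⟨C₃, hC3s, hC3, he3⟩ := h1.strong_elimination h2 hg1 hg2 he he2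
    obtain ⟨C₄, hC4s, hC4, hf4⟩ := h2.strong_elimination h1 hg2 hg1 hf hf1
    have hg3 : g ∉ C₃ := fun h => (hC3s h).2 rfl
    have hg4 : g ∉ C₄ := fun h => (hC4s h).2 rfl
    have hsub3 : C₃ ⊆ C₁ ∪ C₂ := fun x hx => (hC3s hx).1
    have hsub4 : C₄ ⊆ C₁ ∪ C₂ := fun x hx => (hC4s hx).1.symm
    have hm3 : (C₃ ∩ C₂).Nonempty := by
      by_contra hcon
      have : C₃ ⊆ C₁ := by
        intro x hx
        rcases hsub3 hx with h | h
        · exact h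
        · exact absurd ⟨x, hx, h⟩ hcon
      have := hC3.eq_of_subset_isCircuit h1 this
      exact hg3 (this ▸ hg1)
    have hm4 : (C₁ ∩ C₄).Nonempty := by
      by_contra hcon
      have : C₄ ⊆ C₂ := by
        intro x hx
        rcases hsub4 hx with h | h
        · exact absurd ⟨x, h, hx⟩ hcon
        · exact h
      have := hC4.eq_of_subset_isCircuit h2 this
      exact hg4 (this ▸ hg2)
    have hs3 := hsmall C₃ C₂ hC3 h2 he3 hf hm3 (Set.union_subset hsub3 Set.subset_union_right)
    have h34 : (C₃ ∩ C₄).Nonempty := by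
      have hm : ∃ x ∈ C₄, x ∉ C₂ := by
        by_contra! hcon
        have := hC4.eq_of_subset_isCircuit h2 hcon
        exact hg4 (this ▸ hg2)
      obtain ⟨x, hx4, hx2⟩ := hm
      rcases hs3 (hsub4 hx4) with h | h
      · exact ⟨x, h, hx4⟩
      · exact absurd h hx2
    have hs34 := hsmall C₃ C₄ hC3 hC4 he3 hf4 h34 (Set.union_subset hsub3 hsub4)
    rcases hs34 (Or.inl hg1) with h | h
    · exact hg3 h
    · exact hg4 h

lemma separation {α : Type*} {M : Matroid α} (hfin : M.E.Finite) {e f : α} (he : e ∈ M.E)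
    (hf : f ∈ M.E) (hef : e ≠ f) (hno : ¬ ∃ C, M.IsCircuitSet C ∧ e ∈ C ∧ f ∈ C) :
    ∃ A B : Set α, A ∪ B = M.E ∧ Disjoint A B ∧ e ∈ A ∧ f ∈ B ∧ M.rks A + M.rks B ≤ M.rkM := by
  set A : Set α := {x ∈ M.E | x = e ∨ ∃ C, M.IsCircuit C ∧ e ∈ C ∧ x ∈ C} with hAdef
  have hAE : A ⊆ M.E := fun x hx => hx.1
  have hcl : ∀ C, M.IsCircuit C → (C ∩ A).Nonempty → C ⊆ A := by
    rintro C hC ⟨x, hxC, hxA⟩ y hyC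
    refine ⟨hC.subset_ground hyC, Or.inr ?_⟩
    rcases hxA.2 with rfl | ⟨D, hD, heD, hxD⟩
    · exact ⟨C, hC, hxC, hyC⟩
    · exact circ_trans hfin _ D C rfl hD hC heD hyC ⟨x, hxD, hxC⟩
  have hAfin := hfin.subset hAE
  have hBfin : (M.E \ A).Finite := hfin.subset Set.diff_subset
  refine ⟨A, M.E \ A, Set.union_diff_cancel hAE, Set.disjoint_sdiff_right, ⟨he, Or.inl rfl⟩,
    ⟨hf, ?_⟩, ?_⟩
  · rintro ⟨-, h | ⟨C, hC, h1, h2⟩⟩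
    · exact hef h.symm
    · exact hno ⟨C, circ_iff.2 hC, h1, h2⟩
  · obtain ⟨I, hIA, hI, hIc⟩ := exists_rks M hAfin
    obtain ⟨J, hJB, hJ, hJc⟩ := exists_rks M hBfin
    have hIJ : M.Indep (I ∪ J) := by
      by_contra hcon
      have hdep : M.Dep (I ∪ J) :=
        ⟨hcon, Set.union_subset (hIA.trans hAE) (hJB.trans Set.diff_subset)⟩
      obtain ⟨C, hCs, hC⟩ := hdep.exists_isCircuit_subset
      by_cases hCA : (C ∩ A).Nonempty
      · have := hcl C hC hCA
        apply hC.not_indep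
        apply hI.subset
        intro x hx
        rcases hCs hx with h | h
        · exact h
        · exact absurd (this hx) (hJB h).2
      · apply hC.not_indep
        apply hJ.subset
        intro x hx
        rcases hCs hx with h | h
        · exact absurd ⟨x, hx, hIA h⟩ hCA
        · exact h
    have hdis : Disjoint I J :=
      Set.disjoint_sdiff_right.mono hIA hJB
    rw [← hIc, ← hJc, ← Set.ncard_union_eq hdis (hAfin.subset hIA) (hBfin.subset hJB)]
    exact le_rks hfin (Set.union_subset (hIA.trans hAE) (hJB.trans Set.diff_subset)) hIJ

lemma two_FF (n : ℕ) (hn : 5 ≤ n) : 2 * FF n = n * (n + 1) := by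
  obtain ⟨k, rfl⟩ := Nat.exists_eq_add_of_le' hn
  change 2 * (k + 6).choose 2 = _
  rw [Nat.choose_two_right, Nat.mul_div_cancel']
  · rw [mul_comm]; rfl
  · exact (Nat.even_mul_pred_self _).two_dvd

lemma arith1 {a b r : ℕ} (hr : 8 ≤ r) (hab : a + b = r + 1) (ha : 2 ≤ a) (hle : a ≤ b) :
    FF a + FF b ≤ r.choose 2 + 3 := by
  have hb := two_FF b (by omega)
  have hc : 2 * r.choose 2 = r * (r - 1) := by
    rw [Nat.choose_two_right, Nat.mul_div_cancel']
    exact (Nat.even_mul_pred_self _).two_dvd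
  obtain ⟨q, rfl⟩ := Nat.exists_eq_add_of_le' (show 1 ≤ r by omega)
  rw [Nat.add_sub_cancel] at hc
  have hb' : b = q + 2 - a := by omega
  by_cases h5 : 5 ≤ a
  · have ha' := two_FF a h5
    have hq : q + 2 = a + b := by omega
    nlinarith [Nat.mul_le_mul h5 (h5.trans hle), mul_le_mul' h5 hle]
  · obtain rfl | rfl | rfl : a = 2 ∨ a = 3 ∨ a = 4 := by omega
    · obtain rfl : b = q := by omega
      rw [show FF 2 = 3 from rfl]; nlinarith
    · obtain rfl : q = b + 1 := by omega
      rw [show FF 3 = 7 from rfl]; nlinarith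
    · obtain rfl : q = b + 2 := by omega
      rw [show FF 4 = 11 from rfl]; nlinarith

lemma arith {a b r : ℕ} (hr : 8 ≤ r) (hab : a + b ≤ r + 1) (ha : 1 ≤ a) (hb : 1 ≤ b)
    (h : a + b ≤ r ∨ (2 ≤ a ∧ 2 ≤ b)) : FF a + FF b ≤ r.choose 2 + 3 := by
  have key : ∀ a b : ℕ, 1 ≤ a → a ≤ b → a + b ≤ r + 1 → (a + b ≤ r ∨ (2 ≤ a ∧ 2 ≤ b)) →
      FF a + FF b ≤ r.choose 2 + 3 := by
    intro a b ha hle hab h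
    by_cases ha2 : 2 ≤ a
    · have h1 := arith1 (a := a) (b := r + 1 - a) hr (by omega) ha2 (by omega)
      have h2 := FF_mono (show b ≤ r + 1 - a by omega)
      omega
    · obtain rfl : a = 1 := by omega
      have h1 := arith1 (a := 2) (b := r - 1) hr (by omega) le_rfl (by omega)
      have h2 := FF_mono (show b ≤ r - 1 by omega)
      have : FF 1 ≤ FF 2 := FF_mono (by omega)
      omega
  rcases le_total a b with hle | hle
  · exact key a b ha hle hab h
  · have := key b a hb hle (by omega) (by omega)
    omega

theorem main {α : Type*} (M : Matroid α) (r : ℕ) (hr : 8 ≤ r)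
    (hbin : M.IsBinaryM) (hsimple : M.IsSimpleM)
    (hrank : M.rkM = r) (hAG : ¬ M.HasAGMinor)
    (hsize : r.choose 2 + 4 ≤ M.E.ncard) :
    M.IsThreeConnected := by
  have hpos : 0 < M.E.ncard := by omega
  have hfin : M.E.Finite := Set.finite_of_ncard_pos hpos
  have hnot : ∀ A B : Set α, A ∪ B = M.E → 1 ≤ M.rks A → 1 ≤ M.rks B →
      M.rks A + M.rks B ≤ r + 1 →
      (M.rks A + M.rks B ≤ r ∨ (2 ≤ M.rks A ∧ 2 ≤ M.rks B)) → False := by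
    intro A B hAB hA hB hle hor
    have h1 := arith hr hle hA hB hor
    have h2 := matroid_bound hfin hbin hsimple hAG (A := A) (hAB ▸ Set.subset_union_left)
    have h3 := matroid_bound hfin hbin hsimple hAG (A := B) (hAB ▸ Set.subset_union_right)
    have h4 := Set.ncard_union_le A B
    rw [hAB] at h4
    omega
  have hone : ∀ A : Set α, A ⊆ M.E → ∀ x ∈ A, 1 ≤ M.rks A := by
    intro A hA x hx
    have := le_rks (M := M) (A := A) (I := {x}) (hfin.subset hA) (by simpa using hx)
      (by simpa using hsimple x (hA hx) x (hA hx))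
    rwa [Set.ncard_singleton] at this
  have htwo : ∀ A : Set α, A ⊆ M.E → 2 ≤ A.ncard → 2 ≤ M.rks A := by
    intro A hA h2
    obtain ⟨x, y, hx, hy, hxy⟩ := (Set.one_lt_ncard_iff (hfin.subset hA)).1 h2
    have := le_rks (M := M) (A := A) (I := {x, y}) (hfin.subset hA)
      (by rintro u (rfl | rfl) <;> assumption) (hsimple x (hA hx) y (hA hy))
    rwa [Set.ncard_pair hxy] at this
  refine ⟨⟨(Set.ncard_pos hfin).1 hpos, ?_⟩, ?_⟩
  · intro e he f hf hef
    by_contra hno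
    obtain ⟨A, B, hAB, -, heA, hfB, hle⟩ := separation hfin he hf hef hno
    rw [hrank] at hle
    exact hnot A B hAB (hone A (hAB ▸ Set.subset_union_left) e heA)
      (hone B (hAB ▸ Set.subset_union_right) f hfB) (by omega) (Or.inl hle)
  · rintro ⟨A, B, hAB, -, hA2, hB2, hle⟩
    rw [hrank] at hle
    have hA := htwo A (hAB ▸ Set.subset_union_left) hA2
    have hB := htwo B (hAB ▸ Set.subset_union_right) hB2
    exact hnot A B hAB (by omega) (by omega) hle (Or.inr ⟨hA, hB⟩)

end seven
end AGB


theorem nonregular_max_three_connected {α : Type*} (M : Matroid α) (r : ℕ) (hr : 8 ≤ r)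
    (hbin : M.IsBinaryM) (hsimple : M.IsSimpleM) (hnonreg : ¬ M.IsRegularM)
    (hrank : M.rkM = r) (hAG : ¬ M.HasAGMinor)
    (hsize : r.choose 2 + 4 ≤ M.E.ncard) :
    M.IsThreeConnected := by
  exact AGB.main M r hr hbin hsimple hrank hAG hsize
end

section
/- Let M be a simple non-regular binary 3-connected matroid of rank r ≥ 8 with no AG(3,2)-minor and with |M| ≥ (r choose 2) + 4. Suppose M contains an element x such that x lies in no F7-restriction of M and the simplification of M/x is isomorphic to the generalized parallel connection along a line of M(K_{r−1}) and F7. Then M is isomorphic to the generalized parallel connection along a line of M(K_r) and F7. -/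
open Matroid Set

variable {α : Type*}

/-- `N` is a simplification of `M`: the restriction of `M` to a set `X` of non-loop elements
containing no parallel pair, such that every non-loop element of `M` is either in `X` or
parallel to an element of `X`. -/
def Matroid.IsSimplificationOf (N M : Matroid α) : Prop :=
  ∃ X ⊆ M.E, N = M ↾ X ∧ (∀ e ∈ X, M.Indep {e}) ∧
    (∀ e ∈ X, ∀ f ∈ X, e ≠ f → ¬ M.IsCircuitSet {e, f}) ∧
    (∀ e ∈ M.E, M.Indep {e} → ∃ f ∈ X, e = f ∨ M.IsCircuitSet {e, f})

/-- The vectors representing the generalized parallel connection along a line of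
`M(K_r)` and `F₇` in `GF(2)^{r+1}`: the vectors `eᵢ + eⱼ` for `1 ≤ i < j ≤ r` together with
`e₀+e₁`, `e₀+e₂`, `e₀+e₃` and `e₀+e₁+e₂+e₃`. -/
def gpcVecs (r : ℕ) : Set (Fin (r + 1) → ZMod 2) :=
  {x | ∃ i j : Fin (r + 1), i ≠ 0 ∧ j ≠ 0 ∧ i ≠ j ∧ x = Pi.single i 1 + Pi.single j 1} ∪
    {Pi.single 0 1 + Pi.single 1 1, Pi.single 0 1 + Pi.single 2 1, Pi.single 0 1 + Pi.single 3 1,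
      Pi.single 0 1 + Pi.single 1 1 + Pi.single 2 1 + Pi.single 3 1}

open Matroid Set

set_option linter.unusedSectionVars false
set_option linter.unusedSimpArgs false

section AGabs
variable {ι : Type*} [DecidableEq ι]

theorem z2 (a : ZMod 2) : a = 0 ∨ a = 1 := by revert a; decide
theorem z2ne {a b : ZMod 2} (h : a ≠ b) : a = b + 1 := by revert a b; decide

/-- The edge vector `e_i + e_j`. -/
def Ed (i j : ι) : ι → ZMod 2 := Pi.single i 1 + Pi.single j 1

theorem Ed_comm (i j : ι) : Ed i j = Ed j i := add_comm _ _

theorem fself (v : ι → ZMod 2) : v + v = 0 := by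
  ext i; exact CharTwo.add_self_eq_zero (v i)

theorem vself (v : (ι → ZMod 2) × ZMod 2) : v + v = 0 :=
  Prod.ext (fself v.1) (CharTwo.add_self_eq_zero v.2)

/-- vector version of having an AG(3,2) minor -/
def AGM {V : Type*} [AddCommGroup V] [Module (ZMod 2) V] (S : Set V) : Prop :=
  ∃ C ⊆ S, ∃ L : (Fin 4 → ZMod 2) →ₗ[ZMod 2] V,
    (∀ y, L y ∈ Submodule.span (ZMod 2) C → y = 0) ∧
    ∀ y ∈ agVecs, ∃ s ∈ S, s - L y ∈ Submodule.span (ZMod 2) C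

/-- projection along `q` -/
def prj (q : (ι → ZMod 2) × ZMod 2) (k : ι) :
    ((ι → ZMod 2) × ZMod 2) →ₗ[ZMod 2] ((ι → ZMod 2) × ZMod 2) where
  toFun z := z + z.1 k • q
  map_add' a b := by simp [add_smul]; abel
  map_smul' c a := by simp [mul_smul]

theorem prj_apply (q : (ι → ZMod 2) × ZMod 2) (k : ι) (z) : prj q k z = z + z.1 k • q := rfl

theorem AGM_contr (S : Set ((ι → ZMod 2) × ZMod 2)) (q) (hq : q ∈ S) (k : ι) (hk : q.1 k = 1)
    (h : AGM (prj q k '' S)) : AGM S := by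
  obtain ⟨C', hC', L, hL, hav⟩ := h
  have hcoord : ∀ z, (prj q k z).1 k = 0 := by
    intro z; simp [prj_apply, hk, CharTwo.add_self_eq_zero]
  have hsp : ∀ z ∈ Submodule.span (ZMod 2) C', z.1 k = 0 := by
    intro z hz
    induction hz using Submodule.span_induction with
    | mem z hz => obtain ⟨s, -, rfl⟩ := hC' hz; exact hcoord s
    | zero => rfl
    | add a b _ _ ha hb => simp [ha, hb]
    | smul c a _ ha => simp [ha]
  have hLag : ∀ y ∈ agVecs, (L y).1 k = 0 := by
    intro y hy
    obtain ⟨s, hs, hsy⟩ := hav y hy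
    obtain ⟨s0, -, rfl⟩ := hs
    have := hsp _ hsy
    simpa [hcoord] using this
  have hLk : ∀ y, (L y).1 k = 0 := by
    intro y
    rcases z2 (y 0) with h0 | h0
    · have h1 := hLag (y + Pi.single 0 1) (by simp [agVecs, h0])
      have h2 := hLag (Pi.single 0 1) (by simp [agVecs])
      simpa [h2] using h1
    · exact hLag y h0
  have hfix : ∀ z : (ι → ZMod 2) × ZMod 2, z.1 k = 0 → prj q k z = z := by
    intro z hz; simp [prj_apply, hz]
  refine ⟨{s ∈ S | prj q k s ∈ C'} ∪ {q}, ?_, L, ?_, ?_⟩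
  · rintro s (hs | rfl)
    · exact hs.1
    · exact hq
  · intro y hy
    apply hL
    have : ∀ z ∈ Submodule.span (ZMod 2) ({s ∈ S | prj q k s ∈ C'} ∪ {q}),
        prj q k z ∈ Submodule.span (ZMod 2) C' := by
      intro z hz
      induction hz using Submodule.span_induction with
      | mem z hz =>
        rcases hz with hz | rfl
        · exact Submodule.subset_span hz.2
        · have : prj z k z = 0 := by
            rw [prj_apply, hk, one_smul]; exact vself z
          rw [this]; exact Submodule.zero_mem _
      | zero => simp
      | add a b _ _ ha hb => rw [map_add]; exact Submodule.add_mem _ ha hb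
      | smul c a _ ha => rw [map_smul]; exact Submodule.smul_mem _ _ ha
    have := this _ hy
    rwa [hfix _ (hLk y)] at this
  · intro y hy
    obtain ⟨s', ⟨s, hs, rfl⟩, h1⟩ := hav y hy
    refine ⟨s, hs, ?_⟩
    have hqm : q ∈ Submodule.span (ZMod 2) ({s ∈ S | prj q k s ∈ C'} ∪ {q}) :=
      Submodule.subset_span (Or.inr rfl)
    have hle : Submodule.span (ZMod 2) C' ≤
        Submodule.span (ZMod 2) ({s ∈ S | prj q k s ∈ C'} ∪ {q}) := by
      rw [Submodule.span_le]
      intro c hc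
      obtain ⟨s, hs, rfl⟩ := hC' hc
      rw [prj_apply]
      exact Submodule.add_mem _ (Submodule.subset_span (Or.inl ⟨hs, hc⟩))
        (Submodule.smul_mem _ _ hqm)
    have h2 := Submodule.sub_mem _ (hle h1) (Submodule.smul_mem _ (s.1 k) hqm)
    convert h2 using 1
    rw [prj_apply]; abel

theorem AGM_base (S : Set ((ι → ZMod 2) × ZMod 2)) (u v w : ι → ZMod 2)
    (hind : ∀ a b c : ZMod 2, a • u + b • v + c • w = 0 → a = 0 ∧ b = 0 ∧ c = 0)
    (hu : ∀ t, (u, t) ∈ S) (hv : ∀ t, (v, t) ∈ S) (hw : ∀ t, (w, t) ∈ S)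
    (huvw : ∀ t, (u + v + w, t) ∈ S) : AGM S := by
  let L : (Fin 4 → ZMod 2) →ₗ[ZMod 2] ((ι → ZMod 2) × ZMod 2) :=
    { toFun := fun y => (y 0 • u + y 1 • (u + v) + y 2 • (u + w), y 3)
      map_add' := by
        intro a b; ext <;> simp; ring
      map_smul' := by
        intro a b; ext <;> simp; ring }
  have hLa : ∀ y, L y = (y 0 • u + y 1 • (u + v) + y 2 • (u + w), y 3) := fun y => rfl
  refine ⟨∅, by simp, L, ?_, ?_⟩
  · intro y hy
    simp only [Submodule.span_empty, Submodule.mem_bot, hLa, Prod.mk_eq_zero] at hy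
    obtain ⟨h1, h2⟩ := hy
    have := hind (y 0 + y 1 + y 2) (y 1) (y 2) (by rw [← h1]; module)
    obtain ⟨h3, h4, h5⟩ := this
    rw [h4, h5, add_zero, add_zero] at h3
    ext i; fin_cases i
    · exact h3
    · exact h4
    · exact h5
    · exact h2
  · intro y hy
    refine ⟨L y, ?_, by simp⟩
    have h0 : y 0 = 1 := hy
    rw [hLa, h0]
    have huu : u + u = 0 := fself u
    rcases z2 (y 1) with h1 | h1 <;> rcases z2 (y 2) with h2 | h2 <;> rw [h1, h2]
    · simpa using hu _
    · have : (1:ZMod 2) • u + (0:ZMod 2) • (u + v) + (1:ZMod 2) • (u + w) = (u + u) + w := by module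
      rw [this, huu, zero_add]; exact hw _
    · have : (1:ZMod 2) • u + (1:ZMod 2) • (u + v) + (0:ZMod 2) • (u + w) = (u + u) + v := by module
      rw [this, huu, zero_add]; exact hv _
    · have : (1:ZMod 2) • u + (1:ZMod 2) • (u + v) + (1:ZMod 2) • (u + w) = (u + u) + (u + v + w) := by module
      rw [this, huu, zero_add]; exact huvw _

/-- a doubled 4-cycle gives the cube -/
theorem AGM_C4 (S : Set ((ι → ZMod 2) × ZMod 2)) (a b m m' : ι) (hab : a ≠ b) (ham : a ≠ m)
    (ham' : a ≠ m') (hbm : b ≠ m) (hbm' : b ≠ m') (hmm : m ≠ m')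
    (h1 : ∀ t, (Ed a m, t) ∈ S) (h2 : ∀ t, (Ed b m, t) ∈ S)
    (h3 : ∀ t, (Ed a m', t) ∈ S) (h4 : ∀ t, (Ed b m', t) ∈ S) : AGM S := by
  refine AGM_base S (Ed a m) (Ed b m) (Ed b m') ?_ h1 h2 h4 ?_
  · intro x y z h
    have e1 := congrFun h a
    have e2 := congrFun h m
    have e3 := congrFun h m'
    simp [Ed, Pi.single_apply, *, Ne.symm] at e1 e2 e3
    simp_all [Ed, Pi.single_apply, eq_comm]
  · have : Ed a m + Ed b m + Ed b m' = Ed a m' := by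
      have h := fun i : ι => fself (Pi.single i 1 : ι → ZMod 2)
      ext i
      have hb := congrFun (h b) i
      have hm := congrFun (h m) i
      simp only [Ed, Pi.add_apply, Pi.zero_apply] at *
      linear_combination hb + hm
    rw [this]; exact h3

/-- effect of contracting an edge on untouched edges -/
theorem prj_keep {S : Set ((ι → ZMod 2) × ZMod 2)} (q) (k : ι) {v : ι → ZMod 2} {t : ZMod 2}
    (hv : v k = 0) (h : (v, t) ∈ S) : (v, t) ∈ prj q k '' S :=
  ⟨_, h, by simp [prj_apply, hv]⟩

theorem prj_move {S : Set ((ι → ZMod 2) × ZMod 2)} (w : ι → ZMod 2) (s : ZMod 2) (k : ι)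
    {v : ι → ZMod 2} {t : ZMod 2}
    (hv : v k = 1) (h : (v, t) ∈ S) : (v + w, t + s) ∈ prj (w, s) k '' S :=
  ⟨_, h, by simp [prj_apply, hv]⟩

theorem Ed_off {i j k : ι} (hi : k ≠ i) (hj : k ≠ j) : Ed i j k = 0 := by
  simp [Ed, Pi.single_apply, hi, hj]
theorem Ed_left {i j : ι} (hj : i ≠ j) : Ed i j i = 1 := by
  simp [Ed, Pi.single_apply, hj]
theorem Ed_right {i j : ι} (hj : i ≠ j) : Ed i j j = 1 := by
  simp [Ed, Pi.single_apply, hj.symm]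
theorem Ed_tri (i j k : ι) : Ed i j + Ed j k = Ed i k := by
  ext l
  have := CharTwo.add_self_eq_zero ((Pi.single j 1 : ι → ZMod 2) l)
  simp only [Ed, Pi.add_apply]
  linear_combination this

/-- contracting edge `(jk, s)` (vertex `k` is absorbed into `j`) moves `km` to `jm`. -/
theorem prj_edge {S : Set ((ι → ZMod 2) × ZMod 2)} {j k m : ι} {s t : ZMod 2}
    (hm : k ≠ m) (h : (Ed k m, t + s) ∈ S) :
    (Ed j m, t) ∈ prj (Ed j k, s) k '' S := by
  have := prj_move (Ed j k) s k (Ed_left hm) h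
  rw [add_comm (Ed k m), Ed_tri, add_assoc, CharTwo.add_self_eq_zero, add_zero] at this
  exact this

/-- Two contracted edges 12 and 34, and two further vertices. -/
theorem AGM_B1 (S : Set ((ι → ZMod 2) × ZMod 2)) (a b c d m m' : ι) (σ σ' : ZMod 2)
    (hnd : [a, b, c, d, m, m'].Nodup)
    (hab : (Ed a b, σ) ∈ S) (hcd : (Ed c d, σ') ∈ S)
    (h1 : ∀ t, (Ed a m, t) ∈ S ∨ (Ed b m, t + σ) ∈ S)
    (h2 : ∀ t, (Ed a m', t) ∈ S ∨ (Ed b m', t + σ) ∈ S)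
    (h3 : ∀ t, (Ed c m, t) ∈ S ∨ (Ed d m, t + σ') ∈ S)
    (h4 : ∀ t, (Ed c m', t) ∈ S ∨ (Ed d m', t + σ') ∈ S) : AGM S := by
  simp only [List.nodup_cons, List.mem_cons, List.not_mem_nil, or_false, not_or] at hnd
  obtain ⟨⟨n1, n2, n3, n4, n5⟩, ⟨n6, n7, n8, n9⟩, ⟨n10, n11, n12⟩, ⟨n13, n14⟩, n15, -⟩ := hnd
  refine AGM_contr S _ hab b (Ed_right n1) ?_
  refine AGM_contr _ (Ed c d, σ') (prj_keep _ _ (Ed_off n6 n7) hcd) d (Ed_right n10) ?_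
  refine AGM_C4 _ a c m m' n2 n4 n5 n11 n12 n15 ?_ ?_ ?_ ?_
  · intro t
    refine prj_keep _ _ (Ed_off (Ne.symm n3) n13) ?_
    rcases h1 t with h | h
    · exact prj_keep _ _ (Ed_off (Ne.symm n1) n8) h
    · exact prj_edge n8 h
  · intro t
    rcases h3 t with h | h
    · exact prj_keep _ _ (Ed_off (Ne.symm n10) n13) (prj_keep _ _ (Ed_off n6 n8) h)
    · exact prj_edge n13 (prj_keep _ _ (Ed_off n7 n8) h)
  · intro t
    refine prj_keep _ _ (Ed_off (Ne.symm n3) n14) ?_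
    rcases h2 t with h | h
    · exact prj_keep _ _ (Ed_off (Ne.symm n1) n9) h
    · exact prj_edge n9 h
  · intro t
    rcases h4 t with h | h
    · exact prj_keep _ _ (Ed_off (Ne.symm n10) n14) (prj_keep _ _ (Ed_off n6 n9) h)
    · exact prj_edge n14 (prj_keep _ _ (Ed_off n7 n9) h)

end AGabs

open Matroid Set
set_option linter.unusedSectionVars false
set_option linter.unusedSimpArgs false

section AGgraph
variable {ι : Type*} [DecidableEq ι]

/-- every edge of the complete graph off `o` has a lift in `S` -/
def FullK (o : ι) (S : Set ((ι → ZMod 2) × ZMod 2)) : Prop :=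
  ∀ j k, j ≠ o → k ≠ o → j ≠ k → ∃ t, (Ed j k, t) ∈ S

theorem AGM_B2 (S : Set ((ι → ZMod 2) × ZMod 2)) (a b c d m m' m'' : ι) (σ σ' τ : ZMod 2)
    (hnd : [a, b, c, d, m, m'', m'].Nodup)
    (hab : (Ed a b, σ) ∈ S) (hcd : (Ed c d, σ') ∈ S) (hmm : (Ed m m', τ) ∈ S)
    (h2 : ∀ t, (Ed a m'', t) ∈ S ∨ (Ed b m'', t + σ) ∈ S)
    (h4 : ∀ t, (Ed c m'', t) ∈ S ∨ (Ed d m'', t + σ') ∈ S)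
    {t1 t2 t3 t4 u1 u2 u3 u4 : ZMod 2}
    (e1 : (Ed a m, t1) ∈ S) (e2 : (Ed b m, t2) ∈ S) (e3 : (Ed c m, t3) ∈ S) (e4 : (Ed d m, t4) ∈ S)
    (f1 : (Ed a m', u1) ∈ S) (f2 : (Ed b m', u2) ∈ S) (f3 : (Ed c m', u3) ∈ S)
    (f4 : (Ed d m', u4) ∈ S)
    (hs : t1 + t2 ≠ u1 + u2) (hs' : t3 + t4 ≠ u3 + u4) : AGM S := by
  have hnd' := hnd
  simp only [List.nodup_cons, List.mem_cons, List.not_mem_nil, or_false, not_or] at hnd'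
  obtain ⟨⟨n1, n2, n3, n4, n5, n5'⟩, ⟨n6, n7, n8, n9, n9'⟩, ⟨n10, n11, n12, n12'⟩,
    ⟨n13, n14, n14'⟩, ⟨n15, n15'⟩, n16, -⟩ := hnd'
  have key : ∀ t t1 t2 u1 u2 τ σ : ZMod 2, t1 + t2 ≠ u1 + u2 →
      (t = t1 ∨ t + τ = u1) ∨ (t + σ = t2 ∨ (t + σ) + τ = u2) := by
    intro t t1 t2 u1 u2 τ σ h
    by_contra hcon
    push Not at hcon
    obtain ⟨⟨k1, k2⟩, k3, k4⟩ := hcon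
    have k1 := z2ne k1
    have k2 := z2ne k2
    have k3 := z2ne k3
    have k4 := z2ne k4
    apply h
    have h2 : (2 : ZMod 2) = 0 := rfl
    linear_combination -k1 - k3 + k2 + k4 - τ * h2
  refine AGM_contr S _ hmm m' (Ed_right n15') ?_
  have keepE : ∀ {x y : ι} {t : ZMod 2}, m' ≠ x → m' ≠ y → (Ed x y, t) ∈ S →
      (Ed x y, t) ∈ prj (Ed m m', τ) m' '' S := fun hx hy h => prj_keep _ _ (Ed_off hx hy) h
  have moveE : ∀ {x : ι} {t : ZMod 2}, m' ≠ x → (Ed x m', t + τ) ∈ S →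
      (Ed x m, t) ∈ prj (Ed m m', τ) m' '' S := by
    intro x t hx h
    rw [Ed_comm x m'] at h
    rw [Ed_comm x m]
    exact prj_edge hx h
  refine AGM_B1 _ a b c d m m'' σ σ' ?_ (keepE (Ne.symm n5') (Ne.symm n9') hab)
    (keepE (Ne.symm n12') (Ne.symm n14') hcd) ?_ ?_ ?_ ?_
  · simp only [List.nodup_cons, List.mem_cons, List.not_mem_nil, or_false, not_or]
    simp [*]
  · intro t
    rcases key t t1 t2 u1 u2 τ σ hs with (rfl | h) | (h | h)
    · exact Or.inl (keepE (Ne.symm n5') (Ne.symm n15') e1)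
    · exact Or.inl (moveE (Ne.symm n5') (h ▸ f1))
    · exact Or.inr (keepE (Ne.symm n9') (Ne.symm n15') (h ▸ e2))
    · exact Or.inr (moveE (Ne.symm n9') (h ▸ f2))
  · intro t
    exact (h2 t).imp (keepE (Ne.symm n5') (Ne.symm n16)) (keepE (Ne.symm n9') (Ne.symm n16))
  · intro t
    rcases key t t3 t4 u3 u4 τ σ' hs' with (rfl | h) | (h | h)
    · exact Or.inl (keepE (Ne.symm n12') (Ne.symm n15') e3)
    · exact Or.inl (moveE (Ne.symm n12') (h ▸ f3))
    · exact Or.inr (keepE (Ne.symm n14') (Ne.symm n15') (h ▸ e4))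
    · exact Or.inr (moveE (Ne.symm n14') (h ▸ f4))
  · intro t
    exact (h4 t).imp (keepE (Ne.symm n12') (Ne.symm n16)) (keepE (Ne.symm n14') (Ne.symm n16))

theorem odd_avail {S : Set ((ι → ZMod 2) × ZMod 2)} {a b m : ι} {t1 t2 σ : ZMod 2}
    (e1 : (Ed a m, t1) ∈ S) (e2 : (Ed b m, t2) ∈ S) (h : σ = t1 + t2 + 1) :
    ∀ t, (Ed a m, t) ∈ S ∨ (Ed b m, t + σ) ∈ S := by
  intro t
  have key : ∀ t t1 t2 σ : ZMod 2, σ = t1 + t2 + 1 → t = t1 ∨ t + σ = t2 := by decide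
  rcases key t t1 t2 σ h with rfl | h
  · exact Or.inl e1
  · exact Or.inr (h ▸ e2)

theorem AGM_disj7 (S : Set ((ι → ZMod 2) × ZMod 2)) (o a b c d m1 m2 m3 : ι)
    (hfull : FullK o S)
    (hnd : [o, a, b, c, d, m1, m2, m3].Nodup)
    (hab : ∀ t, (Ed a b, t) ∈ S) (hcd : ∀ t, (Ed c d, t) ∈ S) : AGM S := by
  have hnd' := hnd
  simp only [List.nodup_cons, List.mem_cons, List.not_mem_nil, or_false, not_or] at hnd'
  obtain ⟨⟨o1, o2, o3, o4, o5, o6, o7⟩, ⟨n1, n2, n3, a1, a2, a3⟩, ⟨n6, n7, b1, b2, b3⟩,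
    ⟨n10, c1, c2, c3⟩, ⟨d1, d2, d3⟩, ⟨x1, x2⟩, x3, -⟩ := hnd'
  have F := fun j k (hj : o ≠ j) (hk : o ≠ k) h => hfull j k (Ne.symm hj) (Ne.symm hk) h
  obtain ⟨ta1, ea1⟩ := F a m1 o1 o5 a1
  obtain ⟨ta2, ea2⟩ := F a m2 o1 o6 a2
  obtain ⟨ta3, ea3⟩ := F a m3 o1 o7 a3
  obtain ⟨tb1, eb1⟩ := F b m1 o2 o5 b1
  obtain ⟨tb2, eb2⟩ := F b m2 o2 o6 b2
  obtain ⟨tb3, eb3⟩ := F b m3 o2 o7 b3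
  obtain ⟨tc1, ec1⟩ := F c m1 o3 o5 c1
  obtain ⟨tc2, ec2⟩ := F c m2 o3 o6 c2
  obtain ⟨tc3, ec3⟩ := F c m3 o3 o7 c3
  obtain ⟨td1, ed1⟩ := F d m1 o4 o5 d1
  obtain ⟨td2, ed2⟩ := F d m2 o4 o6 d2
  obtain ⟨td3, ed3⟩ := F d m3 o4 o7 d3
  obtain ⟨τ12, e12⟩ := F m1 m2 o5 o6 x1
  obtain ⟨τ13, e13⟩ := F m1 m3 o5 o7 x2
  obtain ⟨τ23, e23⟩ := F m2 m3 o6 o7 x3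
  have key : ∀ p1 p2 p3 q1 q2 q3 : ZMod 2,
      (p1 = p2 ∧ q1 = q2) ∨ (p1 = p3 ∧ q1 = q3) ∨ (p2 = p3 ∧ q2 = q3) ∨
      (p1 ≠ p2 ∧ q1 ≠ q2) ∨ (p1 ≠ p3 ∧ q1 ≠ q3) ∨ (p2 ≠ p3 ∧ q2 ≠ q3) := by decide
  rcases key (ta1 + tb1) (ta2 + tb2) (ta3 + tb3) (tc1 + td1) (tc2 + td2) (tc3 + td3) with
    ⟨h, h'⟩ | ⟨h, h'⟩ | ⟨h, h'⟩ | ⟨h, h'⟩ | ⟨h, h'⟩ | ⟨h, h'⟩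
  · refine AGM_B1 S a b c d m1 m2 (ta1 + tb1 + 1) (tc1 + td1 + 1) ?_ (hab _) (hcd _)
      (odd_avail ea1 eb1 rfl) (odd_avail ea2 eb2 (by rw [h]))
      (odd_avail ec1 ed1 rfl) (odd_avail ec2 ed2 (by rw [h']))
    simp [*]
  · refine AGM_B1 S a b c d m1 m3 (ta1 + tb1 + 1) (tc1 + td1 + 1) ?_ (hab _) (hcd _)
      (odd_avail ea1 eb1 rfl) (odd_avail ea3 eb3 (by rw [h]))
      (odd_avail ec1 ed1 rfl) (odd_avail ec3 ed3 (by rw [h']))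
    simp [*]
  · refine AGM_B1 S a b c d m2 m3 (ta2 + tb2 + 1) (tc2 + td2 + 1) ?_ (hab _) (hcd _)
      (odd_avail ea2 eb2 rfl) (odd_avail ea3 eb3 (by rw [h]))
      (odd_avail ec2 ed2 rfl) (odd_avail ec3 ed3 (by rw [h']))
    simp [*]
  · refine AGM_B2 S a b c d m1 m2 m3 (ta3 + tb3 + 1) (tc3 + td3 + 1) τ12 ?_ (hab _) (hcd _) e12
      (odd_avail ea3 eb3 rfl) (odd_avail ec3 ed3 rfl) ea1 eb1 ec1 ed1 ea2 eb2 ec2 ed2 h h'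
    simp [*, Ne.symm x3]
  · refine AGM_B2 S a b c d m1 m3 m2 (ta2 + tb2 + 1) (tc2 + td2 + 1) τ13 ?_ (hab _) (hcd _) e13
      (odd_avail ea2 eb2 rfl) (odd_avail ec2 ed2 rfl) ea1 eb1 ec1 ed1 ea3 eb3 ec3 ed3 h h'
    simp [*]
  · refine AGM_B2 S a b c d m2 m3 m1 (ta1 + tb1 + 1) (tc1 + td1 + 1) τ23 ?_ (hab _) (hcd _) e23
      (odd_avail ea1 eb1 rfl) (odd_avail ec1 ed1 rfl) ea2 eb2 ec2 ed2 ea3 eb3 ec3 ed3 h h'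
    simp [*, Ne.symm x1]

theorem exists_three [Fintype ι] (T : Finset ι) (h : T.card + 3 ≤ Fintype.card ι) :
    ∃ m1 m2 m3 : ι, m1 ∉ T ∧ m2 ∉ T ∧ m3 ∉ T ∧ m1 ≠ m2 ∧ m1 ≠ m3 ∧ m2 ≠ m3 := by
  have : 2 < (Tᶜ).card := by rw [Finset.card_compl]; omega
  obtain ⟨x, hx, y, hy, z, hz, h1, h2, h3⟩ := Finset.two_lt_card.1 this
  exact ⟨x, y, z, by simpa using hx, by simpa using hy, by simpa using hz, h1, h2, h3⟩

/-- doubled edges pairwise meet -/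
theorem dbl_meet [Fintype ι] (hcard : 8 ≤ Fintype.card ι) (S : Set ((ι → ZMod 2) × ZMod 2)) (o : ι)
    (hfull : FullK o S) (hno : ¬ AGM S) (a b c d : ι) (ha : a ≠ o) (hb : b ≠ o) (hc : c ≠ o)
    (hd : d ≠ o) (hne : a ≠ b) (hne' : c ≠ d)
    (hab : ∀ t, (Ed a b, t) ∈ S) (hcd : ∀ t, (Ed c d, t) ∈ S) :
    a = c ∨ a = d ∨ b = c ∨ b = d := by
  by_contra hcon
  push Not at hcon
  obtain ⟨h1, h2, h3, h4⟩ := hcon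
  obtain ⟨m1, m2, m3, k1, k2, k3, e1, e2, e3⟩ := exists_three ({o, a, b, c, d} : Finset ι)
    (by have := Finset.card_le_five (a := o) (b := a) (c := b) (d := c) (e := d); omega)
  simp only [Finset.mem_insert, Finset.mem_singleton, not_or] at k1 k2 k3
  refine hno (AGM_disj7 S o a b c d m1 m2 m3 hfull ?_ hab hcd)
  simp only [List.nodup_cons, List.mem_cons, List.not_mem_nil, or_false, not_or]
  simp [*, ne_comm, eq_comm]
  grind

/-- star lemma -/
theorem AGM_U2 (S : Set ((ι → ZMod 2) × ZMod 2)) (i j k m m' : ι)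
    (hnd : [i, j, k, m, m'].Nodup) (him : ∀ t, (Ed i m, t) ∈ S) (him' : ∀ t, (Ed i m', t) ∈ S)
    {s α β α' β' : ZMod 2} (hjk : (Ed j k, s) ∈ S)
    (h1 : (Ed j m, α) ∈ S) (h2 : (Ed k m, β) ∈ S) (h3 : (Ed j m', α') ∈ S)
    (h4 : (Ed k m', β') ∈ S) (hs : s + α + β = 1) (hs' : s + α' + β' = 1) : AGM S := by
  simp only [List.nodup_cons, List.mem_cons, List.not_mem_nil, or_false, not_or] at hnd
  obtain ⟨⟨n1, n2, n3, n4⟩, ⟨n6, n7, n8⟩, ⟨n10, n11⟩, n13, -⟩ := hnd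
  have key : ∀ t s α β : ZMod 2, s + α + β = 1 → t = α ∨ t + s = β := by decide
  refine AGM_contr S _ hjk k (Ed_right n6) ?_
  refine AGM_C4 _ i j m m' n1 n3 n4 n7 n8 n13 ?_ ?_ ?_ ?_
  · intro t; exact prj_keep _ _ (Ed_off (Ne.symm n2) n10) (him t)
  · intro t
    rcases key t s α β hs with rfl | h
    · exact prj_keep _ _ (Ed_off (Ne.symm n6) n10) h1
    · exact prj_edge n10 (h ▸ h2)
  · intro t; exact prj_keep _ _ (Ed_off (Ne.symm n2) n11) (him' t)
  · intro t
    rcases key t s α' β' hs' with rfl | h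
    · exact prj_keep _ _ (Ed_off (Ne.symm n6) n11) h3
    · exact prj_edge n11 (h ▸ h4)

theorem star_tri [Fintype ι] (hcard : 8 ≤ Fintype.card ι) (S : Set ((ι → ZMod 2) × ZMod 2)) (o i : ι)
    (hfull : FullK o S) (hno : ¬ AGM S)
    (hstar : ∀ k, k ≠ o → k ≠ i → ∀ t, (Ed i k, t) ∈ S)
    (j k m : ι) (hj : j ≠ o) (hk : k ≠ o) (hm : m ≠ o) (hji : j ≠ i) (hki : k ≠ i) (hmi : m ≠ i)
    (hjk : j ≠ k) (hjm : j ≠ m) (hkm : k ≠ m) {s1 s2 s3 : ZMod 2}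
    (h1 : (Ed j k, s1) ∈ S) (h2 : (Ed k m, s2) ∈ S) (h3 : (Ed j m, s3) ∈ S) :
    s1 + s2 + s3 = 0 := by
  by_contra hcon
  obtain ⟨l, -, -, k1, -⟩ := exists_three ({o, i, j, k, m} : Finset ι)
    (by have := Finset.card_le_five (a := o) (b := i) (c := j) (d := k) (e := m); omega)
  simp only [Finset.mem_insert, Finset.mem_singleton, not_or] at k1
  obtain ⟨lo, li, lj, lk, lm⟩ := k1
  obtain ⟨a, ha⟩ := hfull j l hj lo (Ne.symm lj)
  obtain ⟨b, hb⟩ := hfull k l hk lo (Ne.symm lk)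
  obtain ⟨c, hc⟩ := hfull m l hm lo (Ne.symm lm)
  have key : ∀ s1 s2 s3 a b c : ZMod 2, s1 + s2 + s3 ≠ 0 →
    (s1 + s3 + s2 = 1 ∧ s1 + a + b = 1) ∨ (s2 + s1 + s3 = 1 ∧ s2 + b + c = 1) ∨
      (s3 + s1 + s2 = 1 ∧ s3 + a + c = 1) := by decide
  have h1' := h1
  have h2' := h2
  have h3' := h3
  rw [Ed_comm] at h1' h2' h3'
  rcases key s1 s2 s3 a b c hcon with ⟨e, e'⟩ | ⟨e, e'⟩ | ⟨e, e'⟩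
  · refine hno (AGM_U2 S i j k m l ?_ (hstar m hm hmi) (hstar l lo li) h1 h3 h2 ha hb e e')
    simp [*, ne_comm, eq_comm]; grind
  · refine hno (AGM_U2 S i k m j l ?_ (hstar j hj hji) (hstar l lo li) h2 h1' h3' hb hc e e')
    simp [*, ne_comm, eq_comm]; grind
  · refine hno (AGM_U2 S i j m k l ?_ (hstar k hk hki) (hstar l lo li) h3 h1 h2' ha hc e e')
    simp [*, ne_comm, eq_comm]; grind

end AGgraph

open Matroid Set
set_option linter.unusedSectionVars false
set_option linter.unusedSimpArgs false

section AGstruct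
variable {ι : Type*} [DecidableEq ι]

/-- fourth special point -/
def P0 (o a b c : ι) : ι → ZMod 2 := Pi.single o 1 + Pi.single a 1 + Pi.single b 1 + Pi.single c 1

/-- special points of the Fano plane -/
def Psp (o a b c : ι) : Set (ι → ZMod 2) :=
  {Ed o a, Ed o b, Ed o c, P0 o a b c}

/-- edges -/
def Ksp (o : ι) : Set (ι → ZMod 2) :=
  {x | ∃ i j, i ≠ o ∧ j ≠ o ∧ i ≠ j ∧ x = Ed i j}

theorem Ed_inj {i j k l : ι} (hij : i ≠ j) (hkl : k ≠ l) (h : Ed i j = Ed k l) :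
    (i = k ∧ j = l) ∨ (i = l ∧ j = k) := by
  have h1 : ∀ x, (x = i ∨ x = j) → (x = k ∨ x = l) := by
    intro x hx
    by_contra hcon
    push Not at hcon
    have h2 := congrFun h x
    rw [Ed_off hcon.1 hcon.2] at h2
    rcases hx with rfl | rfl
    · rw [Ed_left hij] at h2; exact one_ne_zero h2
    · rw [Ed_right hij] at h2; exact one_ne_zero h2
  have hi := h1 i (Or.inl rfl)
  have hj := h1 j (Or.inr rfl)
  grind

theorem Psp_pair (o a b c : ι) (p) (hp : p ∈ Psp o a b c) (e)
    (he : e = Ed a b ∨ e = Ed a c ∨ e = Ed b c) : ∃ p' ∈ Psp o a b c, p + p' = e := by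
  have key : ∀ x y z w : ZMod 2, (x + y) + (x + z) = y + z ∧
      (x + y) + (x + y + z + w) = z + w ∧ (x + z) + (x + y + z + w) = y + w ∧
      (x + w) + (x + y + z + w) = y + z ∧ (x + w) + (x + z) = z + w := by decide
  have k1 : ∀ y z, Ed o y + Ed o z = Ed y z := fun y z => by
    rw [Ed_comm o y, Ed_tri]
  have k2 : Ed o a + P0 o a b c = Ed b c := by
    ext l; exact (key _ _ _ _).2.1
  have k3 : Ed o b + P0 o a b c = Ed a c := by
    ext l; exact (key _ _ _ _).2.2.1
  have k4 : Ed o c + P0 o a b c = Ed a b := by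
    ext l; exact (key _ _ _ _).2.2.2.1
  have ma : Ed o a ∈ Psp o a b c := by simp [Psp]
  have mb : Ed o b ∈ Psp o a b c := by simp [Psp]
  have mc : Ed o c ∈ Psp o a b c := by simp [Psp]
  have m0 : P0 o a b c ∈ Psp o a b c := by simp [Psp]
  rcases hp with rfl | rfl | rfl | rfl <;> rcases he with rfl | rfl | rfl
  · exact ⟨_, mb, k1 _ _⟩
  · exact ⟨_, mc, k1 _ _⟩
  · exact ⟨_, m0, k2⟩
  · exact ⟨_, ma, by rw [k1, Ed_comm]⟩
  · exact ⟨_, m0, k3⟩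
  · exact ⟨_, mc, k1 _ _⟩
  · exact ⟨_, m0, k4⟩
  · exact ⟨_, ma, by rw [k1, Ed_comm]⟩
  · exact ⟨_, mb, by rw [k1, Ed_comm]⟩
  · exact ⟨_, mc, by rw [add_comm, k4]⟩
  · exact ⟨_, mb, by rw [add_comm, k3]⟩
  · exact ⟨_, ma, by rw [add_comm, k2]⟩

theorem Psp_o {o a b c : ι} (ha : a ≠ o) (hb : b ≠ o) (hc : c ≠ o) {p} (hp : p ∈ Psp o a b c) :
    p o = 1 := by
  rcases hp with rfl | rfl | rfl | rfl
  · exact Ed_left ha.symm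
  · exact Ed_left hb.symm
  · exact Ed_left hc.symm
  · simp [P0, Pi.single_apply, ha.symm, hb.symm, hc.symm]

/-- contraction of a special point -/
theorem sp_contr {S : Set ((ι → ZMod 2) × ZMod 2)} {o : ι} (hfull : FullK o S) (hno : ¬ AGM S)
    {p' : ι → ZMod 2} {s' : ZMod 2} (hp' : p' o = 1) (h : (p', s') ∈ S) :
    FullK o (prj (p', s') o '' S) ∧ ¬ AGM (prj (p', s') o '' S) ∧
    (∀ j k t, j ≠ o → k ≠ o → (Ed j k, t) ∈ S → (Ed j k, t) ∈ prj (p', s') o '' S) ∧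
    (∀ p t, p o = 1 → (p, t) ∈ S → (p + p', t + s') ∈ prj (p', s') o '' S) := by
  have h3 : ∀ j k t, j ≠ o → k ≠ o → (Ed j k, t) ∈ S → (Ed j k, t) ∈ prj (p', s') o '' S :=
    fun j k t hj hk h => prj_keep _ _ (Ed_off hj.symm hk.symm) h
  refine ⟨?_, ?_, h3, ?_⟩
  · intro j k hj hk hjk
    obtain ⟨t, ht⟩ := hfull j k hj hk hjk
    exact ⟨t, h3 j k t hj hk ht⟩
  · exact fun hA => hno (AGM_contr S _ h o hp' hA)
  · intro p t hp hpt
    exact prj_move _ _ _ hp hpt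

theorem exists_star [Fintype ι] (hcard : 8 ≤ Fintype.card ι) (S : Set ((ι → ZMod 2) × ZMod 2))
    (o a b c : ι) (hnd : [o, a, b, c].Nodup)
    (hfull : FullK o S) (hsp : ∀ p ∈ Psp o a b c, ∃ t, (p, t) ∈ S) (hno : ¬ AGM S)
    (D : Finset (ι → ZMod 2)) (hD : ∀ v ∈ D, v ∈ Ksp o ∪ Psp o a b c)
    (hDS : ∀ v ∈ D, ∀ t, (v, t) ∈ S) (hDc : Fintype.card ι ≤ D.card + 2) :
    ∃ i, i ≠ o ∧ ∀ k, k ≠ o → k ≠ i → ∀ t, (Ed i k, t) ∈ S := by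
  simp only [List.nodup_cons, List.mem_cons, List.not_mem_nil, or_false, not_or] at hnd
  obtain ⟨⟨oa, ob, oc⟩, ⟨ab, ac⟩, bc, -⟩ := hnd
  by_cases hP : ∃ p ∈ D, p ∈ Psp o a b c
  · exfalso
    obtain ⟨p, hpD, hp⟩ := hP
    -- any doubled edge meets any edge of the triangle
    have hmeet : ∀ x y, x ≠ o → y ≠ o → x ≠ y →
        (Ed x y = Ed a b ∨ Ed x y = Ed a c ∨ Ed x y = Ed b c) →
        ∀ j k, j ≠ o → k ≠ o → j ≠ k → Ed j k ∈ D → j = x ∨ j = y ∨ k = x ∨ k = y := by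
      intro x y hx hy hxy he j k hj hk hjk hjkD
      obtain ⟨p', hp', hpp⟩ := Psp_pair o a b c p hp _ he
      obtain ⟨s', hs'⟩ := hsp p' hp'
      obtain ⟨c1, c2, c3, c4⟩ := sp_contr hfull hno
        (Psp_o (Ne.symm oa) (Ne.symm ob) (Ne.symm oc) hp') hs'
      refine dbl_meet hcard _ o c1 c2 j k x y hj hk hx hy hjk hxy
        (fun t => c3 _ _ _ hj hk (hDS _ hjkD t)) ?_
      intro t
      have := c4 p (t + s') (Psp_o (Ne.symm oa) (Ne.symm ob) (Ne.symm oc) hp) (hDS _ hpD _)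
      rwa [hpp, add_assoc, CharTwo.add_self_eq_zero, add_zero] at this
    let T : Finset (ι → ZMod 2) := {Ed o a, Ed o b, Ed o c, P0 o a b c, Ed a b, Ed a c, Ed b c}
    have hT : T.card ≤ 7 := by
      refine (Finset.card_insert_le _ _).trans (Nat.succ_le_succ ?_)
      exact Finset.card_le_six
    have hDT : D ⊆ T := by
      intro v hv
      rcases hD v hv with ⟨j, k, hj, hk, hjk, rfl⟩ | h
      · have h1 := hmeet a b (Ne.symm oa) (Ne.symm ob) ab (Or.inl rfl) j k hj hk hjk hv
        have h2 := hmeet a c (Ne.symm oa) (Ne.symm oc) ac (Or.inr (Or.inl rfl)) j k hj hk hjk hv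
        have h3 := hmeet b c (Ne.symm ob) (Ne.symm oc) bc (Or.inr (Or.inr rfl)) j k hj hk hjk hv
        have : (j = a ∧ k = b) ∨ (j = a ∧ k = c) ∨ (j = b ∧ k = a) ∨ (j = b ∧ k = c) ∨
          (j = c ∧ k = a) ∨ (j = c ∧ k = b) := by grind
        rcases this with ⟨rfl, rfl⟩ | ⟨rfl, rfl⟩ | ⟨rfl, rfl⟩ | ⟨rfl, rfl⟩ | ⟨rfl, rfl⟩ | ⟨rfl, rfl⟩
        · simp [T]
        · simp [T]
        · rw [Ed_comm]; simp [T]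
        · simp [T]
        · rw [Ed_comm]; simp [T]
        · rw [Ed_comm]; simp [T]
      · rcases h with rfl | rfl | rfl | rfl <;> simp [T]
    have hmiss : ∀ x ∈ T, ∀ y ∈ T, x ≠ y → x ∉ D → y ∈ D := by
      intro x hx y hy hxy hxD
      by_contra hyD
      have hsub : D ⊆ (T.erase x).erase y := by
        intro v hv
        rw [Finset.mem_erase, Finset.mem_erase]
        exact ⟨fun h => hyD (h ▸ hv), fun h => hxD (h ▸ hv), hDT hv⟩
      have h1 := Finset.card_le_card hsub
      rw [Finset.card_erase_of_mem (Finset.mem_erase.2 ⟨hxy.symm, hy⟩),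
        Finset.card_erase_of_mem hx] at h1
      omega
    have cyc : ∀ x y z, x ≠ o → y ≠ o → z ≠ o → x ≠ y → x ≠ z → y ≠ z → Ed o x ∈ D → Ed o y ∈ D →
        Ed z x ∈ D → Ed z y ∈ D → False := by
      intro x y z hx hy hz hxy hxz hyz h1 h2 h3 h4
      exact hno (AGM_C4 S o z x y hz.symm hx.symm hy.symm hxz.symm hyz.symm hxy
        (hDS _ h1) (hDS _ h3) (hDS _ h2) (hDS _ h4))
    have dist : ∀ {x y z w : ι}, x ≠ y → z ≠ w → x ≠ z → x ≠ w → Ed x y ≠ Ed z w := by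
      intro x y z w hxy hzw h1 h2 h
      rcases Ed_inj hxy hzw h with h | h
      · exact h1 h.1
      · exact h2 h.1
    have moa : Ed o a ∈ T := by simp [T]
    have mob : Ed o b ∈ T := by simp [T]
    have moc : Ed o c ∈ T := by simp [T]
    have mab : Ed a b ∈ T := by simp [T]
    have mac : Ed a c ∈ T := by simp [T]
    have mbc : Ed b c ∈ T := by simp [T]
    have dist' : ∀ {x y z : ι}, x ≠ y → x ≠ z → y ≠ z → Ed x y ≠ Ed x z := by
      intro x y z hxy hxz hyz h
      rcases Ed_inj hxy hxz h with h | h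
      · exact hyz h.2
      · exact hxz h.1
    -- avoidance of a single missing element
    have C1 : Ed o b ∈ D → Ed o c ∈ D → Ed a b ∈ D → Ed a c ∈ D → False :=
      cyc b c a (Ne.symm ob) (Ne.symm oc) (Ne.symm oa) bc (Ne.symm ab) (Ne.symm ac)
    have C2 : Ed o a ∈ D → Ed o c ∈ D → Ed b a ∈ D → Ed b c ∈ D → False :=
      cyc a c b (Ne.symm oa) (Ne.symm oc) (Ne.symm ob) ac ab (Ne.symm bc)
    have C3 : Ed o a ∈ D → Ed o b ∈ D → Ed c a ∈ D → Ed c b ∈ D → False :=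
      cyc a b c (Ne.symm oa) (Ne.symm ob) (Ne.symm oc) ab ac bc
    rw [Ed_comm b a] at C2
    rw [Ed_comm c a, Ed_comm c b] at C3
    by_cases h1 : Ed o a ∈ D
    · by_cases h2 : Ed o b ∈ D
      · by_cases h3 : Ed a c ∈ D
        · by_cases h4 : Ed b c ∈ D
          · exact C3 h1 h2 h3 h4
          · refine C1 h2 (hmiss _ mbc _ moc ?_ h4) (hmiss _ mbc _ mab ?_ h4) h3
            · exact (dist oc bc ob oc).symm
            · rw [Ed_comm a b]; exact dist' bc (Ne.symm ab) (Ne.symm ac)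
        · refine C2 h1 (hmiss _ mac _ moc ?_ h3) (hmiss _ mac _ mab ?_ h3) (hmiss _ mac _ mbc ?_ h3)
          · exact (dist oc ac oa oc).symm
          · exact dist' ac ab (Ne.symm bc)
          · exact dist ac bc ab ac
      · refine C2 h1 (hmiss _ mob _ moc ?_ h2) (hmiss _ mob _ mab ?_ h2) (hmiss _ mob _ mbc ?_ h2)
        · exact dist' ob oc bc
        · exact dist ob ab oa ob
        · exact dist ob bc ob oc
    · refine C1 (hmiss _ moa _ mob ?_ h1) (hmiss _ moa _ moc ?_ h1) (hmiss _ moa _ mab ?_ h1)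
        (hmiss _ moa _ mac ?_ h1)
      · exact dist' oa ob ab
      · exact dist' oa oc ac
      · exact dist oa ab oa ob
      · exact dist oa ac oa oc
  · have hK : ∀ v ∈ D, v ∈ Ksp o := by
      intro v hv
      rcases hD v hv with h | h
      · exact h
      · exact absurd ⟨v, hv, h⟩ hP
    have hmeet : ∀ j k l m, j ≠ o → k ≠ o → j ≠ k → l ≠ o → m ≠ o → l ≠ m → Ed j k ∈ D → Ed l m ∈ D →
        (j = l ∨ j = m ∨ k = l ∨ k = m) := by
      intro j k l m hj hk hjk hl hm hlm h1 h2
      exact dbl_meet hcard S o hfull hno j k l m hj hk hl hm hjk hlm (hDS _ h1) (hDS _ h2)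
    have hne : D.Nonempty := by
      rw [← Finset.card_pos]; omega
    obtain ⟨v, hv⟩ := hne
    obtain ⟨j, k, hj, hk, hjk, rfl⟩ := hK v hv
    have hstar : ∃ i, i ≠ o ∧ ∀ v ∈ D, ∃ l, l ≠ o ∧ l ≠ i ∧ v = Ed i l := by
      by_contra hcon
      push Not at hcon
      obtain ⟨w, hw, hwj⟩ := hcon j hj
      obtain ⟨u, hu, huk⟩ := hcon k hk
      obtain ⟨w1, w2, hw1, hw2, hw12, rfl⟩ := hK w hw
      obtain ⟨u1, u2, hu1, hu2, hu12, rfl⟩ := hK u hu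
      have a1 : w1 ≠ j := fun h => hwj w2 hw2 (h ▸ hw12.symm) (by rw [h])
      have a2 : w2 ≠ j := fun h => hwj w1 hw1 (h ▸ hw12) (by rw [h, Ed_comm])
      have b1 : u1 ≠ k := fun h => huk u2 hu2 (h ▸ hu12.symm) (by rw [h])
      have b2 : u2 ≠ k := fun h => huk u1 hu1 (h ▸ hu12) (by rw [h, Ed_comm])
      have hex : ∃ l, l ≠ o ∧ l ≠ k ∧ l ≠ j ∧ Ed k l ∈ D ∧ Ed j l ∈ D := by
        have m1 := hmeet _ _ _ _ hj hk hjk hw1 hw2 hw12 hv hw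
        have m2 := hmeet _ _ _ _ hj hk hjk hu1 hu2 hu12 hv hu
        have m3 := hmeet _ _ _ _ hu1 hu2 hu12 hw1 hw2 hw12 hu hw
        have c1 := Ed_comm w1 w2
        have c2 := Ed_comm u1 u2
        grind
      obtain ⟨l, hlo, hlk, hlj, hkl, hjl⟩ := hex
      have hsub : D ⊆ {Ed j k, Ed k l, Ed j l} := by
        intro v hv'
        obtain ⟨x, y, hx, hy, hxy, rfl⟩ := hK v hv'
        have m1 := hmeet _ _ _ _ hj hk hjk hx hy hxy hv hv'
        have m2 := hmeet _ _ _ _ hk hlo hlk.symm hx hy hxy hkl hv'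
        have m3 := hmeet _ _ _ _ hj hlo hlj.symm hx hy hxy hjl hv'
        have c1 := Ed_comm x y
        simp only [Finset.mem_insert, Finset.mem_singleton]
        grind
      have := (Finset.card_le_card hsub).trans Finset.card_le_three
      omega
    obtain ⟨i, hi, hall⟩ := hstar
    refine ⟨i, hi, ?_⟩
    have hsub : D ⊆ ({o, i} : Finset ι)ᶜ.image (Ed i) := by
      intro v hv
      obtain ⟨l, h1, h2, rfl⟩ := hall v hv
      exact Finset.mem_image_of_mem _ (by simp [h1, h2])
    have heq := Finset.eq_of_subset_of_card_le hsub (by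
      refine Finset.card_image_le.trans ?_
      rw [Finset.card_compl, Finset.card_pair hi.symm]
      omega)
    intro l hl hli t
    apply hDS
    rw [heq]
    exact Finset.mem_image_of_mem _ (by simp [hl, hli])

end AGstruct

open Matroid Set
set_option linter.unusedSectionVars false
set_option linter.unusedSimpArgs false

section AGlin
variable {ι : Type*} [DecidableEq ι]

theorem star_uniq [Fintype ι] (hcard : 8 ≤ Fintype.card ι) (S : Set ((ι → ZMod 2) × ZMod 2)) (o i : ι)
    (hfull : FullK o S) (hno : ¬ AGM S)
    (hstar : ∀ k, k ≠ o → k ≠ i → ∀ t, (Ed i k, t) ∈ S)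
    (j k : ι) (hj : j ≠ o) (hk : k ≠ o) (hji : j ≠ i) (hki : k ≠ i)
    (hjk : j ≠ k) {s t : ZMod 2} (h1 : (Ed j k, s) ∈ S) (h2 : (Ed j k, t) ∈ S) : s = t := by
  obtain ⟨l, -, -, k1, -⟩ := exists_three ({o, i, j, k} : Finset ι)
    (by have := Finset.card_le_four (a := o) (b := i) (c := j) (d := k); omega)
  simp only [Finset.mem_insert, Finset.mem_singleton, not_or] at k1
  obtain ⟨lo, li, lj, lk⟩ := k1
  obtain ⟨a, ha⟩ := hfull j l hj lo (Ne.symm lj)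
  obtain ⟨b, hb⟩ := hfull k l hk lo (Ne.symm lk)
  have e1 := star_tri hcard S o i hfull hno hstar j k l hj hk lo hji hki li hjk (Ne.symm lj)
    (Ne.symm lk) h1 hb ha
  have e2 := star_tri hcard S o i hfull hno hstar j k l hj hk lo hji hki li hjk (Ne.symm lj)
    (Ne.symm lk) h2 hb ha
  linear_combination e1 - e2

theorem star_linear [Fintype ι] (hcard : 8 ≤ Fintype.card ι) (S : Set ((ι → ZMod 2) × ZMod 2))
    (o a b c i : ι) (hnd : [o, a, b, c].Nodup) (hi : i ≠ o)
    (hfull : FullK o S) (hsp : ∀ p ∈ Psp o a b c, ∃ t, (p, t) ∈ S) (hno : ¬ AGM S)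
    (hstar : ∀ k, k ≠ o → k ≠ i → ∀ t, (Ed i k, t) ∈ S) :
    ∃ μ : ι → ZMod 2, ∀ v ∈ Ksp o ∪ Psp o a b c,
      (∃ k, k ≠ o ∧ k ≠ i ∧ v = Ed i k) ∨ ∀ t, (v, t) ∈ S → t = μ ⬝ᵥ v := by
  simp only [List.nodup_cons, List.mem_cons, List.not_mem_nil, or_false, not_or] at hnd
  obtain ⟨⟨oa, ob, oc⟩, ⟨ab, ac⟩, bc, -⟩ := hnd
  obtain ⟨m0, -, -, k1, -⟩ := exists_three ({o, i, a, b, c} : Finset ι)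
    (by have := Finset.card_le_five (a := o) (b := i) (c := a) (d := b) (e := c); omega)
  simp only [Finset.mem_insert, Finset.mem_singleton, not_or] at k1
  obtain ⟨mo, mi, -, -, -⟩ := k1
  have hs : ∀ j, ∃ t, (j ≠ o → j ≠ m0 → (Ed j m0, t) ∈ S) ∧ (j = m0 → t = 0) := by
    intro j
    by_cases h : j ≠ o ∧ j ≠ m0
    · obtain ⟨t, ht⟩ := hfull j m0 h.1 mo h.2
      exact ⟨t, fun _ _ => ht, fun h' => absurd h' h.2⟩
    · exact ⟨0, fun h1 h2 => absurd ⟨h1, h2⟩ h, fun _ => rfl⟩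
  choose lam hlam hlam0 using hs
  have C1 : ∀ j k t, j ≠ o → k ≠ o → j ≠ i → k ≠ i → j ≠ k → (Ed j k, t) ∈ S →
      t = lam j + lam k := by
    intro j k t hj hk hji hki hjk h
    by_cases h1 : j = m0
    · subst h1
      rw [hlam0 j rfl, zero_add]
      rw [Ed_comm] at h
      exact star_uniq hcard S o i hfull hno hstar k j hk hj hki hji hjk.symm h
        (hlam k hk hjk.symm)
    · by_cases h2 : k = m0
      · subst h2
        rw [hlam0 k rfl, add_zero]
        exact star_uniq hcard S o i hfull hno hstar j k hj hk hji hki hjk h (hlam j hj hjk)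
      · have := star_tri hcard S o i hfull hno hstar j k m0 hj hk mo hji hki mi hjk h1 h2 h
          (hlam k hk h2) (hlam j hj h1)
        revert this
        generalize lam j = x
        generalize lam k = y
        revert t x y
        intro t _ x y e
        have h2 : (2 : ZMod 2) = 0 := rfl
        linear_combination e - (x + y) * h2
  have C2 : ∀ p p' j k t t', p ∈ Psp o a b c → p' ∈ Psp o a b c → j ≠ o → k ≠ o → j ≠ i → k ≠ i →
      j ≠ k → p + p' = Ed j k → (p, t) ∈ S → (p', t') ∈ S → t = t' + lam j + lam k := by
    intro p p' j k t t' hp hp' hj hk hji hki hjk hpp h h'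
    obtain ⟨c1, c2, c3, c4⟩ := sp_contr hfull hno
        (Psp_o (Ne.symm oa) (Ne.symm ob) (Ne.symm oc) hp') h'
    obtain ⟨s, hs⟩ := hfull j k hj hk hjk
    have e1 := c4 p t (Psp_o (Ne.symm oa) (Ne.symm ob) (Ne.symm oc) hp) h
    rw [hpp] at e1
    have e2 := star_uniq hcard _ o i c1 c2 (fun k hk hki t => c3 _ _ _ hi hk (hstar k hk hki t))
      j k hj hk hji hki hjk e1 (c3 _ _ _ hj hk hs)
    have e3 := C1 j k s hj hk hji hki hjk hs
    have h2 : (2 : ZMod 2) = 0 := rfl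
    linear_combination e2 + e3 - t' * h2
  have k0 : ∀ y z, Ed o y + Ed o z = Ed y z := fun y z => by
    rw [Ed_comm o y, Ed_tri]
  have key : ∀ x y z w : ZMod 2, (x + y) + (x + z) = y + z ∧
      (x + y) + (x + y + z + w) = z + w ∧ (x + z) + (x + y + z + w) = y + w ∧
      (x + w) + (x + y + z + w) = y + z ∧ (x + w) + (x + z) = z + w := by decide
  have k2 : Ed o a + P0 o a b c = Ed b c := by
    ext l; exact (key _ _ _ _).2.1
  have k3 : Ed o b + P0 o a b c = Ed a c := by
    ext l; exact (key _ _ _ _).2.2.1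
  have k4 : Ed o c + P0 o a b c = Ed a b := by
    ext l; exact (key _ _ _ _).2.2.2.1
  have ma : Ed o a ∈ Psp o a b c := by simp [Psp]
  have mb : Ed o b ∈ Psp o a b c := by simp [Psp]
  have mc : Ed o c ∈ Psp o a b c := by simp [Psp]
  have m0' : P0 o a b c ∈ Psp o a b c := by simp [Psp]
  obtain ⟨ta, hta⟩ := hsp _ ma
  obtain ⟨tb, htb⟩ := hsp _ mb
  obtain ⟨tc, htc⟩ := hsp _ mc
  obtain ⟨t0, ht0⟩ := hsp _ m0'
  have dE : ∀ (μ : ι → ZMod 2) j k, μ ⬝ᵥ Ed j k = μ j + μ k := by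
    intro μ j k; simp [Ed, dotProduct_add]
  have dP : ∀ (μ : ι → ZMod 2), μ ⬝ᵥ P0 o a b c = μ o + μ a + μ b + μ c := by
    intro μ; simp [P0, dotProduct_add]
  have h2 : (2 : ZMod 2) = 0 := rfl
  -- reduction: it suffices to find values at `o` and `i`
  suffices H : ∃ x y : ZMod 2, ∀ μ : ι → ZMod 2, μ o = x → μ i = y →
      (∀ j, j ≠ o → j ≠ i → μ j = lam j) →
      (∀ t, (Ed o a, t) ∈ S → t = μ o + μ a) ∧ (∀ t, (Ed o b, t) ∈ S → t = μ o + μ b) ∧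
      (∀ t, (Ed o c, t) ∈ S → t = μ o + μ c) ∧
      (∀ t, (P0 o a b c, t) ∈ S → t = μ o + μ a + μ b + μ c) by
    obtain ⟨x, y, hxy⟩ := H
    let μ : ι → ZMod 2 := fun j => if j = o then x else if j = i then y else lam j
    have hμo : μ o = x := by simp [μ]
    have hμi : μ i = y := by simp [μ, hi]
    have hμ : ∀ j, j ≠ o → j ≠ i → μ j = lam j := by
      intro j h1 h2; simp [μ, h1, h2]
    obtain ⟨q1, q2, q3, q4⟩ := hxy μ hμo hμi hμ
    refine ⟨μ, ?_⟩
    rintro v (⟨j, k, hj, hk, hjk, rfl⟩ | hv)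
    · by_cases h1 : j = i
      · subst h1
        exact Or.inl ⟨k, hk, hjk.symm, rfl⟩
      · by_cases h2 : k = i
        · subst h2
          exact Or.inl ⟨j, hj, hjk, Ed_comm _ _⟩
        · right
          intro t ht
          rw [dE, hμ j hj h1, hμ k hk h2]
          exact C1 j k t hj hk h1 h2 hjk ht
    · right
      rcases hv with rfl | rfl | rfl | rfl
      · intro t ht; rw [dE]; exact q1 t ht
      · intro t ht; rw [dE]; exact q2 t ht
      · intro t ht; rw [dE]; exact q3 t ht
      · intro t ht; rw [dP]; exact q4 t ht
  have oa' := Ne.symm oa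
  have ob' := Ne.symm ob
  have oc' := Ne.symm oc
  -- the relations along the three lines, for edges missing `i`
  have Rab : a ≠ i → b ≠ i → (∀ t t', (Ed o a, t) ∈ S → (Ed o b, t') ∈ S → t = t' + lam a + lam b) ∧
      (∀ t t', (Ed o c, t) ∈ S → (P0 o a b c, t') ∈ S → t = t' + lam a + lam b) := by
    intro h1 h2
    exact ⟨fun t t' h h' => C2 _ _ a b t t' ma mb oa' ob' h1 h2 ab (k0 _ _) h h',
      fun t t' h h' => C2 _ _ a b t t' mc m0' oa' ob' h1 h2 ab k4 h h'⟩
  have Rac : a ≠ i → c ≠ i → (∀ t t', (Ed o a, t) ∈ S → (Ed o c, t') ∈ S → t = t' + lam a + lam c) ∧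
      (∀ t t', (Ed o b, t) ∈ S → (P0 o a b c, t') ∈ S → t = t' + lam a + lam c) := by
    intro h1 h2
    exact ⟨fun t t' h h' => C2 _ _ a c t t' ma mc oa' oc' h1 h2 ac (k0 _ _) h h',
      fun t t' h h' => C2 _ _ a c t t' mb m0' oa' oc' h1 h2 ac k3 h h'⟩
  have Rbc : b ≠ i → c ≠ i → (∀ t t', (Ed o b, t) ∈ S → (Ed o c, t') ∈ S → t = t' + lam b + lam c) ∧
      (∀ t t', (Ed o a, t) ∈ S → (P0 o a b c, t') ∈ S → t = t' + lam b + lam c) := by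
    intro h1 h2
    exact ⟨fun t t' h h' => C2 _ _ b c t t' mb mc ob' oc' h1 h2 bc (k0 _ _) h h',
      fun t t' h h' => C2 _ _ b c t t' ma m0' ob' oc' h1 h2 bc k2 h h'⟩
  by_cases ia : a = i
  · subst ia
    obtain ⟨r1, r2⟩ := Rbc (Ne.symm ab) (Ne.symm ac)
    refine ⟨tb + lam b, ta + tb + lam b, ?_⟩
    intro μ e1 e2 e3
    rw [e1, e2, e3 b ob' (Ne.symm ab), e3 c oc' (Ne.symm ac)]
    refine ⟨fun t ht => ?_, fun t ht => ?_, fun t ht => ?_, fun t ht => ?_⟩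
    · linear_combination r2 t _ ht ht0 - r2 _ _ hta ht0 - (tb + lam b) * h2
    · linear_combination r1 t _ ht htc - r1 _ _ htb htc - lam b * h2
    · linear_combination -r1 tb t htb ht - (lam b + lam c) * h2
    · linear_combination -r2 ta t hta ht - (lam b + lam b + lam c + tb) * h2
  by_cases ib : b = i
  · subst ib
    obtain ⟨r1, r2⟩ := Rac ab (Ne.symm bc)
    refine ⟨ta + lam a, tb + ta + lam a, ?_⟩
    intro μ e1 e2 e3
    rw [e1, e2, e3 a oa' ab, e3 c oc' (Ne.symm bc)]
    refine ⟨fun t ht => ?_, fun t ht => ?_, fun t ht => ?_, fun t ht => ?_⟩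
    · linear_combination r1 t _ ht htc - r1 _ _ hta htc - lam a * h2
    · linear_combination r2 t _ ht ht0 - r2 _ _ htb ht0 - (ta + lam a) * h2
    · linear_combination -r1 ta t hta ht - (lam a + lam c) * h2
    · linear_combination -r2 tb t htb ht - (lam a + lam a + lam c + ta) * h2
  by_cases ic : c = i
  · subst ic
    obtain ⟨r1, r2⟩ := Rab ac bc
    refine ⟨ta + lam a, tc + ta + lam a, ?_⟩
    intro μ e1 e2 e3
    rw [e1, e2, e3 a oa' ac, e3 b ob' bc]
    refine ⟨fun t ht => ?_, fun t ht => ?_, fun t ht => ?_, fun t ht => ?_⟩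
    · linear_combination r1 t _ ht htb - r1 _ _ hta htb - lam a * h2
    · linear_combination -r1 ta t hta ht - (lam a + lam b) * h2
    · linear_combination r2 t _ ht ht0 - r2 _ _ htc ht0 - (ta + lam a) * h2
    · linear_combination -r2 tc t htc ht - (lam a + lam a + lam b + ta) * h2
  · obtain ⟨r1, r2⟩ := Rab ia ib
    obtain ⟨r3, r4⟩ := Rac ia ic
    obtain ⟨r5, r6⟩ := Rbc ib ic
    refine ⟨ta + lam a, 0, ?_⟩
    intro μ e1 e2 e3
    rw [e1, e3 a oa' ia, e3 b ob' ib, e3 c oc' ic]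
    refine ⟨fun t ht => ?_, fun t ht => ?_, fun t ht => ?_, fun t ht => ?_⟩
    · linear_combination r1 t _ ht htb - r1 _ _ hta htb - lam a * h2
    · linear_combination -r1 ta t hta ht - (lam a + lam b) * h2
    · linear_combination -r3 ta t hta ht - (lam a + lam c) * h2
    · linear_combination -r6 ta t hta ht - (lam a + lam b + lam c) * h2

end AGlin

open Matroid Set
set_option linter.unusedSectionVars false
set_option linter.unusedSimpArgs false

section AGmat
variable {α : Type*} {V : Type*} [AddCommGroup V] [Module (ZMod 2) V]

theorem rep_iff {M : Matroid α} {φ : α → V} (h : M.IsRepBy (ZMod 2) φ) {I : Set α} (hI : I ⊆ M.E) :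
    M.Indep I ↔ LinearIndepOn (ZMod 2) φ I := h I hI

/-- contraction in a represented matroid -/
theorem con_indep {M : Matroid α} {φ : α → V} (h : M.IsRepBy (ZMod 2) φ) (C : Set α) (hC : C ⊆ M.E)
    (I : Set α) (hI : I ⊆ M.E) (hd : Disjoint C I) :
    (M.con C).Indep I ↔
      LinearIndepOn (ZMod 2) ((Submodule.span (ZMod 2) (φ '' C)).mkQ ∘ φ) I := by
  obtain ⟨J, hJ⟩ := M.exists_isBasis C
  have h1 : (M.con C).Indep I ↔ M.Indep (I ∪ J) ∧ Disjoint C I := by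
    change (M ／ C).Indep I ↔ _
    exact hJ.isBasis'.contract_indep_iff
  have hJI : LinearIndepOn (ZMod 2) φ J := (rep_iff h (hJ.subset.trans hC)).1 hJ.indep
  have hspan : Submodule.span (ZMod 2) (φ '' J) = Submodule.span (ZMod 2) (φ '' C) := by
    apply le_antisymm (Submodule.span_mono (image_mono hJ.subset))
    rw [Submodule.span_le]
    rintro _ ⟨e, he, rfl⟩
    by_contra hcon
    have heJ : e ∉ J := fun h => hcon (Submodule.subset_span ⟨e, h, rfl⟩)
    have h2 : LinearIndepOn (ZMod 2) φ (insert e J) := (linearIndepOn_insert heJ).2 ⟨hJI, hcon⟩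
    have h3 := (rep_iff h (insert_subset (hC he) (hJ.subset.trans hC))).2 h2
    exact heJ (hJ.mem_of_insert_indep he h3)
  rw [h1, and_iff_left hd, union_comm,
    rep_iff h (union_subset (hJ.subset.trans hC) hI),
    linearIndepOn_union_iff_quotient (hd.mono_left hJ.subset), hspan, and_iff_right hJI]

theorem AGM_minor {M : Matroid α} {φ : α → V} (h : M.IsRepBy (ZMod 2) φ) (hA : AGM (φ '' M.E)) :
    M.HasAGMinor := by
  classical
  obtain ⟨C, hC, L, hL, hav⟩ := hA
  let C0 := {e ∈ M.E | φ e ∈ C}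
  have hC0 : C0 ⊆ M.E := fun e he => he.1
  have hC0C : φ '' C0 = C := by
    ext v; constructor
    · rintro ⟨e, he, rfl⟩; exact he.2
    · intro hv
      obtain ⟨e, he, rfl⟩ := hC hv
      exact ⟨e, ⟨he, hv⟩, rfl⟩
  let q := (Submodule.span (ZMod 2) (φ '' C0)).mkQ
  let L' := q.comp L
  have hL' : Function.Injective L' := by
    rw [← LinearMap.ker_eq_bot, LinearMap.ker_eq_bot']
    intro y hy
    apply hL
    rw [← hC0C]
    simpa [L', q] using hy
  have hs : ∀ y, ∃ e, y ∈ agVecs → e ∈ M.E ∧ q (φ e) = L' y := by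
    intro y
    by_cases hy : y ∈ agVecs
    · obtain ⟨_, ⟨e, he, rfl⟩, h2⟩ := hav y hy
      refine ⟨e, fun _ => ⟨he, ?_⟩⟩
      rw [← hC0C] at h2
      exact (Submodule.Quotient.eq _).2 h2
    · obtain ⟨_, ⟨e, he, rfl⟩, h2⟩ := hav (Pi.single 0 1) (by simp [agVecs])
      exact ⟨e, fun h => absurd h hy⟩
  choose s hs using hs
  let R := s '' agVecs
  have hRE : R ⊆ M.E := by
    rintro _ ⟨y, hy, rfl⟩; exact (hs y hy).1
  have hdisj : Disjoint C0 R := by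
    rw [Set.disjoint_left]
    rintro _ he ⟨y, hy, rfl⟩
    have h1 : q (φ (s y)) = 0 := by
      simpa [q] using Submodule.subset_span (Set.mem_image_of_mem φ he)
    rw [(hs y hy).2] at h1
    have : y = 0 := hL' (by rw [h1, map_zero])
    rw [this] at hy
    simp [agVecs] at hy
  let ψ : α → (Fin 4 → ZMod 2) := fun e => Function.invFun L' (q (φ e))
  have hψs : ∀ y ∈ agVecs, ψ (s y) = y := by
    intro y hy
    simp only [ψ, (hs y hy).2]
    exact Function.leftInverse_invFun hL' y
  have hLψ : ∀ e ∈ R, L' (ψ e) = q (φ e) := by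
    rintro _ ⟨y, hy, rfl⟩
    rw [hψs y hy, (hs y hy).2]
  have hconE : (M.con C0).E = M.E \ C0 := rfl
  have hE : ((M.con C0).del ((M.con C0).E \ R)).E = R := by
    change (M.con C0).E \ ((M.con C0).E \ R) = R
    rw [sdiff_sdiff_right_self, hconE]
    apply inter_eq_right.2
    exact fun e he => ⟨hRE he, fun h' => Set.disjoint_left.1 hdisj h' he⟩
  refine ⟨(M.con C0).del ((M.con C0).E \ R), ⟨C0, _, rfl⟩, ψ, ?_, ?_⟩
  · intro I hI
    rw [hE] at hI
    have h1 : ((M.con C0).del ((M.con C0).E \ R)).Indep I ↔ (M.con C0).Indep I := by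
      have hI' : I ⊆ ((M.con C0).del ((M.con C0).E \ R)).E := by rw [hE]; exact hI
      change ((M.con C0) ↾ _).Indep I ↔ _
      rw [Matroid.restrict_indep_iff]
      exact and_iff_left hI'
    rw [h1, con_indep h C0 hC0 I (hI.trans hRE) (hdisj.mono_right hI)]
    change _ ↔ LinearIndepOn (ZMod 2) ψ I
    have h2 : LinearIndepOn (ZMod 2) (L' ∘ ψ) I ↔ LinearIndepOn (ZMod 2) ψ I :=
      L'.linearIndepOn_iff_of_injOn hL'.injOn
    rw [← h2]
    refine linearIndepOn_congr ?_
    intro e he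
    exact (hLψ e (hI he)).symm
  · rw [hE]
    refine ⟨?_, ?_, ?_⟩
    · rintro _ ⟨y, hy, rfl⟩; rw [hψs y hy]; exact hy
    · rintro _ ⟨y, hy, rfl⟩ _ ⟨y', hy', rfl⟩ hh
      rw [hψs y hy, hψs y' hy'] at hh
      rw [hh]
    · intro y hy; exact ⟨s y, ⟨y, hy, rfl⟩, hψs y hy⟩

end AGmat

open Matroid Set
set_option linter.unusedSectionVars false
set_option linter.unusedSimpArgs false

section Uniq
variable {α : Type*} {U W : Type*} [AddCommGroup U] [Module (ZMod 2) U]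
  [AddCommGroup W] [Module (ZMod 2) W]

theorem dep_sum (f : α → U) (J : Finset α) :
    ¬ LinearIndepOn (ZMod 2) f (J : Set α) ↔ ∃ K ⊆ J, K.Nonempty ∧ ∑ e ∈ K, f e = 0 := by
  classical
  rw [not_linearIndepOn_finset_iff]
  constructor
  · rintro ⟨g, hg, i, hi, hgi⟩
    refine ⟨J.filter (fun e => g e ≠ 0), Finset.filter_subset _ _, ⟨i, by simp [hi, hgi]⟩, ?_⟩
    rw [← hg, Finset.sum_filter]
    refine Finset.sum_congr rfl fun e he => ?_
    rcases z2 (g e) with h | h <;> simp [h]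
  · rintro ⟨K, hK, ⟨i, hi⟩, hs⟩
    refine ⟨fun e => if e ∈ K then 1 else 0, ?_, i, hK hi, by simp [hi]⟩
    rw [← hs]
    simp only [ite_smul, one_smul, zero_smul]
    rw [← Finset.sum_filter]
    congr 1
    ext e
    simp only [Finset.mem_filter]
    exact ⟨fun h => h.2, fun h => ⟨hK h, h⟩⟩

theorem sum_iff_aux (f : α → U) (g : α → W) (X : Set α)
    (h : ∀ I ⊆ X, LinearIndepOn (ZMod 2) f I ↔ LinearIndepOn (ZMod 2) g I) :
    ∀ n, ∀ J : Finset α, J.card ≤ n → (J : Set α) ⊆ X → ∑ e ∈ J, f e = 0 → ∑ e ∈ J, g e = 0 := by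
  classical
  intro n
  induction n with
  | zero =>
    intro J hJ _ _
    have : J = ∅ := by simpa using hJ
    simp [this]
  | succ n ih =>
    intro J hJ hX hf
    by_cases hJe : J = ∅
    · simp [hJe]
    have hne := Finset.nonempty_iff_ne_empty.2 hJe
    have hd : ¬ LinearIndepOn (ZMod 2) f (J : Set α) := (dep_sum f J).2 ⟨J, subset_rfl, hne, hf⟩
    rw [h _ hX, dep_sum] at hd
    obtain ⟨K, hK, hKn, hKg⟩ := hd
    have hd2 : ¬ LinearIndepOn (ZMod 2) g (K : Set α) := (dep_sum g K).2 ⟨K, subset_rfl, hKn, hKg⟩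
    have hKX : (K : Set α) ⊆ X := (Finset.coe_subset.2 hK).trans hX
    by_cases hKJ : K = J
    · rw [← hKJ]; exact hKg
    have hlt : K.card < J.card := Finset.card_lt_card (hK.ssubset_of_ne hKJ)
    rw [← h _ hKX, dep_sum] at hd2
    obtain ⟨K', hK', hKn', hKf⟩ := hd2
    have hc1 := Finset.card_le_card hK'
    have hp := hKn'.card_pos
    have e1 := ih K' (by omega) ((Finset.coe_subset.2 hK').trans hKX) hKf
    have hs : K' ⊆ J := hK'.trans hK
    have c2 := Finset.card_sdiff_add_card_eq_card hs
    have s1 := Finset.sum_sdiff hs (f := f)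
    have s2 := Finset.sum_sdiff hs (f := g)
    rw [hKf, hf, add_zero] at s1
    have e2 := ih (J \ K') (by omega)
      ((Finset.coe_subset.2 Finset.sdiff_subset).trans hX) s1
    rw [← s2, e1, e2, add_zero]

theorem uniq_rep (f : α → U) (g : α → W) (X : Set α)
    (h : ∀ I ⊆ X, LinearIndepOn (ZMod 2) f I ↔ LinearIndepOn (ZMod 2) g I) :
    ∃ L : U →ₗ[ZMod 2] W, (∀ e ∈ X, L (f e) = g e) ∧
      ∀ u ∈ Submodule.span (ZMod 2) (f '' X), L u = 0 → u = 0 := by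
  classical
  let Lf := Finsupp.linearCombination (ZMod 2) (fun e : X => f e)
  let Lg := Finsupp.linearCombination (ZMod 2) (fun e : X => g e)
  have key : ∀ (V : Type _) [AddCommGroup V] [Module (ZMod 2) V] (k : α → V) (c : X →₀ ZMod 2),
      Finsupp.linearCombination (ZMod 2) (fun e : X => k e) c =
        ∑ e ∈ c.support.map (Function.Embedding.subtype _), k e := by
    intro V _ _ k c
    rw [Finsupp.linearCombination_apply, Finsupp.sum, Finset.sum_map]
    refine Finset.sum_congr rfl fun e he => ?_
    rcases z2 (c e) with h | h
    · simp [h] at he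
    · simp [h]
  have key2 : ∀ (V : Type _) [AddCommGroup V] [Module (ZMod 2) V] (k : α → V) (c : X →₀ ZMod 2),
      Finsupp.linearCombination (ZMod 2) (fun e : X => k e) c =
        ∑ e ∈ c.support.map (Function.Embedding.subtype _), k e := by
    intro V _ _ k c
    rw [Finsupp.linearCombination_apply, Finsupp.sum, Finset.sum_map]
    refine Finset.sum_congr rfl fun e he => ?_
    rcases z2 (c e) with h | h
    · simp [h] at he
    · simp [h]
  have hsub : ∀ c : X →₀ ZMod 2,
      ((c.support.map (Function.Embedding.subtype _) : Finset α) : Set α) ⊆ X := by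
    intro c e he
    simp only [Finset.coe_map, Function.Embedding.subtype_apply, mem_image] at he
    obtain ⟨e', -, rfl⟩ := he
    exact e'.2
  have hfg : ∀ c, Lf c = 0 → Lg c = 0 := by
    intro c hc
    simp only [Lf, Lg] at hc ⊢
    rw [key] at hc
    rw [key2]
    exact sum_iff_aux f g X h _ _ le_rfl (hsub c) hc
  have hgf : ∀ c, Lg c = 0 → Lf c = 0 := by
    intro c hc
    simp only [Lf, Lg] at hc ⊢
    rw [key2] at hc
    rw [key]
    exact sum_iff_aux g f X (fun I hI => (h I hI).symm) _ _ le_rfl (hsub c) hc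
  obtain ⟨s, hs⟩ := Lf.rangeRestrict.exists_rightInverse_of_surjective Lf.range_rangeRestrict
  obtain ⟨L, hL⟩ := LinearMap.exists_extend (Lg.comp s)
  have hLL : ∀ c, L (Lf c) = Lg c := by
    intro c
    have h1 : L (Lf c) = Lg (s (Lf.rangeRestrict c)) := by
      have := LinearMap.congr_fun hL (Lf.rangeRestrict c)
      simpa using this
    rw [h1, ← sub_eq_zero, ← map_sub]
    apply hfg
    rw [map_sub, sub_eq_zero]
    have := LinearMap.congr_fun hs (Lf.rangeRestrict c)
    exact congrArg Subtype.val this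
  refine ⟨L, ?_, ?_⟩
  · intro e he
    have := hLL (Finsupp.single ⟨e, he⟩ 1)
    simpa [Lf, Lg] using this
  · intro u hu hLu
    have : u ∈ LinearMap.range Lf := by
      rw [Finsupp.range_linearCombination]
      rwa [image_eq_range] at hu
    obtain ⟨c, rfl⟩ := this
    exact hgf c (by rw [← hLL, hLu])

end Uniq

open Matroid Set
set_option linter.unusedSectionVars false
set_option linter.unusedSimpArgs false

section RepEx
variable {α : Type*} {V W : Type*} [AddCommGroup V] [Module (ZMod 2) V]
  [AddCommGroup W] [Module (ZMod 2) W]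

theorem pair_indep_ne {f : α → V} {e e' : α} (hne : e ≠ e')
    (h1 : f e ≠ 0) (h2 : f e' ≠ 0) (h3 : f e ≠ f e') : LinearIndepOn (ZMod 2) f {e, e'} := by
  rw [LinearIndepOn.pair_iff f hne]
  intro c d hcd
  rcases z2 c with rfl | rfl <;> rcases z2 d with rfl | rfl
  · exact ⟨rfl, rfl⟩
  · simp at hcd; exact absurd hcd h2
  · simp at hcd; exact absurd hcd h1
  · simp only [one_smul] at hcd
    exfalso; apply h3
    calc f e = f e + (f e' + f e') := by rw [← two_smul (ZMod 2) (f e')]; simp [show (2 : ZMod 2) = 0 from rfl]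
      _ = f e' := by rw [← add_assoc, hcd, zero_add]

theorem rep_exists {M : Matroid α} {φ0 : α → V} (h0 : M.IsRepBy (ZMod 2) φ0) (hs : M.IsSimpleM)
    {x : α} (hx : x ∈ M.E) {N : Matroid α} (hN : N.IsSimplificationOf (M.con {x})) {G : Set W}
    (hiso : N.IsBinaryIsoTo G) :
    ∃ φ : α → W × ZMod 2, M.IsRepBy (ZMod 2) φ ∧ φ x = (0, 1) ∧
      (∀ e ∈ M.E, e ≠ x → (φ e).1 ∈ G) ∧ ∀ v ∈ G, ∃ e ∈ M.E, e ≠ x ∧ (φ e).1 = v := by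
  classical
  obtain ⟨X, hX, rfl, -, -, hX3⟩ := hN
  obtain ⟨ψ, hψ, hbij⟩ := hiso
  have hconE : (M.con {x}).E = M.E \ {x} := rfl
  rw [hconE] at hX hX3
  have hXE : X ⊆ M.E := fun e he => (hX he).1
  have hXx : ∀ e ∈ X, e ≠ x := fun e he => (hX he).2
  change BijOn ψ X G at hbij
  let π := (Submodule.span (ZMod 2) (φ0 '' {x})).mkQ
  have hcon : ∀ I ⊆ M.E, x ∉ I → ((M.con {x}).Indep I ↔ LinearIndepOn (ZMod 2) (π ∘ φ0) I) :=
    fun I hI hxI => con_indep h0 {x} (by simpa using hx) I hI (by simpa using hxI)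
  have hrep : ∀ I ⊆ X, LinearIndepOn (ZMod 2) (π ∘ φ0) I ↔ LinearIndepOn (ZMod 2) ψ I := by
    intro I hI
    rw [← hcon I (hI.trans hXE) (fun h => hXx x (hI h) rfl)]
    have h1 := hψ I hI
    rw [Matroid.restrict_indep_iff, and_iff_left hI] at h1
    exact h1
  obtain ⟨L, hL, hLi⟩ := uniq_rep (π ∘ φ0) ψ X hrep
  have nz : ∀ e ∈ M.E, φ0 e ≠ 0 := by
    intro e he
    have := (rep_iff h0 (by simp [he, insert_subset_iff])).1 (hs e he e he)
    simpa using this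
  have ninj : ∀ e ∈ M.E, ∀ f ∈ M.E, e ≠ f → φ0 e ≠ φ0 f := by
    intro e he f hf hne hcontra
    have := (rep_iff h0 (by simp [he, hf, insert_subset_iff])).1 (hs e he f hf)
    rw [LinearIndepOn.pair_iff _ hne] at this
    have h2 := this 1 (-1) (by rw [hcontra, neg_smul, add_neg_cancel])
    exact one_ne_zero h2.1
  obtain ⟨τ, hτ⟩ : ∃ τ : V →ₗ[ZMod 2] ZMod 2, τ (φ0 x) = 1 := by
    by_contra hcon
    push Not at hcon
    apply nz x hx
    rw [← Module.forall_dual_apply_eq_zero_iff (ZMod 2)]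
    intro τ
    exact (z2 (τ (φ0 x))).resolve_right (hcon τ)
  have hπx : π (φ0 x) = 0 := by
    simpa [π] using Submodule.mem_span_singleton_self (φ0 x)
  have hker : ∀ u, π u = 0 → u = 0 ∨ u = φ0 x := by
    intro u hu
    have : u ∈ Submodule.span (ZMod 2) {φ0 x} := by simpa [π] using hu
    obtain ⟨c, rfl⟩ := Submodule.mem_span_singleton.1 this
    rcases z2 c with rfl | rfl <;> simp
  have hnzπ : ∀ e ∈ M.E, e ≠ x → π (φ0 e) ≠ 0 := by
    intro e he hex h
    rcases hker _ h with h | h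
    · exact nz e he h
    · exact ninj e he x hx hex h
  have hpar : ∀ e ∈ M.E, e ≠ x → ∃ f ∈ X, π (φ0 e) = π (φ0 f) := by
    intro e he hex
    have hi : (M.con {x}).Indep {e} := by
      rw [hcon _ (by simpa using he) (by simpa using hex.symm)]
      simpa using hnzπ e he hex
    obtain ⟨f, hf, rfl | hc⟩ := hX3 e ⟨he, hex⟩ hi
    · exact ⟨e, hf, rfl⟩
    · refine ⟨f, hf, ?_⟩
      by_contra hne
      have hef : e ≠ f := fun h => hne (by rw [h])
      have h1 := pair_indep_ne (f := π ∘ φ0) hef (hnzπ e he hex)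
        (hnzπ f (hXE hf) (hXx f hf)) hne
      rw [← hcon _ (by simp [insert_subset_iff, he, hXE hf]) (by
        simp only [mem_insert_iff, mem_singleton_iff, not_or]
        exact ⟨hex.symm, (hXx f hf).symm⟩)] at h1
      exact hc.1.not_indep h1
  let T : V →ₗ[ZMod 2] W × ZMod 2 := (L.comp π).prod τ
  have hTinj : ∀ u ∈ Submodule.span (ZMod 2) (φ0 '' M.E), T u = 0 → u = 0 := by
    intro u hu hTu
    have hT1 : L (π u) = 0 := congrArg Prod.fst hTu
    have hT2 : τ u = 0 := congrArg Prod.snd hTu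
    have h3 : π u ∈ Submodule.span (ZMod 2) ((π ∘ φ0) '' X) := by
      have : Submodule.span (ZMod 2) (φ0 '' M.E) ≤
          (Submodule.span (ZMod 2) ((π ∘ φ0) '' X)).comap π := by
        rw [Submodule.span_le]
        rintro _ ⟨e, he, rfl⟩
        rw [SetLike.mem_coe, Submodule.mem_comap]
        by_cases hex : e = x
        · rw [hex, hπx]; exact Submodule.zero_mem _
        · obtain ⟨f, hf, hef⟩ := hpar e he hex
          rw [hef]
          exact Submodule.subset_span ⟨f, hf, rfl⟩
      exact this hu
    rcases hker u (hLi _ h3 hT1) with h | h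
    · exact h
    · rw [h, hτ] at hT2; exact absurd hT2 one_ne_zero
  refine ⟨fun e => T (φ0 e), ?_, ?_, ?_, ?_⟩
  · intro I hI
    rw [rep_iff h0 hI]
    change _ ↔ LinearIndepOn (ZMod 2) (T ∘ φ0) I
    symm
    apply T.linearIndepOn_iff_of_injOn
    intro u hu v hv huv
    have hm : Submodule.span (ZMod 2) (φ0 '' I) ≤ Submodule.span (ZMod 2) (φ0 '' M.E) :=
      Submodule.span_mono (image_mono hI)
    rw [← sub_eq_zero]
    apply hTinj _ (Submodule.sub_mem _ (hm hu) (hm hv))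
    rw [map_sub, huv, sub_self]
  · change (L (π (φ0 x)), τ (φ0 x)) = _
    rw [hπx, hτ, map_zero]
  · intro e he hex
    obtain ⟨f, hf, hef⟩ := hpar e he hex
    change L (π (φ0 e)) ∈ G
    rw [hef]
    have := hL f hf
    rw [show L (π (φ0 f)) = ψ f from this]
    exact hbij.mapsTo hf
  · intro v hv
    obtain ⟨f, hf, rfl⟩ := hbij.surjOn hv
    exact ⟨f, hXE hf, hXx f hf, hL f hf⟩

end RepEx

open Matroid Set
set_option linter.unusedSectionVars false
set_option linter.unusedSimpArgs false

section Count
variable {ι : Type*} [DecidableEq ι] [Fintype ι]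

theorem gcard (o a b c : ι) : (Ksp o ∪ Psp o a b c).ncard ≤ (Fintype.card ι - 1).choose 2 + 4 := by
  classical
  let K : Finset (ι → ZMod 2) := ((Finset.univ.erase o).powersetCard 2).image
    (fun s => ∑ i ∈ s, Pi.single i 1)
  let P : Finset (ι → ZMod 2) := {Ed o a, Ed o b, Ed o c, P0 o a b c}
  have hsub : Ksp o ∪ Psp o a b c ⊆ ((K ∪ P : Finset _) : Set (ι → ZMod 2)) := by
    rw [Finset.coe_union]
    apply union_subset_union
    · rintro _ ⟨i, j, hi, hj, hij, rfl⟩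
      simp only [K, Finset.coe_image, mem_image, Finset.mem_coe, Finset.mem_powersetCard]
      refine ⟨{i, j}, ⟨?_, Finset.card_pair hij⟩, ?_⟩
      · intro k hk
        simp only [Finset.mem_insert, Finset.mem_singleton] at hk
        rcases hk with rfl | rfl <;> simp [hi, hj]
      · rw [Finset.sum_pair hij]; rfl
    · simp [P, Psp]
  have h1 := Set.ncard_le_ncard hsub (Finset.finite_toSet _)
  rw [Set.ncard_coe_finset] at h1
  have h2 := Finset.card_union_le K P
  have h3 : K.card ≤ (Fintype.card ι - 1).choose 2 := by
    refine Finset.card_image_le.trans ?_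
    rw [Finset.card_powersetCard, Finset.card_erase_of_mem (Finset.mem_univ _), Finset.card_univ]
  have h4 : P.card ≤ 4 := Finset.card_le_four
  omega

theorem double_count {V : Type*} [Finite V] [Zero V] (S : Set (V × ZMod 2)) (G : Set V)
    (h : ∀ p ∈ S, p = (0, 1) ∨ p.1 ∈ G) :
    S.ncard ≤ 1 + G.ncard + {v ∈ G | ∀ t, (v, t) ∈ S}.ncard := by
  classical
  let A : ZMod 2 → Set V := fun t => {v ∈ G | (v, t) ∈ S}
  have hS : S ⊆ {((0 : V), (1 : ZMod 2))} ∪ ((fun v => (v, (0 : ZMod 2))) '' A 0 ∪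
      (fun v => (v, (1 : ZMod 2))) '' A 1) := by
    rintro ⟨v, t⟩ hp
    rcases h _ hp with h | h
    · left; exact h
    · right
      rcases z2 t with rfl | rfl
      · left; exact ⟨v, ⟨h, hp⟩, rfl⟩
      · right; exact ⟨v, ⟨h, hp⟩, rfl⟩
  have h1 := Set.ncard_le_ncard hS (Set.toFinite _)
  have h2 := Set.ncard_union_le {((0 : V), (1 : ZMod 2))} ((fun v => (v, (0 : ZMod 2))) '' A 0 ∪
      (fun v => (v, (1 : ZMod 2))) '' A 1)
  have h3 := Set.ncard_union_le ((fun v => (v, (0 : ZMod 2))) '' A 0)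
      ((fun v => (v, (1 : ZMod 2))) '' A 1)
  have h4 := Set.ncard_image_le (f := fun v => (v, (0 : ZMod 2))) (Set.toFinite (A 0))
  have h5 := Set.ncard_image_le (f := fun v => (v, (1 : ZMod 2))) (Set.toFinite (A 1))
  have h6 := Set.ncard_union_add_ncard_inter (A 0) (A 1)
  have h7 : (A 0 ∪ A 1).ncard ≤ G.ncard :=
    Set.ncard_le_ncard (union_subset (fun v hv => hv.1) (fun v hv => hv.1)) (Set.toFinite _)
  have h8 : (A 0 ∩ A 1).ncard ≤ {v ∈ G | ∀ t, (v, t) ∈ S}.ncard := by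
    apply Set.ncard_le_ncard _ (Set.toFinite _)
    rintro v ⟨ha, hb⟩
    refine ⟨ha.1, fun t => ?_⟩
    rcases z2 t with rfl | rfl
    · exact ha.2
    · exact hb.2
  rw [Set.ncard_singleton] at h2
  omega

end Count

section Final
variable {n : ℕ}

/-- the coordinate change -/
def Fm (i : Fin n) (μ : Fin n → ZMod 2) : ((Fin n → ZMod 2) × ZMod 2) →ₗ[ZMod 2] (Fin (n + 1) → ZMod 2) where
  toFun p := Fin.snoc (α := fun _ => ZMod 2)
    (fun k => p.1 k + if k = i then p.2 + μ ⬝ᵥ p.1 else 0) (p.2 + μ ⬝ᵥ p.1)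
  map_add' p q := by
    ext j
    refine Fin.lastCases ?_ (fun k => ?_) j
    · simp [dotProduct_add]; ring
    · simp [dotProduct_add]; split_ifs <;> ring
  map_smul' c p := by
    ext j
    refine Fin.lastCases ?_ (fun k => ?_) j
    · simp [dotProduct_smul]; ring
    · simp [dotProduct_smul]; split_ifs <;> ring

theorem Fm_last (i : Fin n) (μ p) : Fm i μ p (Fin.last n) = p.2 + μ ⬝ᵥ p.1 := by
  simp [Fm]

theorem Fm_cast (i : Fin n) (μ p) (k : Fin n) :
    Fm i μ p k.castSucc = p.1 k + if k = i then p.2 + μ ⬝ᵥ p.1 else 0 := by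
  simp [Fm]

theorem Fm_inj (i : Fin n) (μ) : Function.Injective (Fm i μ) := by
  rw [← LinearMap.ker_eq_bot, LinearMap.ker_eq_bot']
  rintro ⟨v, t⟩ h
  have h1 : t + μ ⬝ᵥ v = 0 := by
    rw [← Fm_last i μ (v, t), h]; rfl
  have h2 : v = 0 := by
    ext k
    have := Fm_cast i μ (v, t) k
    rw [h] at this
    simp [h1] at this
    exact this.symm
  subst h2
  simp at h1
  simp [h1]

theorem Fm_x (i : Fin n) (μ) : Fm i μ (0, 1) = Ed i.castSucc (Fin.last n) := by
  ext j
  refine Fin.lastCases ?_ (fun k => ?_) j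
  · rw [Fm_last]; simp [Ed, Pi.single_apply, Fin.castSucc_ne_last, (Fin.castSucc_ne_last i).symm]
  · rw [Fm_cast]; simp [Ed, Pi.single_apply, Fin.castSucc_ne_last]

/-- extension by zero -/
def ex0 (v : Fin n → ZMod 2) : Fin (n + 1) → ZMod 2 := Fin.snoc (α := fun _ => ZMod 2) v 0

theorem Fm_zero (i : Fin n) (μ v) : Fm i μ (v, μ ⬝ᵥ v) = ex0 v := by
  ext j
  refine Fin.lastCases ?_ (fun k => ?_) j
  · rw [Fm_last]; simp [ex0, CharTwo.add_self_eq_zero]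
  · rw [Fm_cast]; simp [ex0, CharTwo.add_self_eq_zero]

theorem ex0_add (v w : Fin n → ZMod 2) : ex0 (v + w) = ex0 v + ex0 w := by
  ext j
  refine Fin.lastCases ?_ (fun k => ?_) j <;> simp [ex0]

theorem ex0_single (i : Fin n) : ex0 (Pi.single i 1) = Pi.single i.castSucc 1 := by
  ext j
  refine Fin.lastCases ?_ (fun k => ?_) j
  · simp [ex0, Pi.single_apply, (Fin.castSucc_ne_last i).symm]
  · simp [ex0, Pi.single_apply]

theorem ex0_Ed (i j : Fin n) : ex0 (Ed i j) = Ed i.castSucc j.castSucc := by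
  simp [Ed, ex0_add, ex0_single]

theorem ex0_P0 (o a b c : Fin n) :
    ex0 (P0 o a b c) = P0 o.castSucc a.castSucc b.castSucc c.castSucc := by
  simp [P0, ex0_add, ex0_single]

theorem Fm_one (i k : Fin n) (μ) :
    Fm i μ (Ed i k, μ ⬝ᵥ Ed i k + 1) = Ed k.castSucc (Fin.last n) := by
  have : (Ed i k, μ ⬝ᵥ Ed i k + 1) = (Ed i k, μ ⬝ᵥ Ed i k) + ((0 : Fin n → ZMod 2), (1 : ZMod 2)) := by
    simp
  rw [this, map_add, Fm_zero, Fm_x, ex0_Ed]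
  rw [Ed_comm i.castSucc]
  ext j
  have h1 := CharTwo.add_self_eq_zero (Pi.single (M := fun _ => ZMod 2) i.castSucc 1 j)
  simp only [Ed, Pi.add_apply]
  linear_combination h1

theorem ex0_mem (o a b c : Fin n) (v) (hv : v ∈ Ksp o ∪ Psp o a b c) :
    ex0 v ∈ Ksp o.castSucc ∪ Psp o.castSucc a.castSucc b.castSucc c.castSucc := by
  rcases hv with ⟨i, j, hi, hj, hij, rfl⟩ | hv
  · left
    exact ⟨i.castSucc, j.castSucc, by simpa using hi, by simpa using hj, by simpa using hij, ex0_Ed i j⟩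
  · right
    simp only [Psp, mem_insert_iff, mem_singleton_iff] at hv ⊢
    rcases hv with rfl | rfl | rfl | rfl
    · left; exact ex0_Ed _ _
    · right; left; exact ex0_Ed _ _
    · right; right; left; exact ex0_Ed _ _
    · right; right; right; exact ex0_P0 _ _ _ _

theorem ex0_surj (o a b c : Fin n) (w)
    (hw : w ∈ Ksp o.castSucc ∪ Psp o.castSucc a.castSucc b.castSucc c.castSucc) :
    (∃ v ∈ Ksp o ∪ Psp o a b c, w = ex0 v) ∨ ∃ k, k ≠ o ∧ w = Ed k.castSucc (Fin.last n) := by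
  rcases hw with ⟨i, j, hi, hj, hij, rfl⟩ | hw
  · induction i using Fin.lastCases with
    | last =>
      induction j using Fin.lastCases with
      | last => exact absurd rfl hij
      | cast j => right; exact ⟨j, by simpa using hj, Ed_comm _ _⟩
    | cast i =>
      induction j using Fin.lastCases with
      | last => right; exact ⟨i, by simpa using hi, rfl⟩
      | cast j =>
        left
        exact ⟨Ed i j, Or.inl ⟨i, j, by simpa using hi, by simpa using hj, by simpa using hij, rfl⟩,
          (ex0_Ed i j).symm⟩
  · left
    simp only [Psp, mem_insert_iff, mem_singleton_iff] at hw
    rcases hw with rfl | rfl | rfl | rfl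
    · exact ⟨Ed o a, Or.inr (by simp [Psp]), (ex0_Ed _ _).symm⟩
    · exact ⟨Ed o b, Or.inr (by simp [Psp]), (ex0_Ed _ _).symm⟩
    · exact ⟨Ed o c, Or.inr (by simp [Psp]), (ex0_Ed _ _).symm⟩
    · exact ⟨P0 o a b c, Or.inr (by simp [Psp]), (ex0_P0 _ _ _ _).symm⟩

theorem final_img (S : Set ((Fin n → ZMod 2) × ZMod 2)) (o a b c i : Fin n) (μ : Fin n → ZMod 2)
    (hio : i ≠ o) (hx : (0, 1) ∈ S)
    (hS : ∀ p ∈ S, p = (0, 1) ∨ p.1 ∈ Ksp o ∪ Psp o a b c)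
    (hsurj : ∀ v ∈ Ksp o ∪ Psp o a b c, ∃ t, (v, t) ∈ S)
    (hstar : ∀ k, k ≠ o → k ≠ i → ∀ t, (Ed i k, t) ∈ S)
    (hμ : ∀ v ∈ Ksp o ∪ Psp o a b c,
      (∃ k, k ≠ o ∧ k ≠ i ∧ v = Ed i k) ∨ ∀ t, (v, t) ∈ S → t = μ ⬝ᵥ v) :
    BijOn (Fm i μ) S (Ksp o.castSucc ∪ Psp o.castSucc a.castSucc b.castSucc c.castSucc) := by
  have hlast : ∀ k : Fin n, k ≠ o → Ed k.castSucc (Fin.last n) ∈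
      Ksp o.castSucc ∪ Psp o.castSucc a.castSucc b.castSucc c.castSucc := by
    intro k hk
    exact Or.inl ⟨k.castSucc, Fin.last n, by simpa using hk, (Fin.castSucc_ne_last o).symm,
      Fin.castSucc_ne_last k, rfl⟩
  refine ⟨?_, (Fm_inj i μ).injOn, ?_⟩
  · rintro ⟨v, t⟩ hp
    rcases hS _ hp with h | h
    · rw [h, Fm_x]; exact hlast i hio
    · change v ∈ _ at h
      by_cases ht : t = μ ⬝ᵥ v
      · rw [ht, Fm_zero]; exact ex0_mem _ _ _ _ _ h
      · rcases hμ v h with ⟨k, hk, -, rfl⟩ | h'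
        · rw [z2ne ht, Fm_one]; exact hlast k hk
        · exact absurd (h' t hp) ht
  · intro w hw
    rcases ex0_surj o a b c w hw with ⟨v, hv, rfl⟩ | ⟨k, hk, rfl⟩
    · refine ⟨(v, μ ⬝ᵥ v), ?_, Fm_zero _ _ _⟩
      rcases hμ v hv with ⟨k, hk, hki, rfl⟩ | h'
      · exact hstar k hk hki _
      · obtain ⟨t, ht⟩ := hsurj v hv
        rw [← h' t ht]; exact ht
    · by_cases hki : k = i
      · rw [hki]; exact ⟨(0, 1), hx, Fm_x _ _⟩
      · exact ⟨_, hstar k hk hki _, Fm_one _ _ _⟩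

end Final

theorem structure_claim {α : Type*} (M : Matroid α) (r : ℕ) (hr : 8 ≤ r)
    (hbin : M.IsBinaryM) (hsimple : M.IsSimpleM) (hnonreg : ¬ M.IsRegularM)
    (h3c : M.IsThreeConnected) (hrank : M.rkM = r) (hAG : ¬ M.HasAGMinor)
    (hsize : r.choose 2 + 4 ≤ M.E.ncard)
    (x : α) (hx : x ∈ M.E)
    (hxF7 : ¬ ∃ R ⊆ M.E, x ∈ R ∧ (M ↾ R).IsBinaryIsoTo fanoVecs)
    (hsi : ∃ N : Matroid α, N.IsSimplificationOf (M.con {x}) ∧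
      N.IsBinaryIsoTo (gpcVecs (r - 1))) :
    M.IsBinaryIsoTo (gpcVecs r) := by
  classical
  obtain ⟨m, rfl⟩ : ∃ m, r = m + 8 := ⟨r - 8, by omega⟩
  obtain ⟨N, hN, hiso⟩ := hsi
  obtain ⟨d, φ0, h0⟩ := hbin
  obtain ⟨φ, hφ, hφx, hφG, hφs⟩ := rep_exists h0 hsimple hx hN hiso
  change α → (Fin (m + 8) → ZMod 2) × ZMod 2 at φ
  have hG : gpcVecs (m + 8 - 1) = Ksp (0 : Fin (m + 8)) ∪ Psp 0 1 2 3 := rfl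
  rw [hG] at hφG hφs
  have hinj : InjOn φ M.E := by
    intro e he f hf hef
    by_contra hne
    have := (rep_iff hφ (by simp [he, hf, insert_subset_iff])).1 (hsimple e he f hf)
    rw [LinearIndepOn.pair_iff _ hne] at this
    have h2 := this 1 (-1) (by rw [hef, neg_smul, add_neg_cancel])
    exact one_ne_zero h2.1
  let S := φ '' M.E
  have hno : ¬ AGM S := fun h => hAG (AGM_minor hφ h)
  have hxS : (0, 1) ∈ S := ⟨x, hx, hφx⟩
  have hS : ∀ p ∈ S, p = (0, 1) ∨ p.1 ∈ Ksp (0 : Fin (m + 8)) ∪ Psp 0 1 2 3 := by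
    rintro _ ⟨e, he, rfl⟩
    by_cases hex : e = x
    · left; rw [hex, hφx]
    · right; exact hφG e he hex
  have hsurj : ∀ v ∈ Ksp (0 : Fin (m + 8)) ∪ Psp 0 1 2 3, ∃ t, (v, t) ∈ S := by
    intro v hv
    obtain ⟨e, he, -, rfl⟩ := hφs v hv
    exact ⟨(φ e).2, e, he, rfl⟩
  have hfull : FullK 0 S := fun j k hj hk hjk => hsurj _ (Or.inl ⟨j, k, hj, hk, hjk, rfl⟩)
  have hsp : ∀ p ∈ Psp (0 : Fin (m + 8)) 1 2 3, ∃ t, (p, t) ∈ S := fun p hp => hsurj p (Or.inr hp)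
  have v2 : ((2 : Fin (m + 8)) : ℕ) = 2 := rfl
  have v3 : ((3 : Fin (m + 8)) : ℕ) = 3 := rfl
  have hnd : [(0 : Fin (m + 8)), 1, 2, 3].Nodup := by
    have e2 : 2 % (m + 8) = 2 := Nat.mod_eq_of_lt (by omega)
    have e3 : 3 % (m + 8) = 3 := Nat.mod_eq_of_lt (by omega)
    simp [Fin.ext_iff, e2, e3]
  have hcard : 8 ≤ Fintype.card (Fin (m + 8)) := by simp
  let D : Set (Fin (m + 8) → ZMod 2) := {v ∈ Ksp (0 : Fin (m + 8)) ∪ Psp 0 1 2 3 | ∀ t, (v, t) ∈ S}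
  have hDc : m + 8 ≤ D.ncard + 2 := by
    have h1 := double_count S _ hS
    have h2 := gcard (0 : Fin (m + 8)) 1 2 3
    have h3 : S.ncard = M.E.ncard := hinj.ncard_image
    have h4 : (m + 8).choose 2 = (m + 7) + (m + 7).choose 2 := by
      rw [show m + 8 = (m + 7) + 1 from rfl, Nat.choose_succ_succ' (m + 7) 1, Nat.choose_one_right]
    rw [Fintype.card_fin, show m + 8 - 1 = m + 7 from rfl] at h2
    change _ ≤ _ + D.ncard at h1
    omega
  obtain ⟨i, hi, hstar⟩ := exists_star hcard S 0 1 2 3 hnd hfull hsp hno D.toFinite.toFinset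
    (fun v hv => ((Set.Finite.mem_toFinset _).1 hv).1)
    (fun v hv => ((Set.Finite.mem_toFinset _).1 hv).2)
    (by rw [← Set.ncard_eq_toFinset_card D, Fintype.card_fin]; exact hDc)
  obtain ⟨μ, hμ⟩ := star_linear hcard S 0 1 2 3 i hnd hi hfull hsp hno hstar
  have hb := final_img S 0 1 2 3 i μ hi hxS hS hsurj hstar hμ
  refine ⟨Fm i μ ∘ φ, ?_, ?_⟩
  · intro I hI
    rw [rep_iff hφ hI]
    exact ((Fm i μ).linearIndepOn_iff_of_injOn (Fm_inj i μ).injOn).symm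
  · have : gpcVecs (m + 8) = Ksp (0 : Fin (m + 8)).castSucc ∪ Psp (0 : Fin (m + 8)).castSucc
      (1 : Fin (m + 8)).castSucc (2 : Fin (m + 8)).castSucc (3 : Fin (m + 8)).castSucc := rfl
    rw [this]
    exact hb.comp ⟨mapsTo_image φ M.E, hinj, surjOn_image φ M.E⟩
end
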